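/- For every p < 1/2, the percolation function r ↦ Θ(p,r) of the DaC model is a continuous function of r on [0,1]. -/

import Mathlib

/-!
Common definitions for the Divide-and-Colour (DaC) model of
Bálint, Camia and Meester, "Sharp phase transition and critical
behaviour in 2D divide and colour models".

The model is built concretely: a single uniform random variable on `(0,1]`
is decomposed into countably many i.i.d. uniform random variables (via its
binary digits); one family of uniforms drives the Bernoulli(p) bond
percolation (the edge configuration), and an independent family of uniforms
attaches an independent Bernoulli(r) colour to each bond cluster (the colour
of a cluster is determined by the uniform label of its canonical
representative, the vertex of minimal encoding).  The DaC measure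
`ℙ_{p,r}` is the pushforward of Lebesgue measure on `(0,1]` under the map
producing the pair (edge configuration, colour configuration).
-/

open MeasureTheory ENNReal

namespace DaC

/-- Vertices of the lattice. -/
abbrev V : Type := ℤ × ℤ

/-- Square lattice adjacency: Euclidean distance `1`. -/
def SqAdj (u v : V) : Prop := (u.1 - v.1) ^ 2 + (u.2 - v.2) ^ 2 = 1

/-- `*`-adjacency (matching graph of the square lattice):
Euclidean distance `1` or `√2`. -/
def StarAdj (u v : V) : Prop :=
  (u.1 - v.1) ^ 2 + (u.2 - v.2) ^ 2 = 1 ∨ (u.1 - v.1) ^ 2 + (u.2 - v.2) ^ 2 = 2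

/-- Triangular lattice adjacency. -/
def TriAdj (u v : V) : Prop :=
  (u.1 - v.1, u.2 - v.2) ∈
    ({(1, 0), (-1, 0), (0, 1), (0, -1), (1, 1), (-1, -1)} : Set (ℤ × ℤ))

/-- Classical indicator of a proposition, as a boolean. -/
noncomputable def boolOf (P : Prop) : Bool := @decide P (Classical.propDecidable P)

/-- The `n`-th binary digit of a real number `x ∈ (0,1]`. -/
noncomputable def bit (n : ℕ) (x : ℝ) : Bool := boolOf (⌊x * 2 ^ (n + 1)⌋ % 2 = 1)

/-- A countable family of i.i.d. uniform random variables on `[0,1]`, extracted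
from a single uniform sample `x` by splitting its binary digits. -/
noncomputable def unif (i : ℕ) (x : ℝ) : ℝ :=
  ∑' k : ℕ, if bit (Nat.pair i k) x then ((2 : ℝ)⁻¹) ^ (k + 1) else 0

/-- A symmetric encoding of (unordered) pairs of vertices. -/
noncomputable def eIdx (u v : V) : ℕ :=
  min (Encodable.encode (u, v)) (Encodable.encode (v, u))

/-- The uniform label attached to the edge `{u,v}`. -/
noncomputable def edgeU (u v : V) (x : ℝ) : ℝ := unif (2 * eIdx u v) x

/-- The uniform label attached to the vertex `v` (independent of the edge labels). -/
noncomputable def vtxU (v : V) (x : ℝ) : ℝ := unif (2 * Encodable.encode v + 1) x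

/-- Edge configurations: a boolean (open/closed) for each (ordered) pair of
vertices; configurations arising from the model are symmetric and are
supported on pairs of adjacent vertices. -/
abbrev EdgeCfg : Type := V → V → Bool

/-- Colour configurations: a colour (black = `true`, white = `false`) for each vertex. -/
abbrev ColourCfg : Type := V → Bool

/-- Full configurations of the DaC model: an edge configuration together with
a colour configuration. -/
abbrev Config : Type := EdgeCfg × ColourCfg

/-- The Bernoulli(p) edge configuration determined by the uniform sample `x`,
on the lattice with adjacency `adj`: an edge `{u,v}` of the lattice is open
iff its uniform label is `< p`. -/
noncomputable def edgeCfg (adj : V → V → Prop) (p : ℝ) (x : ℝ) : EdgeCfg :=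
  fun u v => boolOf (adj u v) && boolOf (edgeU u v x < p)

/-- Connectivity through open edges of the edge configuration `η`. -/
def Conn (η : EdgeCfg) (u v : V) : Prop :=
  Relation.ReflTransGen (fun a b => η a b = true) u v

/-- The `p`-cluster of the vertex `v`: its connected component in the graph
retaining only open edges. -/
def pCluster (η : EdgeCfg) (v : V) : Set V := {w | Conn η v w}

/-- Canonical representative of the `p`-cluster of `v`: the vertex of the
cluster with minimal encoding. -/
noncomputable def clusterRep (η : EdgeCfg) (v : V) : V :=
  (Encodable.decode (α := V) (sInf (Encodable.encode '' pCluster η v))).getD v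

/-- The colour configuration with parameters `p, r` determined by the uniform
sample `x`: every `p`-cluster is coloured black (with probability `r`)
or white, independently of all other `p`-clusters, according to the uniform
label of its canonical representative. -/
noncomputable def colourCfg (adj : V → V → Prop) (p r : ℝ) (x : ℝ) : ColourCfg :=
  fun v => boolOf (vtxU (clusterRep (edgeCfg adj p x) v) x < r)

/-- The uniform sample: Lebesgue measure on `(0,1]`. -/
noncomputable def base : Measure ℝ := volume.restrict (Set.Ioc 0 1)

/-- `ν_p`: the product Bernoulli(p) measure on edge configurations of the
lattice with adjacency `adj`. -/
noncomputable def edgeMeasure (adj : V → V → Prop) (p : ℝ) : Measure EdgeCfg :=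
  base.map (edgeCfg adj p)

/-- `ℙ_{p,r}`: the DaC measure on pairs (edge configuration, colour
configuration) for the lattice with adjacency `adj`. -/
noncomputable def DaCMeasure (adj : V → V → Prop) (p r : ℝ) : Measure Config :=
  base.map (fun x => (edgeCfg adj p x, colourCfg adj p r x))

/-- Monochromatic connectivity: `u` and `v` are joined by a path (for the
adjacency `adj`) all of whose vertices have colour `c`. -/
def MonoConn (adj : V → V → Prop) (ξ : ColourCfg) (c : Bool) (u v : V) : Prop :=
  Relation.ReflTransGen (fun a b => adj a b ∧ ξ a = c ∧ ξ b = c) u v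

/-- The colour-`c` cluster of `v` (for the adjacency `adj`): empty if `v` does
not have colour `c`, and otherwise the maximal `adj`-connected set of
`c`-coloured vertices containing `v`. -/
def monoCluster (adj : V → V → Prop) (ξ : ColourCfg) (c : Bool) (v : V) : Set V :=
  {w | ξ v = c ∧ MonoConn adj ξ c v w}

/-- The origin. -/
def origin : V := (0, 0)

/-- The size (cardinality) of a set of vertices, with values in `ℝ≥0∞`. -/
noncomputable def sizeE (S : Set V) : ℝ≥0∞ := S.encard

/-- The probability, under the DaC measure with edge adjacency `eadj` and
parameters `p, r`, that the origin lies in an infinite colour-`c` cluster for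
the adjacency `cadj`. -/
noncomputable def percProb (eadj cadj : V → V → Prop) (c : Bool) (p r : ℝ) : ℝ≥0∞ :=
  DaCMeasure eadj p r {ω | (monoCluster cadj ω.2 c origin).Infinite}

/-- `Θ(p,r)` for the square lattice: probability that the origin lies in an
infinite black `r`-cluster. -/
noncomputable def thetaSq (p r : ℝ) : ℝ≥0∞ := percProb SqAdj SqAdj true p r

/-- `Θ*(p,s)` for the square lattice: the `ℙ_{p,1-s}`-probability that the
origin lies in an infinite white `*`-cluster. -/
noncomputable def thetaStarSq (p s : ℝ) : ℝ≥0∞ := percProb SqAdj StarAdj false p (1 - s)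

/-- `Θ(p,r)` for the triangular lattice. -/
noncomputable def thetaTri (p r : ℝ) : ℝ≥0∞ := percProb TriAdj TriAdj true p r

/-- The critical colouring density `r_c(p)` of the square lattice DaC model. -/
noncomputable def rcSq (p : ℝ) : ℝ :=
  sSup {r : ℝ | r ∈ Set.Icc (0 : ℝ) 1 ∧ thetaSq p r = 0}

/-- The critical colouring density `r_c*(p)` for white `*`-percolation. -/
noncomputable def rcStarSq (p : ℝ) : ℝ :=
  sSup {s : ℝ | s ∈ Set.Icc (0 : ℝ) 1 ∧ thetaStarSq p s = 0}

/-- The critical colouring density `r_c(p)` of the triangular lattice DaC model. -/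
noncomputable def rcTri (p : ℝ) : ℝ :=
  sSup {r : ℝ | r ∈ Set.Icc (0 : ℝ) 1 ∧ thetaTri p r = 0}

/-! ### Rectangles and crossings -/

/-- The rectangle `S_{n,m} = ([0,n] × [0,m]) ∩ ℤ²`. -/
def Rect (n m : ℕ) : Set V :=
  {v | 0 ≤ v.1 ∧ v.1 ≤ (n : ℤ) ∧ 0 ≤ v.2 ∧ v.2 ≤ (m : ℤ)}

/-- The top side of `S_{n,m}`. -/
def TopSide (n m : ℕ) : Set V := {v | v ∈ Rect n m ∧ v.2 = (m : ℤ)}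

/-- The bottom side of `S_{n,m}`. -/
def BotSide (n m : ℕ) : Set V := {v | v ∈ Rect n m ∧ v.2 = 0}

/-- The left side of `S_{n,m}`. -/
def LeftSide (n m : ℕ) : Set V := {v | v ∈ Rect n m ∧ v.1 = 0}

/-- The right side of `S_{n,m}`. -/
def RightSide (n m : ℕ) : Set V := {v | v ∈ Rect n m ∧ v.1 = (n : ℤ)}

/-- There is a path (for the adjacency `adj`), all of whose vertices lie in the
region `R` and satisfy the predicate `good`, from the set `A` to the set `B`. -/
def HasCrossing (adj : V → V → Prop) (good : V → Prop) (R A B : Set V) : Prop :=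
  ∃ (k : ℕ) (f : Fin (k + 1) → V),
    (∀ i, f i ∈ R ∧ good (f i)) ∧
    (∀ i : Fin k, adj (f i.castSucc) (f i.succ)) ∧
    f 0 ∈ A ∧ f (Fin.last k) ∈ B

/-- `V^b_{n,m}` as a set of colour configurations: there is a black vertical
crossing of `S_{n,m}` (for the adjacency `adj`). -/
def VertBC (adj : V → V → Prop) (n m : ℕ) : Set ColourCfg :=
  {ξ | HasCrossing adj (fun v => ξ v = true) (Rect n m) (TopSide n m) (BotSide n m)}

/-- `V^{w*}_{n,m}` as a set of colour configurations: there is a white vertical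
`*`-crossing of `S_{n,m}`. -/
def VertWStarC (n m : ℕ) : Set ColourCfg :=
  {ξ | HasCrossing StarAdj (fun v => ξ v = false) (Rect n m) (TopSide n m) (BotSide n m)}

/-- `H^{w*}_{n,m}` as a set of colour configurations: there is a white
horizontal `*`-crossing of `S_{n,m}`. -/
def HorizWStarC (n m : ℕ) : Set ColourCfg :=
  {ξ | HasCrossing StarAdj (fun v => ξ v = false) (Rect n m) (LeftSide n m) (RightSide n m)}

/-- The event (set of full configurations) determined by a set of colour
configurations. -/
def colourEvent (C : Set ColourCfg) : Set Config := {ω | ω.2 ∈ C}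

/-! ### Events depending on colours, increasing events, pivotal clusters -/

/-- The event `A` is defined in terms of the colours of the vertices in `W`. -/
def DependsOnColoursIn (A : Set Config) (W : Set V) : Prop :=
  ∀ ω ω' : Config, (∀ v ∈ W, ω.2 v = ω'.2 v) → (ω ∈ A ↔ ω' ∈ A)

/-- The event `A` is increasing (for the partial order comparing colour
configurations pointwise, black = `true` above white = `false`). -/
def IncreasingColourEvent (A : Set Config) : Prop :=
  ∀ ω ω' : Config, (∀ v : V, ω.2 v = true → ω'.2 v = true) → ω ∈ A → ω' ∈ A

/-- Flip the colours of the vertices of `C`. -/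
noncomputable def flipOn (C : Set V) (ξ : ColourCfg) : ColourCfg :=
  fun v => @ite _ (v ∈ C) (Classical.propDecidable _) (!ξ v) (ξ v)

/-- The set `C` is a pivotal `p`-cluster for the event `A` in the
configuration `ω`: `C` is a `p`-cluster of the edge configuration of `ω`, and
flipping the colour of (all the vertices of) `C` changes whether the
configuration belongs to `A`. -/
def IsPivotal (A : Set Config) (ω : Config) (C : Set V) : Prop :=
  (∃ v : V, C = pCluster ω.1 v) ∧ ¬ (ω ∈ A ↔ (ω.1, flipOn C ω.2) ∈ A)

/-- `n(A)`: the number of pivotal `p`-clusters for the event `A`, with values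
in `ℝ≥0∞`. -/
noncomputable def numPivotal (A : Set Config) (ω : Config) : ℝ≥0∞ :=
  {C : Set V | IsPivotal A ω C}.encard

/-! ### Barriers -/

/-- Connectivity in the square lattice avoiding the edges of `E`. -/
def AvoidConn (E : Set (V × V)) (u v : V) : Prop :=
  Relation.ReflTransGen (fun a b => SqAdj a b ∧ (a, b) ∉ E ∧ (b, a) ∉ E) u v

/-- `E` is a barrier: a set of edges of the square lattice whose removal
(keeping the end-vertices) separates `ℤ²` into two or more connected
components, exactly one of which is infinite. -/
def IsBarrier (E : Set (V × V)) : Prop :=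
  (∀ e ∈ E, SqAdj e.1 e.2) ∧
  (∃ v, {w | AvoidConn E v w}.Infinite) ∧
  (∀ v w, {x | AvoidConn E v x}.Infinite → {x | AvoidConn E w x}.Infinite → AvoidConn E v w) ∧
  (∃ v, {w | AvoidConn E v w}.Finite)

/-- The exterior of a barrier: its unique infinite complementary component. -/
def barrierExt (E : Set (V × V)) : Set V := {v | {w | AvoidConn E v w}.Infinite}

/-- The interior of a barrier: the union of the finite complementary components. -/
def barrierInt (E : Set (V × V)) : Set V := {v | {w | AvoidConn E v w}.Finite}

/-- The event `A ⊆ EdgeCfg` is increasing (opening edges preserves it). -/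
def IncreasingEdgeEvent (A : Set EdgeCfg) : Prop :=
  ∀ η η' : EdgeCfg, (∀ a b : V, η a b = true → η' a b = true) → η ∈ A → η' ∈ A

/-- The event `A ⊆ EdgeCfg` depends only on the states of the edges both of
whose endpoints lie in `W`. -/
def DependsOnEdgesIn (A : Set EdgeCfg) (W : Set V) : Prop :=
  ∀ η η' : EdgeCfg, (∀ a b : V, a ∈ W → b ∈ W → η a b = η' a b) → (η ∈ A ↔ η' ∈ A)

/-! ### Translations -/

/-- Translation of configurations by the vector `u`. -/
def shift (u : V) (ω : Config) : Config :=
  (fun a b => ω.1 (a + u) (b + u), fun a => ω.2 (a + u))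

end DaC

set_option linter.all false


namespace DaC

/-! ## Part 0: walks in the square lattice and their intersections -/

lemma sqAdj_cases {u v : V} (h : SqAdj u v) :
    (u.1 = v.1 ∧ (u.2 = v.2 + 1 ∨ v.2 = u.2 + 1)) ∨
    (u.2 = v.2 ∧ (u.1 = v.1 + 1 ∨ v.1 = u.1 + 1)) := by
  unfold SqAdj at h
  have h1 : (u.1 - v.1) ^ 2 ≤ 1 := by nlinarith [sq_nonneg (u.2 - v.2)]
  have h2 : (u.2 - v.2) ^ 2 ≤ 1 := by nlinarith [sq_nonneg (u.1 - v.1)]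
  have a1 : u.1 - v.1 ≤ 1 ∧ -1 ≤ u.1 - v.1 := ⟨by nlinarith, by nlinarith⟩
  have a2 : u.2 - v.2 ≤ 1 ∧ -1 ≤ u.2 - v.2 := ⟨by nlinarith, by nlinarith⟩
  obtain ⟨b1, b2⟩ := a1
  obtain ⟨b3, b4⟩ := a2
  rcases (by omega : u.1 - v.1 = -1 ∨ u.1 - v.1 = 0 ∨ u.1 - v.1 = 1) with e | e | e <;>
  rcases (by omega : u.2 - v.2 = -1 ∨ u.2 - v.2 = 0 ∨ u.2 - v.2 = 1) with f | f | f <;>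
  rw [e, f] at h <;> simp at h <;> omega

lemma sqAdj_iff {u v : V} : SqAdj u v ↔
    (u.1 = v.1 ∧ (u.2 = v.2 + 1 ∨ v.2 = u.2 + 1)) ∨
    (u.2 = v.2 ∧ (u.1 = v.1 + 1 ∨ v.1 = u.1 + 1)) := by
  refine ⟨sqAdj_cases, ?_⟩
  unfold SqAdj
  rintro (⟨h, h' | h'⟩ | ⟨h, h' | h'⟩) <;> rw [h, h'] <;> ring

lemma SqAdj.symm {u v : V} (h : SqAdj u v) : SqAdj v u := by
  rw [sqAdj_iff] at *; omega

lemma sqAdj_comm {u v : V} : SqAdj u v ↔ SqAdj v u := ⟨SqAdj.symm, SqAdj.symm⟩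

lemma rtg_mono {α : Type*} {R S : α → α → Prop} (hRS : ∀ a b, R a b → S a b) {u v : α}
    (h : Relation.ReflTransGen R u v) : Relation.ReflTransGen S u v := by
  induction h with
  | refl => exact .refl
  | tail _ h ih => exact ih.tail (hRS _ _ h)

lemma rtg_symm {α : Type*} {R : α → α → Prop} (hR : ∀ a b, R a b → R b a) {u v : α}
    (h : Relation.ReflTransGen R u v) : Relation.ReflTransGen R v u := by
  induction h with
  | refl => exact .refl
  | tail _ h ih => exact (Relation.ReflTransGen.single (hR _ _ h)).trans ih

/-- Walk inside the set `A`. -/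
def SC (A : Set V) (u v : V) : Prop :=
  u ∈ A ∧ Relation.ReflTransGen (fun a b => SqAdj a b ∧ a ∈ A ∧ b ∈ A) u v

lemma SC.refl {A : Set V} {u : V} (h : u ∈ A) : SC A u u := ⟨h, .refl⟩

lemma SC.mem_left {A : Set V} {u v : V} (h : SC A u v) : u ∈ A := h.1

lemma SC.mem_right {A : Set V} {u v : V} (h : SC A u v) : v ∈ A := by
  obtain ⟨h1, h2⟩ := h
  induction h2 with
  | refl => exact h1
  | tail _ h _ => exact h.2.2

lemma SC.trans {A : Set V} {u v w : V} (h : SC A u v) (h' : SC A v w) : SC A u w :=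
  ⟨h.1, h.2.trans h'.2⟩

lemma SC.symm {A : Set V} {u v : V} (h : SC A u v) : SC A v u := by
  refine ⟨h.mem_right, ?_⟩
  refine rtg_symm ?_ h.2
  rintro x y ⟨h1, h2, h3⟩
  exact ⟨h1.symm, h3, h2⟩

lemma SC.mono {A B : Set V} (hAB : A ⊆ B) {u v : V} (h : SC A u v) : SC B u v :=
  ⟨hAB h.1, rtg_mono (fun _ _ h => ⟨h.1, hAB h.2.1, hAB h.2.2⟩) h.2⟩

lemma SC.step {A : Set V} {u v : V} (hu : u ∈ A) (hv : v ∈ A) (h : SqAdj u v) : SC A u v :=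
  ⟨hu, .single ⟨h, hu, hv⟩⟩

lemma rtg_path {α : Type*} {R : α → α → Prop} {u v : α} (h : Relation.ReflTransGen R u v) :
    ∃ (n : ℕ) (f : ℕ → α), f 0 = u ∧ f n = v ∧ ∀ i < n, R (f i) (f (i + 1)) := by
  induction h with
  | refl => exact ⟨0, fun _ => u, rfl, rfl, by simp⟩
  | @tail b c _ hbc ih =>
    obtain ⟨n, f, h0, hn, hf⟩ := ih
    refine ⟨n + 1, fun i => if i ≤ n then f i else c, by simp [h0], by simp, ?_⟩
    intro i hi
    rcases Nat.lt_succ_iff_lt_or_eq.1 hi with h | h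
    · simp [h.le, Nat.succ_le_of_lt h, hf i h]
    · subst h; simp [hn, hbc]

lemma SC.path {A : Set V} {u v : V} (h : SC A u v) :
    ∃ (n : ℕ) (f : ℕ → V), f 0 = u ∧ f n = v ∧ (∀ i ≤ n, f i ∈ A) ∧
      ∀ i < n, SqAdj (f i) (f (i + 1)) := by
  obtain ⟨n, f, h0, hn, hf⟩ := rtg_path h.2
  refine ⟨n, f, h0, hn, ?_, fun i hi => (hf i hi).1⟩
  intro i hi
  rcases hi.lt_or_eq with h' | h'
  · exact (hf i h').2.1
  · rw [h', hn]; exact h.mem_right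

lemma telescope2 (h : ℕ → ZMod 2) (m : ℕ) :
    ∑ i ∈ Finset.range m, (h i + h (i + 1)) = h 0 + h m := by
  induction m with
  | zero => simp; exact (CharTwo.add_self_eq_zero _).symm
  | succ m ih =>
    rw [Finset.sum_range_succ, ih]
    linear_combination CharTwo.add_self_eq_zero (h m)

open Classical in
/-- The step from `a` to `b` is vertical, crosses between rows `y` and `y+1`, right of `x`. -/
noncomputable def vcr (x y : ℤ) (a b : V) : ZMod 2 :=
  if x < a.1 ∧ a.1 = b.1 ∧ ((a.2 = y ∧ b.2 = y + 1) ∨ (b.2 = y ∧ a.2 = y + 1)) then 1 else 0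

/-- Main crossing lemma. -/
theorem cross_lemma {A B : Set V} {a b c d : ℤ} {u v w z : V}
    (hA : SC A u v) (hB : SC B w z)
    (hAc : ∀ x ∈ A, c ≤ x.2 ∧ x.2 ≤ d) (hBc : ∀ x ∈ B, a ≤ x.1 ∧ x.1 ≤ b)
    (hu : u.1 ≤ a) (hv : b ≤ v.1) (hw : w.2 ≤ c) (hz : d ≤ z.2) :
    ∃ x, x ∈ A ∧ x ∈ B := by
  classical
  by_contra hcon
  have hcon : ∀ x ∈ A, x ∉ B := fun x hx hx' => hcon ⟨x, hx, hx'⟩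
  obtain ⟨m, f, f0, fm, fB, fs⟩ := hB.path
  -- extended path
  let g : ℕ → V := fun i => if i ≤ m then f i else (z.1, z.2 + 1)
  have g0 : g 0 = w := by simp [g, f0]
  have gm : g (m + 1) = (z.1, z.2 + 1) := by simp [g]
  have gs : ∀ i < m + 1, SqAdj (g i) (g (i + 1)) := by
    intro i hi
    rcases Nat.lt_succ_iff_lt_or_eq.1 hi with h | h
    · simp [g, h.le, Nat.succ_le_of_lt h, fs i h]
    · subst h; simp [g, fm, sqAdj_iff]
  have zB := hB.mem_right
  have gx : ∀ i, i ≤ m + 1 → a ≤ (g i).1 ∧ (g i).1 ≤ b := by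
    intro i hi
    by_cases h : i ≤ m
    · simp only [g, h, if_true]; exact hBc _ (fB i h)
    · simp only [g, h, if_false]; exact hBc _ zB
  have gA : ∀ i, i ≤ m + 1 → g i ∉ A := by
    intro i hi
    by_cases h : i ≤ m
    · simp only [g, h, if_true]; exact fun h' => hcon _ h' (fB i h)
    · simp only [g, h, if_false]; intro h'
      have := (hAc _ h').2
      simp at this; omega
  let N : V → ZMod 2 := fun q => ∑ i ∈ Finset.range (m + 1), vcr q.1 q.2 (g i) (g (i + 1))
  have hN0 : N v = 0 := by
    apply Finset.sum_eq_zero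
    intro i hi
    have := (gx i (Finset.mem_range.1 hi).le).2
    simp only [vcr]
    rw [if_neg]; omega
  have hN1 : N u = 1 := by
    have huA := hA.mem_left
    have hr := hAc u huA
    have key : ∀ i ∈ Finset.range (m + 1), vcr u.1 u.2 (g i) (g (i + 1)) =
        (fun i => if (g i).2 ≤ u.2 then (1 : ZMod 2) else 0) i +
        (fun i => if (g i).2 ≤ u.2 then (1 : ZMod 2) else 0) (i + 1) := by
      intro i hi
      have hi := Finset.mem_range.1 hi
      have h1 := gs i hi
      have h2 := gx i hi.le
      have h3 := gA i hi.le
      have h4 := gA (i + 1) hi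
      have n1 : ¬ (g i = u) := fun h => h3 (h ▸ huA)
      have n2 : ¬ (g (i + 1) = u) := fun h => h4 (h ▸ huA)
      rw [Prod.ext_iff] at n1 n2
      rw [sqAdj_iff] at h1
      simp only [vcr]
      split_ifs <;> first | rfl | decide | (exfalso; omega)
    show ∑ i ∈ Finset.range (m + 1), vcr u.1 u.2 (g i) (g (i + 1)) = 1
    rw [Finset.sum_congr rfl key, telescope2]
    simp only [g0, gm]
    rw [if_pos (by omega), if_neg (by omega), add_zero]
  have hinv : ∀ q q', SqAdj q q' → q ∈ A → q' ∈ A → q'.2 = q.2 + 1 ∨ q'.1 = q.1 + 1 →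
      N q = N q' := by
    intro q q' hqq hq hq' hor
    rcases hor with hor | hor
    · -- vertical step
      have hx : q'.1 = q.1 := by rw [sqAdj_iff] at hqq; omega
      have hr := hAc q hq
      have hr' := hAc q' hq'
      have key : ∀ i ∈ Finset.range (m + 1),
          vcr q.1 q.2 (g i) (g (i + 1)) + vcr q'.1 q'.2 (g i) (g (i + 1)) =
          (fun i => if (g i).2 = q'.2 ∧ q.1 < (g i).1 then (1 : ZMod 2) else 0) i +
          (fun i => if (g i).2 = q'.2 ∧ q.1 < (g i).1 then (1 : ZMod 2) else 0) (i + 1) := by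
        intro i hi
        have hi := Finset.mem_range.1 hi
        have h1 := gs i hi
        have h3 := gA i hi.le
        have h4 := gA (i + 1) hi
        have n1 : ¬ (g i = q') := fun h => h3 (h ▸ hq')
        have n2 : ¬ (g (i + 1) = q') := fun h => h4 (h ▸ hq')
        rw [Prod.ext_iff] at n1 n2
        rw [sqAdj_iff] at h1
        simp only [vcr]
        split_ifs <;> first | rfl | decide | (exfalso; omega)
      have : N q + N q' = 0 := by
        show ∑ i ∈ Finset.range (m + 1), vcr q.1 q.2 (g i) (g (i + 1)) +
          ∑ i ∈ Finset.range (m + 1), vcr q'.1 q'.2 (g i) (g (i + 1)) = 0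
        rw [← Finset.sum_add_distrib, Finset.sum_congr rfl key, telescope2]
        simp only [g0, gm]
        rw [if_neg (by omega), if_neg (by omega), add_zero]
      exact CharTwo.add_eq_zero.1 this
    · have hy : q'.2 = q.2 := by rw [sqAdj_iff] at hqq; omega
      apply Finset.sum_congr rfl
      intro i hi
      have hi := Finset.mem_range.1 hi
      have h3 := gA i hi.le
      have h4 := gA (i + 1) hi
      have n1 : ¬ (g i = q') := fun h => h3 (h ▸ hq')
      have n2 : ¬ (g (i + 1) = q') := fun h => h4 (h ▸ hq')
      rw [Prod.ext_iff] at n1 n2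
      simp only [vcr]
      split_ifs <;> first | rfl | (exfalso; omega)
  have hall : ∀ q, Relation.ReflTransGen (fun a b => SqAdj a b ∧ a ∈ A ∧ b ∈ A) u q →
      N q = N u := by
    intro q hq
    induction hq with
    | refl => rfl
    | @tail x y _ hxy ih =>
      rw [← ih]
      obtain ⟨h1, h2, h3⟩ := hxy
      rcases sqAdj_cases h1 with ⟨_, h | h⟩ | ⟨_, h | h⟩
      · exact hinv y x h1.symm h3 h2 (Or.inl h)
      · exact (hinv x y h1 h2 h3 (Or.inl h)).symm
      · exact hinv y x h1.symm h3 h2 (Or.inr h)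
      · exact (hinv x y h1 h2 h3 (Or.inr h)).symm
  have := hall v hA.2
  rw [hN0, hN1] at this
  exact zero_ne_one this

lemma SC.vline {A : Set V} (x y : ℤ) (n : ℕ) (h : ∀ k : ℤ, y ≤ k → k ≤ y + n → (x, k) ∈ A) :
    SC A (x, y) (x, y + n) := by
  induction n with
  | zero => simpa using SC.refl (h y le_rfl (by simp))
  | succ n ih =>
    refine (ih fun k h1 h2 => h k h1 (by push_cast; omega)).trans ?_
    refine SC.step (h _ (by omega) (by push_cast; omega)) (h _ (by omega) le_rfl) ?_
    rw [sqAdj_iff]; left; push_cast; simp; omega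

lemma SC.vline' {A : Set V} (x y y' : ℤ) (hy : y ≤ y')
    (h : ∀ k : ℤ, y ≤ k → k ≤ y' → (x, k) ∈ A) : SC A (x, y) (x, y') := by
  have := SC.vline (A := A) x y (y' - y).toNat (fun k h1 h2 => h k h1 (by omega))
  rwa [show y + ((y' - y).toNat : ℤ) = y' by omega] at this

/-- Hook lemma: a walk ending on the column `b` between the two endpoints of a walk
from column `b` to itself inside the strip `a ≤ x ≤ b`. -/
theorem hook_lemma {A B : Set V} {a b y1 y2 M : ℤ} {u v : V}
    (hA : SC A u v) (hB : SC B (b, y2) (b, y1))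
    (hAb : ∀ x ∈ A, x.1 ≤ b) (hBc : ∀ x ∈ B, a ≤ x.1 ∧ x.1 ≤ b)
    (hM : ∀ x ∈ A, -M ≤ x.2 ∧ x.2 ≤ M) 
    (hu : u.1 ≤ a) (hv : v.1 = b) (h2 : y2 ≤ v.2) (h1 : v.2 ≤ y1) :
    ∃ x, x ∈ A ∧ x ∈ B := by
  by_contra hcon
  have hcon : ∀ x ∈ A, x ∉ B := fun x hx hx' => hcon ⟨x, hx, hx'⟩
  have vA := hA.mem_right
  have ne2 : v ≠ (b, y2) := fun h => hcon v vA (h ▸ hB.mem_left)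
  have ne1 : v ≠ (b, y1) := fun h => hcon v vA (h ▸ hB.mem_right)
  have ne2' : y2 < v.2 := lt_of_le_of_ne h2 fun h => ne2 (Prod.ext hv h.symm)
  have ne1' : v.2 < y1 := lt_of_le_of_ne h1 fun h => ne1 (Prod.ext hv h)
  let A' : Set V := insert (b + 1, v.2) A
  let B' : Set V := B ∪ {x | x.1 = b + 1 ∧ (x.2 ≤ y2 ∨ y1 ≤ x.2)}
  have hA' : SC A' u (b + 1, v.2) := by
    refine (hA.mono (Set.subset_insert _ _)).trans (SC.step ?_ ?_ ?_)
    · exact Or.inr vA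
    · exact Or.inl rfl
    · rw [sqAdj_iff]; right; simp [hv]
  have hMv := hM v vA
  have hB' : SC B' (b + 1, min y2 (-M)) (b + 1, max y1 M) := by
    have e1 : SC B' (b + 1, min y2 (-M)) (b + 1, y2) :=
      SC.vline' _ _ _ (min_le_left _ _) fun k _ hk => Or.inr ⟨rfl, Or.inl hk⟩
    have e2 : SC B' (b + 1, y1) (b + 1, max y1 M) :=
      SC.vline' _ _ _ (le_max_left _ _) fun k hk _ => Or.inr ⟨rfl, Or.inr hk⟩
    have e3 : SC B' (b, y2) (b, y1) := hB.mono Set.subset_union_left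
    refine e1.trans (SC.trans (SC.step e1.mem_right e3.mem_left ?_) (e3.trans
      (SC.trans (SC.step e3.mem_right e2.mem_left ?_) e2)))
    · rw [sqAdj_iff]; right; simp
    · rw [sqAdj_iff]; right; simp
  have hab : a ≤ b := by have := hBc _ hB.mem_left; simp at this; exact this
  obtain ⟨x, hxA, hxB⟩ := cross_lemma (a := a) (b := b + 1) (c := -M) (d := M) hA' hB'
    (by rintro x (rfl | hx)
        · exact hMv
        · exact hM x hx)
    (by rintro x (hx | hx)
        · have := hBc x hx; omega
        · have := hx.1; omega) hu le_rfl (min_le_right _ _) (le_max_right _ _)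
  rcases hxA with rfl | hxA
  · rcases hxB with hxB | hxB
    · have := (hBc _ hxB).2; simp at this
    · have := hxB.2; simp at this; omega
  · rcases hxB with hxB | hxB
    · exact hcon x hxA hxB
    · have := hAb x hxA; have := hxB.1; omega

end DaC


namespace DaC

/-! ## Part 1a: connection events, deterministic facts -/

def ostep (η : EdgeCfg) (a b : V) : Prop := SqAdj a b ∧ η a b = true ∧ η b a = true

lemma ostep.symm {η : EdgeCfg} {a b : V} (h : ostep η a b) : ostep η b a :=
  ⟨h.1.symm, h.2.2, h.2.1⟩

/-- Pointwise order on edge configurations. -/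
def cle (η η' : EdgeCfg) : Prop := ∀ a b : V, η a b = true → η' a b = true

/-- Connection inside the region `R`. -/
def CI (η : EdgeCfg) (R : Set V) (u v : V) : Prop :=
  u ∈ R ∧ Relation.ReflTransGen (fun a b => ostep η a b ∧ a ∈ R ∧ b ∈ R) u v

lemma CI.refl {η : EdgeCfg} {R : Set V} {u : V} (h : u ∈ R) : CI η R u u := ⟨h, .refl⟩

lemma CI.mem_left {η : EdgeCfg} {R : Set V} {u v : V} (h : CI η R u v) : u ∈ R := h.1

lemma CI.mem_right {η : EdgeCfg} {R : Set V} {u v : V} (h : CI η R u v) : v ∈ R := by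
  obtain ⟨h1, h2⟩ := h
  induction h2 with
  | refl => exact h1
  | tail _ h _ => exact h.2.2

lemma CI.trans {η : EdgeCfg} {R : Set V} {u v w : V} (h : CI η R u v) (h' : CI η R v w) :
    CI η R u w := ⟨h.1, h.2.trans h'.2⟩

lemma CI.symm {η : EdgeCfg} {R : Set V} {u v : V} (h : CI η R u v) : CI η R v u :=
  ⟨h.mem_right, rtg_symm (fun _ _ h => ⟨h.1.symm, h.2.2, h.2.1⟩) h.2⟩

lemma CI.mono {η : EdgeCfg} {R S : Set V} (hRS : R ⊆ S) {u v : V} (h : CI η R u v) :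
    CI η S u v := ⟨hRS h.1, rtg_mono (fun _ _ h => ⟨h.1, hRS h.2.1, hRS h.2.2⟩) h.2⟩

lemma CI.mono_cfg {η η' : EdgeCfg} {R : Set V} (hη : cle η η') {u v : V} (h : CI η R u v) :
    CI η' R u v :=
  ⟨h.1, rtg_mono (fun _ _ h => ⟨⟨h.1.1, hη _ _ h.1.2.1, hη _ _ h.1.2.2⟩, h.2⟩) h.2⟩

lemma CI.congr {η η' : EdgeCfg} {R : Set V} (hη : ∀ a b, a ∈ R → b ∈ R → η a b = η' a b)
    {u v : V} (h : CI η R u v) : CI η' R u v :=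
  ⟨h.1, rtg_mono (fun a b h => ⟨⟨h.1.1, hη a b h.2.1 h.2.2 ▸ h.1.2.1,
    hη b a h.2.2 h.2.1 ▸ h.1.2.2⟩, h.2⟩) h.2⟩

lemma CI.tail {η : EdgeCfg} {R : Set V} {u v w : V} (h : CI η R u v) (h' : ostep η v w)
    (hw : w ∈ R) : CI η R u w := ⟨h.1, h.2.tail ⟨h', h.mem_right, hw⟩⟩

lemma CI.sc {η : EdgeCfg} {R : Set V} {u v : V} (h : CI η R u v) :
    SC {x | CI η R u x} u v := by
  obtain ⟨h1, h2⟩ := h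
  induction h2 with
  | refl => exact SC.refl (CI.refl h1)
  | @tail b c hub hbc ih =>
    have hb : CI η R u b := ⟨h1, hub⟩
    exact ih.trans (SC.step hb (hb.tail hbc.1 hbc.2.2) hbc.1.1)

/-- Crossing lemma for connections, possibly in two different configurations. -/
lemma CI.cross {η η' : EdgeCfg} {R S : Set V} {u v w z : V} {a b c d : ℤ}
    (h : CI η R u v) (h' : CI η' S w z)
    (hR : ∀ x ∈ R, c ≤ x.2 ∧ x.2 ≤ d) (hS : ∀ x ∈ S, a ≤ x.1 ∧ x.1 ≤ b)
    (hu : u.1 ≤ a) (hv : b ≤ v.1) (hw : w.2 ≤ c) (hz : d ≤ z.2) :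
    ∃ x, CI η R u x ∧ CI η' S w x := by
  obtain ⟨x, h1, h2⟩ := cross_lemma h.sc h'.sc (fun x hx => hR x (CI.mem_right hx))
    (fun x hx => hS x (CI.mem_right hx)) hu hv hw hz
  exact ⟨x, h1, h2⟩

/-- Stopping a walk at the first time an integer-valued 1-Lipschitz function reaches `b`. -/
lemma CI.haltAt {η : EdgeCfg} {R : Set V} {u v : V} (h : CI η R u v) (f : V → ℤ)
    (hf : ∀ x y, SqAdj x y → f y ≤ f x + 1) (b : ℤ) (hu : f u ≤ b) (hv : b ≤ f v) :
    ∃ v', f v' = b ∧ CI η (R ∩ {x | f x ≤ b}) u v' := by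
  obtain ⟨h1, h2⟩ := h
  have key : ∀ y, Relation.ReflTransGen (fun a b => ostep η a b ∧ a ∈ R ∧ b ∈ R) u y →
      (CI η (R ∩ {x | f x ≤ b}) u y) ∨ ∃ v', f v' = b ∧ CI η (R ∩ {x | f x ≤ b}) u v' := by
    intro y hy
    induction hy with
    | refl => exact Or.inl (CI.refl ⟨h1, hu⟩)
    | @tail y z _ hyz ih =>
      rcases ih with ih | ih
      · by_cases hz : f z ≤ b
        · exact Or.inl (ih.tail hyz.1 ⟨hyz.2.2, hz⟩)
        · right
          refine ⟨y, ?_, ih⟩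
          have h3 := ih.mem_right.2
          simp only [Set.mem_ofPred_eq] at h3
          have := hf y z hyz.1.1
          omega
      · exact Or.inr ih
  rcases key v h2 with h | h
  · exact ⟨v, le_antisymm h.mem_right.2 hv, h⟩
  · exact h

/-- Restricting a walk to the part between two levels of a Lipschitz function. -/
lemma CI.slab {η : EdgeCfg} {R : Set V} {u v : V} (h : CI η R u v) (f : V → ℤ)
    (hf : ∀ x y, SqAdj x y → f y ≤ f x + 1) (a b : ℤ) (hab : a ≤ b) (hu : f u ≤ a)
    (hv : b ≤ f v) :
    ∃ u' v', f u' = a ∧ f v' = b ∧ CI η (R ∩ {x | a ≤ f x ∧ f x ≤ b}) u' v' := by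
  obtain ⟨v', e1, h1⟩ := h.haltAt f hf b (hu.trans hab) hv
  obtain ⟨u', e2, h2⟩ := h1.symm.haltAt (fun x => - f x)
    (fun x y hxy => by have := hf y x hxy.symm; omega) (-a) (by omega) (by omega)
  refine ⟨u', v', by omega, e1, h2.symm.mono ?_⟩
  rintro x ⟨⟨hx1, hx2⟩, hx3⟩
  simp only [Set.mem_ofPred_eq] at hx2 hx3
  exact ⟨hx1, by omega, hx2⟩

lemma lip_fst (x y : V) (h : SqAdj x y) : y.1 ≤ x.1 + 1 := by rw [sqAdj_iff] at h; omega
lemma lip_snd (x y : V) (h : SqAdj x y) : y.2 ≤ x.2 + 1 := by rw [sqAdj_iff] at h; omega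

/-- Sup norm. -/
def nrm (v : V) : ℤ := max |v.1| |v.2|

lemma nrm_le {v : V} {n : ℤ} : nrm v ≤ n ↔ -n ≤ v.1 ∧ v.1 ≤ n ∧ -n ≤ v.2 ∧ v.2 ≤ n := by
  simp only [nrm, max_le_iff, abs_le]; tauto

lemma lip_nrm (x y : V) (h : SqAdj x y) : nrm y ≤ nrm x + 1 := by
  have := (nrm_le (v := x)).1 le_rfl
  rw [sqAdj_iff] at h
  rw [nrm_le]; omega

lemma nrm_eq {v : V} {n : ℤ} (h : nrm v = n) : v.1 = n ∨ v.1 = -n ∨ v.2 = n ∨ v.2 = -n := by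
  unfold nrm at h
  rcases max_choice |v.1| |v.2| with e | e <;> rw [e] at h
  · rcases abs_choice v.1 with f | f <;> rw [f] at h <;> omega
  · rcases abs_choice v.2 with f | f <;> rw [f] at h <;> omega

/-- Boxes. -/
def bx (a b c d : ℤ) : Set V := {v | a ≤ v.1 ∧ v.1 ≤ b ∧ c ≤ v.2 ∧ v.2 ≤ d}

lemma bx_finite (a b c d : ℤ) : (bx a b c d).Finite := by
  refine (Set.finite_Icc ((a, c) : V) (b, d)).subset ?_
  rintro ⟨x, y⟩ ⟨h1, h2, h3, h4⟩
  exact ⟨⟨h1, h3⟩, ⟨h2, h4⟩⟩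

lemma bx_mono {a b c d a' b' c' d' : ℤ} (h1 : a' ≤ a) (h2 : b ≤ b') (h3 : c' ≤ c) (h4 : d ≤ d') :
    bx a b c d ⊆ bx a' b' c' d' := by
  rintro ⟨x, y⟩ ⟨g1, g2, g3, g4⟩
  exact ⟨h1.trans g1, g2.trans h2, h3.trans g3, g4.trans h4⟩

/-- Centered box. -/
abbrev BB (n : ℤ) : Set V := bx (-n) n (-n) n

lemma mem_BB {v : V} {n : ℤ} : v ∈ BB n ↔ nrm v ≤ n := nrm_le.symm

/-- Connection events. -/
def Ev (R S T : Set V) : Set EdgeCfg := {η | ∃ u ∈ S, ∃ v ∈ T, CI η R u v}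

def Inc (A : Set EdgeCfg) : Prop := ∀ η η', cle η η' → η ∈ A → η' ∈ A
def Dep (W : Set V) (A : Set EdgeCfg) : Prop :=
  ∀ η η' : EdgeCfg, (∀ a b : V, a ∈ W → b ∈ W → η a b = η' a b) → (η ∈ A → η' ∈ A)

lemma Dep.iff {W : Set V} {A : Set EdgeCfg} (h : Dep W A) {η η' : EdgeCfg}
    (h' : ∀ a b : V, a ∈ W → b ∈ W → η a b = η' a b) : η ∈ A ↔ η' ∈ A :=
  ⟨h _ _ h', h _ _ fun a b ha hb => (h' a b ha hb).symm⟩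

lemma Dep.inter {W : Set V} {A B : Set EdgeCfg} (h : Dep W A) (h' : Dep W B) : Dep W (A ∩ B) :=
  fun _ _ e hx => ⟨h _ _ e hx.1, h' _ _ e hx.2⟩
lemma Dep.union {W : Set V} {A B : Set EdgeCfg} (h : Dep W A) (h' : Dep W B) : Dep W (A ∪ B) :=
  fun _ _ e hx => hx.imp (h _ _ e) (h' _ _ e)
lemma Dep.compl {W : Set V} {A : Set EdgeCfg} (h : Dep W A) : Dep W Aᶜ :=
  fun _ _ e hx hx' => hx (h _ _ (fun a b ha hb => (e a b ha hb).symm) hx')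
lemma Dep.mono {W W' : Set V} {A : Set EdgeCfg} (h : Dep W A) (hW : W ⊆ W') : Dep W' A :=
  fun _ _ e hx => h _ _ (fun a b ha hb => e a b (hW ha) (hW hb)) hx
lemma Inc.inter {A B : Set EdgeCfg} (h : Inc A) (h' : Inc B) : Inc (A ∩ B) :=
  fun _ _ e hx => ⟨h _ _ e hx.1, h' _ _ e hx.2⟩
lemma Inc.union {A B : Set EdgeCfg} (h : Inc A) (h' : Inc B) : Inc (A ∪ B) :=
  fun _ _ e hx => hx.imp (h _ _ e) (h' _ _ e)

lemma Ev.inc (R S T : Set V) : Inc (Ev R S T) :=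
  fun _ _ e ⟨u, hu, v, hv, h⟩ => ⟨u, hu, v, hv, h.mono_cfg e⟩
lemma Ev.dep (R S T : Set V) : Dep R (Ev R S T) :=
  fun _ _ e ⟨u, hu, v, hv, h⟩ => ⟨u, hu, v, hv, h.congr e⟩
lemma Ev.mono {R S T R' S' T' : Set V} (hR : R ⊆ R') (hS : S ⊆ S') (hT : T ⊆ T') :
    Ev R S T ⊆ Ev R' S' T' :=
  fun _ ⟨u, hu, v, hv, h⟩ => ⟨u, hS hu, v, hT hv, h.mono hR⟩
lemma Ev.comm (R S T : Set V) : Ev R S T = Ev R T S := by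
  ext η; constructor <;> rintro ⟨u, hu, v, hv, h⟩ <;> exact ⟨v, hv, u, hu, h.symm⟩
lemma Ev.union_right (R S T T' : Set V) : Ev R S (T ∪ T') = Ev R S T ∪ Ev R S T' := by
  ext η; constructor
  · rintro ⟨u, hu, v, hv | hv, h⟩
    · exact Or.inl ⟨u, hu, v, hv, h⟩
    · exact Or.inr ⟨u, hu, v, hv, h⟩
  · rintro (⟨u, hu, v, hv, h⟩ | ⟨u, hu, v, hv, h⟩)
    · exact ⟨u, hu, v, Or.inl hv, h⟩
    · exact ⟨u, hu, v, Or.inr hv, h⟩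

/-- Left-right and bottom-top crossings. -/
def LR (a b c d : ℤ) : Set EdgeCfg := Ev (bx a b c d) {u | u.1 ≤ a} {v | b ≤ v.1}
def TB (a b c d : ℤ) : Set EdgeCfg := Ev (bx a b c d) {u | u.2 ≤ c} {v | d ≤ v.2}

lemma LR.inc (a b c d : ℤ) : Inc (LR a b c d) := Ev.inc _ _ _
lemma TB.inc (a b c d : ℤ) : Inc (TB a b c d) := Ev.inc _ _ _
lemma LR.dep (a b c d : ℤ) : Dep (bx a b c d) (LR a b c d) := Ev.dep _ _ _
lemma TB.dep (a b c d : ℤ) : Dep (bx a b c d) (TB a b c d) := Ev.dep _ _ _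

lemma LR.shrink {a b c d a' b' c' d' : ℤ} (h1 : a ≤ a') (h0 : a' ≤ b') (h2 : b' ≤ b)
    (h3 : c' ≤ c) (h4 : d ≤ d') : LR a b c d ⊆ LR a' b' c' d' := by
  rintro η ⟨u, hu, v, hv, h⟩
  obtain ⟨u', v', e1, e2, h⟩ := h.slab Prod.fst lip_fst a' b' h0 (hu.trans h1) (h2.trans hv)
  refine ⟨u', e1.le, v', e2.ge, h.mono ?_⟩
  rintro x ⟨hx, hx1, hx2⟩
  exact ⟨hx1, hx2, h3.trans hx.2.2.1, hx.2.2.2.trans h4⟩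

lemma glue {a a' b b' c d : ℤ} (h1 : a ≤ a') (h2 : a' ≤ b) (h3 : b ≤ b') :
    LR a b c d ∩ LR a' b' c d ∩ TB a' b c d ⊆ LR a b' c d := by
  rintro η ⟨⟨⟨u, hu, v, hv, h⟩, ⟨u', hu', v', hv', h'⟩⟩, ⟨w, hw, z, hz, k⟩⟩
  simp only [Set.mem_ofPred_eq] at *
  obtain ⟨x, x1, x2⟩ := h.cross k (a := a') (b := b) (c := c) (d := d)
    (fun x hx => hx.2.2) (fun x hx => ⟨hx.1, hx.2.1⟩) (hu.trans h1) hv hw hz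
  obtain ⟨y, y1, y2⟩ := h'.cross k (a := a') (b := b) (c := c) (d := d)
    (fun x hx => hx.2.2) (fun x hx => ⟨hx.1, hx.2.1⟩) hu' (h3.trans hv') hw hz
  refine ⟨u, hu, v', hv', ?_⟩
  have i1 : bx a b c d ⊆ bx a b' c d := bx_mono le_rfl h3 le_rfl le_rfl
  have i2 : bx a' b' c d ⊆ bx a b' c d := bx_mono h1 le_rfl le_rfl le_rfl
  have i3 : bx a' b c d ⊆ bx a b' c d := bx_mono h1 h3 le_rfl le_rfl
  exact (x1.mono i1).trans ((x2.symm.mono i3).trans ((y2.mono i3).trans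
    ((y1.symm.mono i2).trans (h'.mono i2))))

/-- Circuit in the annulus `BB (2N) \ BB (N-1)`. -/
def circ (N : ℤ) : Set EdgeCfg :=
  (TB N (2 * N) (-(2 * N)) (2 * N) ∩ TB (-(2 * N)) (-N) (-(2 * N)) (2 * N)) ∩
  (LR (-(2 * N)) (2 * N) N (2 * N) ∩ LR (-(2 * N)) (2 * N) (-(2 * N)) (-N))

lemma circ_inc (N : ℤ) : Inc (circ N) :=
  ((TB.inc _ _ _ _).inter (TB.inc _ _ _ _)).inter ((LR.inc _ _ _ _).inter (LR.inc _ _ _ _))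

/-- The annulus. -/
def ann (N : ℤ) : Set V := BB (2 * N) \ BB (N - 1)

lemma circ_dep {N : ℤ} (hN : 0 ≤ N) : Dep (ann N) (circ N) := by
  have key : ∀ a b c d : ℤ, bx a b c d ⊆ ann N → Dep (ann N) (LR a b c d) ∧
      Dep (ann N) (TB a b c d) := fun a b c d h =>
    ⟨(LR.dep _ _ _ _).mono h, (TB.dep _ _ _ _).mono h⟩
  refine Dep.inter (Dep.inter (key _ _ _ _ ?_).2 (key _ _ _ _ ?_).2)
    (Dep.inter (key _ _ _ _ ?_).1 (key _ _ _ _ ?_).1) <;>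
  · rintro ⟨x, y⟩ ⟨h1, h2, h3, h4⟩
    simp only [] at h1 h2 h3 h4
    refine ⟨⟨?_, ?_, ?_, ?_⟩, fun h => ?_⟩
    any_goals (simp only []; omega)
    obtain ⟨g1, g2, g3, g4⟩ := h
    simp only [] at g1 g2 g3 g4
    omega

lemma circ_hit {N : ℤ} (hN : 0 ≤ N) {η : EdgeCfg} (hη : η ∈ circ N) {z z' : V}
    (hz : CI η (bx N (2 * N) (-(2 * N)) (2 * N)) z z') (hz1 : z.2 ≤ -(2 * N))
    (hz2 : 2 * N ≤ z'.2) {η' : EdgeCfg} {R : Set V} {u v : V} (h : CI η' R u v)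
    (hu : nrm u ≤ N) (hv : 2 * N ≤ nrm v) :
    ∃ x, CI η' R u x ∧ CI η (BB (2 * N)) z x := by
  obtain ⟨⟨_, hL⟩, hT, hB⟩ := hη
  obtain ⟨l, hl, l', hl', L⟩ := hL
  obtain ⟨t, ht, t', ht', T⟩ := hT
  obtain ⟨b, hb, b', hb', B⟩ := hB
  simp only [Set.mem_ofPred_eq] at *
  have i1 : bx N (2 * N) (-(2 * N)) (2 * N) ⊆ BB (2 * N) := bx_mono (by omega) (by omega) (by omega) (by omega)
  have i2 : bx (-(2 * N)) (-N) (-(2 * N)) (2 * N) ⊆ BB (2 * N) := bx_mono (by omega) (by omega) (by omega) (by omega)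
  have i3 : bx (-(2 * N)) (2 * N) N (2 * N) ⊆ BB (2 * N) := bx_mono (by omega) (by omega) (by omega) (by omega)
  have i4 : bx (-(2 * N)) (2 * N) (-(2 * N)) (-N) ⊆ BB (2 * N) := bx_mono (by omega) (by omega) (by omega) (by omega)
  obtain ⟨p1, p1a, p1b⟩ := T.cross hz (a := N) (b := 2 * N) (c := N) (d := 2 * N)
    (fun x hx => hx.2.2) (fun x hx => ⟨hx.1, hx.2.1⟩) (by omega) ht' (by omega) hz2
  obtain ⟨p2, p2a, p2b⟩ := T.cross L (a := -(2 * N)) (b := -N) (c := N) (d := 2 * N)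
    (fun x hx => hx.2.2) (fun x hx => ⟨hx.1, hx.2.1⟩) (by omega) (by omega) (by omega) hl'
  obtain ⟨p3, p3a, p3b⟩ := B.cross hz (a := N) (b := 2 * N) (c := -(2 * N)) (d := -N)
    (fun x hx => hx.2.2) (fun x hx => ⟨hx.1, hx.2.1⟩) (by omega) (by omega) (by omega) (by omega)
  have ct : CI η (BB (2 * N)) z t := (p1b.mono i1).trans (p1a.symm.mono i3)
  have cl : CI η (BB (2 * N)) z l := ct.trans ((p2a.mono i3).trans (p2b.symm.mono i2))
  have cb : CI η (BB (2 * N)) z b := (p3b.mono i1).trans (p3a.symm.mono i4)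
  obtain ⟨v', hv', h'⟩ := h.haltAt nrm lip_nrm (2 * N) (by omega) hv
  have e : R ∩ {x | nrm x ≤ 2 * N} ⊆ R := Set.inter_subset_left
  have hR : ∀ x ∈ R ∩ {x | nrm x ≤ 2 * N}, -(2 * N) ≤ x.1 ∧ x.1 ≤ 2 * N ∧ -(2 * N) ≤ x.2 ∧ x.2 ≤ 2 * N :=
    fun x hx => nrm_le.1 hx.2
  rw [nrm_le] at hu
  rcases nrm_eq hv' with k | k | k | k
  · obtain ⟨x, xa, xb⟩ := h'.cross hz (a := N) (b := 2 * N) (c := -(2 * N)) (d := 2 * N)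
      (fun x hx => (hR x hx).2.2) (fun x hx => ⟨hx.1, hx.2.1⟩) (by omega) (by omega) hz1 hz2
    exact ⟨x, xa.mono e, xb.mono i1⟩
  · obtain ⟨x, xa, xb⟩ := h'.symm.cross L (a := -(2 * N)) (b := -N) (c := -(2 * N)) (d := 2 * N)
      (fun x hx => (hR x hx).2.2) (fun x hx => ⟨hx.1, hx.2.1⟩) (by omega) (by omega) hl hl'
    exact ⟨x, (h'.trans xa).mono e, cl.trans (xb.mono i2)⟩
  · obtain ⟨x, xa, xb⟩ := T.cross h' (a := -(2 * N)) (b := 2 * N) (c := N) (d := 2 * N)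
      (fun x hx => hx.2.2) (fun x hx => ⟨(hR x hx).1, (hR x hx).2.1⟩) ht ht' (by omega) (by omega)
    exact ⟨x, xb.mono e, ct.trans (xa.mono i3)⟩
  · obtain ⟨x, xa, xb⟩ := B.cross h'.symm (a := -(2 * N)) (b := 2 * N) (c := -(2 * N)) (d := -N)
      (fun x hx => hx.2.2) (fun x hx => ⟨(hR x hx).1, (hR x hx).2.1⟩) hb hb' (by omega) (by omega)
    exact ⟨x, (h'.trans xb).mono e, cb.trans (xa.mono i4)⟩

end DaC


namespace DaC

/-! ## Part 1b: abstract percolation measures -/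

lemma Dep.measurable {W : Set V} (hW : W.Finite) {A : Set EdgeCfg} (h : Dep W A) :
    MeasurableSet A := by
  classical
  have : Finite W := hW
  let f : EdgeCfg → (W × W → Bool) := fun η ab => η ab.1 ab.2
  have hf : Measurable f := by fun_prop
  have : A = f ⁻¹' (f '' A) := by
    ext η
    refine ⟨fun hη => ⟨η, hη, rfl⟩, ?_⟩
    rintro ⟨η', h', e⟩
    exact h η' η (fun a b ha hb => congrFun e (⟨a, ha⟩, ⟨b, hb⟩)) h'
  rw [this]
  exact hf (Set.toFinite _).measurableSet

/-- Action of lattice symmetries. -/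
def act (g : V → V) (η : EdgeCfg) : EdgeCfg := fun a b => η (g a) (g b)

lemma act_meas (g : V → V) : Measurable (act g) := by
  unfold act; fun_prop

structure Lat (g : V ≃ V) : Prop where
  adj : ∀ a b, SqAdj (g a) (g b) ↔ SqAdj a b
  mid : ∃ j : V → V, Function.Injective j ∧ ∀ a b, g a + g b = j (a + b)

structure Perc (μ : Measure EdgeCfg) : Prop where
  prob : IsProbabilityMeasure μ
  inv : ∀ g : V ≃ V, Lat g → μ.map (act g) = μ
  pa : ∀ (W : Set V) (A B : Set EdgeCfg), W.Finite → Dep W A → Dep W B → Inc A → Inc B →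
    μ.real A * μ.real B ≤ μ.real (A ∩ B)

/-- Mixing with rate `ε`. -/
def Mix (μ : Measure EdgeCfg) (ε : ℕ → ℝ) : Prop :=
  ∀ (n : ℕ), 1 ≤ n → ∀ (W W' : Set V) (A B : Set EdgeCfg), W ⊆ BB (20 * n) → W' ⊆ BB (20 * n) →
    (∀ u ∈ W, ∀ v ∈ W', (n : ℤ) ≤ nrm (u - v)) → Dep W A → Dep W' B →
    μ.real (A ∩ B) ≤ μ.real A * μ.real B + ε n

/-- Local increasing events. -/
def LI (A : Set EdgeCfg) : Prop := Inc A ∧ ∃ W : Set V, W.Finite ∧ Dep W A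

lemma LI.inter {A B : Set EdgeCfg} (h : LI A) (h' : LI B) : LI (A ∩ B) := by
  obtain ⟨h1, W, hW, h2⟩ := h
  obtain ⟨h1', W', hW', h2'⟩ := h'
  exact ⟨h1.inter h1', W ∪ W', hW.union hW', (h2.mono Set.subset_union_left).inter
    (h2'.mono Set.subset_union_right)⟩
lemma LI.union {A B : Set EdgeCfg} (h : LI A) (h' : LI B) : LI (A ∪ B) := by
  obtain ⟨h1, W, hW, h2⟩ := h
  obtain ⟨h1', W', hW', h2'⟩ := h'
  exact ⟨h1.union h1', W ∪ W', hW.union hW', (h2.mono Set.subset_union_left).union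
    (h2'.mono Set.subset_union_right)⟩
lemma LI.meas {A : Set EdgeCfg} (h : LI A) : MeasurableSet A := by
  obtain ⟨_, W, hW, h2⟩ := h
  exact h2.measurable hW
lemma Ev.li {R : Set V} (hR : R.Finite) (S T : Set V) : LI (Ev R S T) :=
  ⟨Ev.inc _ _ _, R, hR, Ev.dep _ _ _⟩
lemma LR.li (a b c d : ℤ) : LI (LR a b c d) := Ev.li (bx_finite _ _ _ _) _ _
lemma TB.li (a b c d : ℤ) : LI (TB a b c d) := Ev.li (bx_finite _ _ _ _) _ _
lemma circ_li (N : ℤ) : LI (circ N) :=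
  ((TB.li _ _ _ _).inter (TB.li _ _ _ _)).inter ((LR.li _ _ _ _).inter (LR.li _ _ _ _))

namespace Perc
variable {μ : Measure EdgeCfg} (hμ : Perc μ)
include hμ

lemma pos_assoc {A B : Set EdgeCfg} (h : LI A) (h' : LI B) :
    μ.real A * μ.real B ≤ μ.real (A ∩ B) := by
  obtain ⟨h1, W, hW, h2⟩ := h
  obtain ⟨h1', W', hW', h2'⟩ := h'
  exact hμ.pa (W ∪ W') A B (hW.union hW') (h2.mono Set.subset_union_left)
    (h2'.mono Set.subset_union_right) h1 h1'

lemma le_one (A : Set EdgeCfg) : μ.real A ≤ 1 := by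
  have := hμ.prob
  exact measureReal_le_one

lemma mono {A B : Set EdgeCfg} (h : A ⊆ B) : μ.real A ≤ μ.real B := by
  have := hμ.prob
  exact measureReal_mono h

/-- Square root trick. -/
lemma sqrt_trick {A B : Set EdgeCfg} (h : LI A) (h' : LI B) :
    (1 - μ.real A) * (1 - μ.real B) ≤ 1 - μ.real (A ∪ B) := by
  have := hμ.prob
  have h1 := hμ.pos_assoc h h'
  have h2 := measureReal_union_add_inter (μ := μ) (s := A) (t := B) h'.meas
  nlinarith

lemma inter_fail {A B : Set EdgeCfg} (hA : MeasurableSet A) (hB : MeasurableSet B) :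
    1 - μ.real (A ∩ B) ≤ (1 - μ.real A) + (1 - μ.real B) := by
  have := hμ.prob
  have h2 := measureReal_union_add_inter (μ := μ) (s := A) (t := B) hB
  have := hμ.le_one (A ∪ B)
  linarith

omit hμ in
lemma CI_act {g : V ≃ V} (hg : Lat g) {η : EdgeCfg} {R : Set V} {u v : V} :
    CI (act g η) (g ⁻¹' R) u v ↔ CI η R (g u) (g v) := by
  have hg := hg.adj
  have key : ∀ (g : V ≃ V), (∀ a b, SqAdj (g a) (g b) ↔ SqAdj a b) → ∀ (η : EdgeCfg) (R : Set V) (u v : V),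
      CI (act g η) (g ⁻¹' R) u v → CI η R (g u) (g v) := by
    rintro g hg η R u v ⟨h1, h2⟩
    refine ⟨h1, ?_⟩
    induction h2 with
    | refl => exact .refl
    | tail _ h ih => exact ih.tail ⟨⟨(hg _ _).2 h.1.1, h.1.2⟩, h.2⟩
  refine ⟨key g hg η R u v, fun h => ?_⟩
  have hg' : ∀ a b, SqAdj (g.symm a) (g.symm b) ↔ SqAdj a b := fun a b => by
    rw [← hg]; simp
  have := key g.symm hg' (act g η) (g ⁻¹' R) (g u) (g v)
  have e1 : act g.symm (act g η) = η := by ext a b; simp [act]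
  have e2 : g.symm ⁻¹' (g ⁻¹' R) = R := by ext a; simp
  rw [e1, e2] at this
  simpa using this h

lemma inv_real {g : V ≃ V} (hg : Lat g) {A : Set EdgeCfg} (hA : MeasurableSet A) :
    μ.real (act g ⁻¹' A) = μ.real A := by
  conv_rhs => rw [← hμ.inv g hg]
  rw [map_measureReal_apply (act_meas g) hA]

omit hμ in
lemma act_Ev {g : V ≃ V} (hg : Lat g) (R S T : Set V) :
    act g ⁻¹' (Ev (g ⁻¹' R) (g ⁻¹' S) (g ⁻¹' T)) = Ev R S T := by
  ext η
  constructor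
  · rintro ⟨u, hu, v, hv, h⟩
    exact ⟨g u, hu, g v, hv, (CI_act hg).1 h⟩
  · rintro ⟨u, hu, v, hv, h⟩
    refine ⟨g.symm u, by simpa using hu, g.symm v, by simpa using hv, (CI_act hg).2 (by simpa using h)⟩

lemma inv_Ev {g : V ≃ V} (hg : Lat g) {R : Set V} (hR : R.Finite) (S T : Set V) :
    μ.real (Ev (g ⁻¹' R) (g ⁻¹' S) (g ⁻¹' T)) = μ.real (Ev R S T) := by
  rw [← act_Ev hg R S T, hμ.inv_real hg]
  exact (Ev.li (hR.preimage g.injective.injOn) _ _).meas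

end Perc

def trE (t : V) : V ≃ V := Equiv.addRight t
def rxE : V ≃ V := Equiv.prodCongr (Equiv.neg ℤ) (Equiv.refl ℤ)
def ryE : V ≃ V := Equiv.prodCongr (Equiv.refl ℤ) (Equiv.neg ℤ)
def swE : V ≃ V := Equiv.prodComm ℤ ℤ
lemma trE_lat (t : V) : Lat (trE t) := ⟨fun a b => by simp [trE, SqAdj],
  fun m => m + (t + t), fun a b h => by simpa using h, fun a b => by simp only [trE, Equiv.coe_addRight]; abel⟩
lemma rxE_lat : Lat rxE := ⟨fun a b => by
  simp only [rxE, SqAdj, Equiv.prodCongr_apply, Prod.map, Equiv.neg_apply, Equiv.refl_apply]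
  ring_nf, rxE, rxE.injective, fun a b => by
  ext <;> simp [rxE]; ring⟩
lemma ryE_lat : Lat ryE := ⟨fun a b => by
  simp only [ryE, SqAdj, Equiv.prodCongr_apply, Prod.map, Equiv.neg_apply, Equiv.refl_apply]
  ring_nf, ryE, ryE.injective, fun a b => by
  ext <;> simp [ryE]; ring⟩
lemma swE_lat : Lat swE := ⟨fun a b => by
  simp only [swE, SqAdj, Equiv.prodComm_apply, Prod.fst_swap, Prod.snd_swap, add_comm],
  swE, swE.injective, fun a b => by ext <;> simp [swE]⟩
lemma trE_apply (t v : V) : trE t v = (v.1 + t.1, v.2 + t.2) := rfl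
lemma rxE_apply (v : V) : rxE v = (-v.1, v.2) := rfl
lemma ryE_apply (v : V) : ryE v = (v.1, -v.2) := rfl
lemma swE_apply (v : V) : swE v = (v.2, v.1) := rfl

/-- Crossing probability of a `w × h` rectangle. -/
noncomputable def hP (μ : Measure EdgeCfg) (w h : ℤ) : ℝ := μ.real (LR 0 w 0 h)

namespace Perc
variable {μ : Measure EdgeCfg} (hμ : Perc μ)
include hμ

lemma inv_Ev' {g : V ≃ V} (hg : Lat g) {R S T R' S' T' : Set V} (hR : R.Finite)
    (h1 : ∀ v, v ∈ R' ↔ g v ∈ R) (h2 : ∀ v, v ∈ S' ↔ g v ∈ S) (h3 : ∀ v, v ∈ T' ↔ g v ∈ T) :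
    μ.real (Ev R' S' T') = μ.real (Ev R S T) := by
  rw [← hμ.inv_Ev hg hR S T]
  congr <;> ext v
  · exact h1 v
  · exact h2 v
  · exact h3 v

lemma LR_eq (a b c d : ℤ) : μ.real (LR a b c d) = hP μ (b - a) (d - c) := by
  symm
  refine hμ.inv_Ev' (trE_lat (a, c)) (bx_finite _ _ _ _) ?_ ?_ ?_ <;> intro v <;>
    simp only [trE_apply, bx, Set.mem_ofPred_eq] <;> omega

lemma TB_eq (a b c d : ℤ) : μ.real (TB a b c d) = hP μ (d - c) (b - a) := by
  rw [← hμ.LR_eq c d a b]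
  refine hμ.inv_Ev' swE_lat (bx_finite _ _ _ _) ?_ ?_ ?_ <;> intro v <;>
    simp only [swE_apply, bx, Set.mem_ofPred_eq] <;> omega

lemma hP_anti {w w' h h' : ℤ} (h0 : 0 ≤ w) (hw : w ≤ w') (hh : h' ≤ h) : hP μ w' h' ≤ hP μ w h :=
  hμ.mono (LR.shrink le_rfl h0 hw le_rfl hh)

/-- Gluing rectangles, product form. -/
lemma hP_glue {w w' e h : ℤ} (he : 0 ≤ e) (h1 : e ≤ w) (h2 : e ≤ w') :
    hP μ w h * hP μ w' h * hP μ h e ≤ hP μ (w + w' - e) h := by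
  have k1 := hμ.LR_eq 0 w 0 h
  have k2 := hμ.LR_eq (w - e) (w + w' - e) 0 h
  have k3 := hμ.TB_eq (w - e) w 0 h
  have k4 := hμ.LR_eq 0 (w + w' - e) 0 h
  simp only [sub_zero] at k1 k2 k3 k4
  rw [show w + w' - e - (w - e) = w' by ring] at k2
  rw [show w - (w - e) = e by ring] at k3
  rw [← k1, ← k2, ← k3, ← k4]
  refine le_trans ?_ (hμ.mono (glue (a := 0) (a' := w - e) (b := w) (b' := w + w' - e) (c := 0)
    (d := h) (by omega) (by omega) (by omega)))
  refine le_trans ?_ (hμ.pos_assoc ((LR.li _ _ _ _).inter (LR.li _ _ _ _)) (TB.li _ _ _ _))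
  exact mul_le_mul_of_nonneg_right (hμ.pos_assoc (LR.li _ _ _ _) (LR.li _ _ _ _)) measureReal_nonneg

lemma one_sub_mul3 {a b c : ℝ} (ha : 0 ≤ a) (hb : 0 ≤ b) (hc : 0 ≤ c) (ha1 : a ≤ 1) (hb1 : b ≤ 1)
    (hc1 : c ≤ 1) : 1 - a * b * c ≤ (1 - a) + (1 - b) + (1 - c) := by
  have h1 : (1 - a) * (1 - b) ≥ 0 := mul_nonneg (by linarith) (by linarith)
  have h2 : (1 - a * b) * (1 - c) ≥ 0 :=
    mul_nonneg (by nlinarith) (by linarith)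
  nlinarith

lemma hP_nonneg (w h : ℤ) : 0 ≤ hP μ w h := measureReal_nonneg
lemma hP_le_one (w h : ℤ) : hP μ w h ≤ 1 := hμ.le_one _

/-- Gluing rectangles, union bound form. -/
lemma hP_glue' {w w' e h : ℤ} (he : 0 ≤ e) (h1 : e ≤ w) (h2 : e ≤ w') :
    1 - hP μ (w + w' - e) h ≤ (1 - hP μ w h) + (1 - hP μ w' h) + (1 - hP μ h e) := by
  have := hμ.hP_glue (h := h) he h1 h2
  have := hμ.one_sub_mul3 (hμ.hP_nonneg w h) (hμ.hP_nonneg w' h) (hμ.hP_nonneg h e)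
    (hμ.hP_le_one _ _) (hμ.hP_le_one _ _) (hμ.hP_le_one _ _)
  linarith

lemma circ_ge (N : ℤ) : hP μ (4 * N) N ^ 4 ≤ μ.real (circ N) := by
  have k1 := hμ.TB_eq N (2 * N) (-(2 * N)) (2 * N)
  have k2 := hμ.TB_eq (-(2 * N)) (-N) (-(2 * N)) (2 * N)
  have k3 := hμ.LR_eq (-(2 * N)) (2 * N) N (2 * N)
  have k4 := hμ.LR_eq (-(2 * N)) (2 * N) (-(2 * N)) (-N)
  ring_nf at k1 k2 k3 k4
  have := hμ.pos_assoc ((TB.li N (2 * N) (-(2 * N)) (2 * N)).inter (TB.li (-(2 * N)) (-N) (-(2 * N)) (2 * N)))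
    ((LR.li (-(2 * N)) (2 * N) N (2 * N)).inter (LR.li (-(2 * N)) (2 * N) (-(2 * N)) (-N)))
  refine le_trans ?_ this
  have e1 := hμ.pos_assoc (TB.li N (2 * N) (-(2 * N)) (2 * N)) (TB.li (-(2 * N)) (-N) (-(2 * N)) (2 * N))
  have e2 := hμ.pos_assoc (LR.li (-(2 * N)) (2 * N) N (2 * N)) (LR.li (-(2 * N)) (2 * N) (-(2 * N)) (-N))
  ring_nf at e1 e2 ⊢
  rw [k1, k2] at e1
  rw [k3, k4] at e2
  have := hμ.hP_nonneg (N * 4) N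
  calc hP μ (N * 4) N ^ 4 = (hP μ (N * 4) N * hP μ (N * 4) N) * (hP μ (N * 4) N * hP μ (N * 4) N) := by ring
    _ ≤ _ := mul_le_mul e1 e2 (by positivity) measureReal_nonneg

end Perc
end DaC


namespace DaC

/-! ## Part 1c: Russo-Seymour-Welsh theory after Tassion -/

lemma CI.hook {η : EdgeCfg} {R S : Set V} {u v w z : V} {a b M : ℤ}
    (h : CI η R u v) (h' : CI η S w z)
    (hR : ∀ x ∈ R, x.1 ≤ b ∧ -M ≤ x.2 ∧ x.2 ≤ M) (hS : ∀ x ∈ S, a ≤ x.1 ∧ x.1 ≤ b)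
    (hu : u.1 ≤ a) (hv : v.1 = b) (hw : w.1 = b) (hz : z.1 = b) (h2 : w.2 ≤ v.2) (h1 : v.2 ≤ z.2) :
    ∃ x, CI η R u x ∧ CI η S w x := by
  have hw' : w = (b, w.2) := by rw [← hw]
  have hz' : z = (b, z.2) := by rw [← hz]
  have h'' := h'.sc
  rw [hw', hz'] at h''
  obtain ⟨x, h1, h2⟩ := hook_lemma (a := a) (M := M) h.sc h''
    (fun x hx => (hR x (CI.mem_right hx)).1) (fun x hx => hS x (CI.mem_right hx))
    (fun x hx => (hR x (CI.mem_right hx)).2) hu hv h2 h1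
  exact ⟨x, h1, by rw [hw']; exact h2⟩

lemma CI.rx {η : EdgeCfg} {R : Set V} {u v : V} (h : CI η R u v) :
    CI (act rxE η) (rxE ⁻¹' R) (rxE u) (rxE v) := by
  rw [Perc.CI_act rxE_lat]
  simpa [rxE_apply] using h

lemma CI.hook' {η : EdgeCfg} {R S : Set V} {u v w z : V} {a b M : ℤ}
    (h : CI η R u v) (h' : CI η S w z)
    (hR : ∀ x ∈ R, a ≤ x.1 ∧ -M ≤ x.2 ∧ x.2 ≤ M) (hS : ∀ x ∈ S, a ≤ x.1 ∧ x.1 ≤ b)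
    (hu : b ≤ u.1) (hv : v.1 = a) (hw : w.1 = a) (hz : z.1 = a) (h2 : w.2 ≤ v.2) (h1 : v.2 ≤ z.2) :
    ∃ x, CI η R u x ∧ CI η S w x := by
  obtain ⟨x, k1, k2⟩ := CI.hook (a := -b) (b := -a) (M := M) h.rx h'.rx
    (by intro x hx
        have := hR _ hx
        simp only [rxE_apply] at this
        omega)
    (by intro x hx
        have := hS _ hx
        simp only [rxE_apply] at this
        omega) (by simp only [rxE_apply]; omega) (by simp only [rxE_apply]; omega)
        (by simp only [rxE_apply]; omega) (by simp only [rxE_apply]; omega) h2 h1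
  rw [Perc.CI_act rxE_lat] at k1 k2
  refine ⟨rxE x, ?_, ?_⟩
  · simpa [rxE_apply] using k1
  · simpa [rxE_apply] using k2

/-- Left side connected to a window of the right side. -/
def Hev (s α β : ℤ) : Set EdgeCfg :=
  Ev (BB s) {u | u.1 ≤ -s} {v | s ≤ v.1 ∧ α ≤ v.2 ∧ v.2 ≤ β}
def E2 (s α : ℤ) : Set EdgeCfg := Ev (BB s) {u | u.1 ≤ -s} {v | s ≤ v.1 ∧ v.2 ≤ -α}
def E3 (s α : ℤ) : Set EdgeCfg := Ev (BB s) {u | s ≤ u.1} {v | v.1 ≤ -s ∧ α ≤ v.2}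
def E4 (s α : ℤ) : Set EdgeCfg := Ev (BB s) {u | s ≤ u.1} {v | v.1 ≤ -s ∧ v.2 ≤ -α}
def Ga1 (s' s h β : ℤ) : Set EdgeCfg :=
  Ev (bx (s' - 2 * s) s' (h - s) (h + s)) {u | u.1 ≤ s' - 2 * s} {v | s' ≤ v.1 ∧ h ≤ v.2 ∧ v.2 ≤ h + β}
def Ga2 (s' s h β : ℤ) : Set EdgeCfg :=
  Ev (bx (-s') (2 * s - s') (h - s) (h + s)) {u | 2 * s - s' ≤ u.1}
    {v | v.1 ≤ -s' ∧ h ≤ v.2 ∧ v.2 ≤ h + β}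

lemma tassion_geom {s' s α β : ℤ} (h0 : 0 ≤ α) (h1 : α ≤ s') (h2 : s' ≤ s) (h3 : s ≤ 2 * s')
    (hβ : β ≤ 2 * α) :
    (Hev s' α s' ∩ E2 s' α) ∩ (E3 s' α ∩ E4 s' α) ∩
      (TB (-s') s' (-s') s' ∩ (Ga1 s' s (-α) β ∩ Ga2 s' s (-α) β)) ⊆
    LR (s' - 2 * s) (2 * s - s') (-s - α) (2 * s' - α) := by
  rintro η ⟨⟨⟨⟨u1, hu1, v1, ⟨hv1, hv1', -⟩, e1⟩, ⟨u2, hu2, v2, ⟨hv2, hv2'⟩, e2⟩⟩,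
    ⟨u3, hu3, v3, ⟨hv3, hv3'⟩, e3⟩, ⟨u4, hu4, v4, ⟨hv4, hv4'⟩, e4⟩⟩, ⟨t, ht, t', ht', eT⟩,
    ⟨p, hp, q, ⟨hq1, hq2, hq3⟩, g1⟩, ⟨p', hp', q', ⟨hq1', hq2', hq3'⟩, g2⟩⟩
  simp only [Set.mem_ofPred_eq] at *
  have key : ∀ u v, CI η (BB s') u v → u.1 ≤ -s' → s' ≤ v.1 → CI η (BB s') t u := by
    intro u v h k1 k2
    obtain ⟨x, x1, x2⟩ := h.cross eT (a := -s') (b := s') (c := -s') (d := s')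
      (fun x hx => hx.2.2) (fun x hx => ⟨hx.1, hx.2.1⟩) k1 k2 ht ht'
    exact x2.trans x1.symm
  have c1 := (key _ _ e1 hu1 hv1).trans e1
  have c2 := (key _ _ e2 hu2 hv2).trans e2
  have c3 := key _ _ e3.symm hv3 hu3
  have c4 := key _ _ e4.symm hv4 hu4
  have m1 := e1.mem_right
  have m2 := e2.mem_right
  have m3 := e3.mem_right
  have m4 := e4.mem_right
  have mq := g1.mem_right
  have mq' := g2.mem_right
  simp only [bx, Set.mem_ofPred_eq] at m1 m2 m3 m4 mq mq'
  obtain ⟨x, x1, x2⟩ := g1.hook (c2.symm.trans c1) (a := -s') (b := s') (M := 2 * s + 2 * s')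
    (fun x hx => ⟨hx.2.1, by have := hx.2.2.1; omega, by have := hx.2.2.2; omega⟩)
    (fun x hx => ⟨hx.1, hx.2.1⟩) (by omega) (by omega) (by omega) (by omega) (by omega) (by omega)
  obtain ⟨y, y1, y2⟩ := g2.hook' (c4.symm.trans c3) (a := -s') (b := s') (M := 2 * s + 2 * s')
    (fun x hx => ⟨hx.1, by have := hx.2.2.1; omega, by have := hx.2.2.2; omega⟩)
    (fun x hx => ⟨hx.1, hx.2.1⟩) (by omega) (by omega) (by omega) (by omega) (by omega) (by omega)
  have i1 : bx (s' - 2 * s) s' (-α - s) (-α + s) ⊆ bx (s' - 2 * s) (2 * s - s') (-s - α) (2 * s' - α) :=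
    bx_mono (by omega) (by omega) (by omega) (by omega)
  have i2 : bx (-s') (2 * s - s') (-α - s) (-α + s) ⊆ bx (s' - 2 * s) (2 * s - s') (-s - α) (2 * s' - α) :=
    bx_mono (by omega) (by omega) (by omega) (by omega)
  have i3 : BB s' ⊆ bx (s' - 2 * s) (2 * s - s') (-s - α) (2 * s' - α) :=
    bx_mono (by omega) (by omega) (by omega) (by omega)
  refine ⟨p, hp, p', hp', ?_⟩
  have z1 : CI η (BB s') x y := x2.symm.trans (c2.symm.trans (c4.trans y2))
  exact (x1.mono i1).trans ((z1.mono i3).trans (y1.symm.mono i2))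

lemma Hev.li (s α β : ℤ) : LI (Hev s α β) := Ev.li (bx_finite _ _ _ _) _ _

noncomputable def sq1 (c : ℝ) : ℝ := 1 - Real.sqrt (1 - c)

lemma sq1_of {x y c : ℝ} (hx : x ≤ 1) (hy : y ≤ 1) (h : (1 - x) * (1 - y) ≤ 1 - c) (hxc : x < sq1 c) :
    sq1 c ≤ y := by
  unfold sq1 at *
  set t := Real.sqrt (1 - c) with ht
  have h0 : 0 ≤ t := Real.sqrt_nonneg _
  have h1 : t < 1 - x := by linarith
  have h2 : 0 ≤ 1 - c := le_trans (mul_nonneg (by linarith) (by linarith)) h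
  have h3 : t * t = 1 - c := Real.mul_self_sqrt h2
  by_contra hcon
  push Not at hcon
  nlinarith

lemma sq1_self {x c : ℝ} (hx : x ≤ 1) (h : (1 - x) * (1 - x) ≤ 1 - c) : sq1 c ≤ x := by
  by_contra hcon
  push Not at hcon
  exact absurd (sq1_of hx hx h hcon) (by linarith)

lemma sq1_nonneg {c : ℝ} (h : 0 ≤ c) : 0 ≤ sq1 c := by
  unfold sq1
  have : Real.sqrt (1 - c) ≤ 1 := Real.sqrt_le_one.2 (by linarith)
  linarith

lemma sq1_pos {c : ℝ} (h : 0 < c) : 0 < sq1 c := by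
  unfold sq1
  have : Real.sqrt (1 - c) < 1 := by rw [Real.sqrt_lt' one_pos]; linarith
  linarith

lemma sq1_le {c : ℝ} (h : 0 ≤ c) (h1 : c ≤ 1) : sq1 c ≤ c := by
  unfold sq1
  have := Real.mul_self_sqrt (sub_nonneg.2 h1)
  have : Real.sqrt (1 - c) ≤ 1 := Real.sqrt_le_one.2 (by linarith)
  nlinarith [Real.sqrt_nonneg (1 - c)]

lemma sq1_le_one (c : ℝ) : sq1 c ≤ 1 := by
  unfold sq1; linarith [Real.sqrt_nonneg (1 - c)]

/-- The bound obtained for long crossings. -/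
noncomputable def gT (c : ℝ) : ℝ := sq1 (sq1 c) ^ 6 * c ^ 2

namespace Perc
variable {μ : Measure EdgeCfg} (hμ : Perc μ)
include hμ

lemma Hev_half {s : ℤ} {c : ℝ} (hs : 0 ≤ s) (h : c ≤ hP μ (2 * s) (2 * s)) :
    sq1 c ≤ μ.real (Hev s 0 s) := by
  have k1 := hμ.LR_eq (-s) s (-s) s
  rw [show s - -s = 2 * s by ring] at k1
  have e2 : μ.real (Hev s (-s) 0) = μ.real (Hev s 0 s) := by
    refine hμ.inv_Ev' ryE_lat (bx_finite _ _ _ _) ?_ ?_ ?_ <;> intro v <;>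
      simp only [ryE_apply, bx, Set.mem_ofPred_eq] <;> omega
  have sub : LR (-s) s (-s) s ⊆ Hev s 0 s ∪ Hev s (-s) 0 := by
    rintro η ⟨u, hu, v, hv, h⟩
    have m := h.mem_right
    rcases le_total 0 v.2 with k | k
    · exact Or.inl ⟨u, hu, v, ⟨hv, k, m.2.2.2⟩, h⟩
    · exact Or.inr ⟨u, hu, v, ⟨hv, m.2.2.1, k⟩, h⟩
  have t := hμ.sqrt_trick (Hev.li s 0 s) (Hev.li s (-s) 0)
  have := hμ.mono sub
  rw [e2] at t
  exact sq1_self (hμ.le_one _) (by linarith)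

lemma exists_alpha {s : ℕ} {c : ℝ} (h0 : 0 ≤ c) (h1 : c ≤ 1) (h : c ≤ hP μ (2 * s) (2 * s)) :
    ∃ a : ℕ, a ≤ s ∧ sq1 (sq1 c) ≤ μ.real (Hev s 0 a) ∧ sq1 (sq1 c) ≤ μ.real (Hev s a s) := by
  classical
  have hh := hμ.Hev_half (by positivity) h
  have hc1 := sq1_nonneg h0
  have hs : sq1 (sq1 c) ≤ μ.real (Hev s 0 (s : ℕ)) :=
    (sq1_le hc1 (sq1_le_one _)).trans hh
  have hex : ∃ a : ℕ, sq1 (sq1 c) ≤ μ.real (Hev s 0 a) := ⟨s, hs⟩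
  let a := Nat.find hex
  have ha : sq1 (sq1 c) ≤ μ.real (Hev s 0 a) := Nat.find_spec hex
  have has : a ≤ s := Nat.find_min' _ hs
  refine ⟨a, has, ha, ?_⟩
  rcases Nat.eq_zero_or_pos a with h | h
  · rw [h]; exact hs
  · have hlt : ¬ (sq1 (sq1 c) ≤ μ.real (Hev s 0 ((a - 1 : ℕ) : ℤ))) :=
      Nat.find_min hex (show a - 1 < a by omega)
    have sub : Hev s 0 s ⊆ Hev s 0 ((a - 1 : ℕ) : ℤ) ∪ Hev s a s := by
      rintro η ⟨u, hu, v, ⟨hv, hv1, hv2⟩, h⟩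
      rcases le_or_gt v.2 ((a - 1 : ℕ) : ℤ) with k | k
      · exact Or.inl ⟨u, hu, v, ⟨hv, hv1, k⟩, h⟩
      · exact Or.inr ⟨u, hu, v, ⟨hv, by omega, hv2⟩, h⟩
    have t := hμ.sqrt_trick (Hev.li s 0 ((a - 1 : ℕ) : ℤ)) (Hev.li s a s)
    have := hμ.mono sub
    exact sq1_of (hμ.le_one _) (hμ.le_one _) (by linarith) (not_le.1 hlt)

/-- One step of Tassion's argument. -/
lemma tassion_step {s' s α β : ℤ} (h0 : 0 ≤ α) (h1 : α ≤ s') (h2 : s' ≤ s) (h3 : s ≤ 2 * s')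
    (hβ : β ≤ 2 * α) {c c2 : ℝ} (hc : 0 ≤ c) (hc2 : 0 ≤ c2) (hs' : c ≤ hP μ (2 * s') (2 * s'))
    (hX : c2 ≤ μ.real (Hev s' α s')) (hG : c2 ≤ μ.real (Hev s 0 β)) :
    c2 ^ 6 * c ≤ hP μ (4 * s - 2 * s') (s + 2 * s') := by
  have fin : ∀ n : ℤ, (BB n).Finite := fun n => bx_finite _ _ _ _
  have p2 : μ.real (E2 s' α) = μ.real (Hev s' α s') := by
    have : μ.real (Hev s' α s') = μ.real (Ev (BB s') {u | u.1 ≤ -s'} {v | s' ≤ v.1 ∧ α ≤ v.2}) := by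
      congr 1
      ext η
      constructor
      · rintro ⟨u, hu, v, hv, h⟩
        exact ⟨u, hu, v, ⟨hv.1, hv.2.1⟩, h⟩
      · rintro ⟨u, hu, v, hv, h⟩
        exact ⟨u, hu, v, ⟨hv.1, hv.2, h.mem_right.2.2.2⟩, h⟩
    rw [this]
    refine hμ.inv_Ev' ryE_lat (bx_finite _ _ _ _) ?_ ?_ ?_ <;> intro v <;>
      simp only [ryE_apply, bx, Set.mem_ofPred_eq] <;> omega
  have p4 : μ.real (E4 s' α) = μ.real (E2 s' α) := by
    refine hμ.inv_Ev' rxE_lat (bx_finite _ _ _ _) ?_ ?_ ?_ <;> intro v <;>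
      simp only [rxE_apply, bx, Set.mem_ofPred_eq] <;> omega
  have p3 : μ.real (E3 s' α) = μ.real (E4 s' α) := by
    refine hμ.inv_Ev' ryE_lat (bx_finite _ _ _ _) ?_ ?_ ?_ <;> intro v <;>
      simp only [ryE_apply, bx, Set.mem_ofPred_eq] <;> omega
  have p5 := hμ.TB_eq (-s') s' (-s') s'
  rw [show s' - -s' = 2 * s' by ring] at p5
  have p6 : μ.real (Hev s 0 β) = μ.real (Ga1 s' s (-α) β) := by
    refine hμ.inv_Ev' (trE_lat (s' - s, -α)) (bx_finite _ _ _ _) ?_ ?_ ?_ <;> intro v <;>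
      simp only [trE_apply, bx, Set.mem_ofPred_eq] <;> omega
  have p7 : μ.real (Ga2 s' s (-α) β) = μ.real (Ga1 s' s (-α) β) := by
    refine hμ.inv_Ev' rxE_lat (bx_finite _ _ _ _) ?_ ?_ ?_ <;> intro v <;>
      simp only [rxE_apply, bx, Set.mem_ofPred_eq] <;> omega
  have l1 : LI (Hev s' α s') := Ev.li (fin _) _ _
  have l2 : LI (E2 s' α) := Ev.li (fin _) _ _
  have l3 : LI (E3 s' α) := Ev.li (fin _) _ _
  have l4 : LI (E4 s' α) := Ev.li (fin _) _ _
  have l5 := TB.li (-s') s' (-s') s'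
  have l6 : LI (Ga1 s' s (-α) β) := Ev.li (bx_finite _ _ _ _) _ _
  have l7 : LI (Ga2 s' s (-α) β) := Ev.li (bx_finite _ _ _ _) _ _
  have geo := hμ.mono (tassion_geom h0 h1 h2 h3 hβ)
  rw [hμ.LR_eq, show 2 * s - s' - (s' - 2 * s) = 4 * s - 2 * s' by ring,
    show 2 * s' - α - (-s - α) = s + 2 * s' by ring] at geo
  refine le_trans ?_ geo
  refine le_trans ?_ (hμ.pos_assoc ((l1.inter l2).inter (l3.inter l4)) (l5.inter (l6.inter l7)))
  have a1 := hμ.pos_assoc l1 l2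
  have a2 := hμ.pos_assoc l3 l4
  have a3 := hμ.pos_assoc (l1.inter l2) (l3.inter l4)
  have a4 := hμ.pos_assoc l6 l7
  have a5 := hμ.pos_assoc l5 (l6.inter l7)
  have b1 : c2 * c2 ≤ μ.real (Hev s' α s' ∩ E2 s' α) :=
    (mul_le_mul hX (hX.trans p2.ge) hc2 measureReal_nonneg).trans a1
  have b2 : c2 * c2 ≤ μ.real (E3 s' α ∩ E4 s' α) :=
    (mul_le_mul (by rw [p3, p4, p2]; exact hX) (by rw [p4, p2]; exact hX) hc2 measureReal_nonneg).trans a2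
  have b3 := (mul_le_mul b1 b2 (by positivity) measureReal_nonneg).trans a3
  have b4 : c2 * c2 ≤ μ.real (Ga1 s' s (-α) β ∩ Ga2 s' s (-α) β) :=
    (mul_le_mul (by rw [← p6]; exact hG) (by rw [p7, ← p6]; exact hG) hc2 measureReal_nonneg).trans a4
  have b5 : c * (c2 * c2) ≤ _ := (mul_le_mul (by rw [p5]; exact hs') b4 (by positivity) measureReal_nonneg).trans a5
  calc c2 ^ 6 * c = (c2 * c2 * (c2 * c2)) * (c * (c2 * c2)) := by ring
    _ ≤ _ := mul_le_mul b3 b5 (by positivity) measureReal_nonneg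

/-- The sequence of half-scales. -/
def tSeq (t0 : ℕ) : ℕ → ℕ
  | 0 => t0
  | k + 1 => (3 * tSeq t0 k + 1) / 2

omit hμ in
lemma tSeq_ge (t0 : ℕ) : ∀ k, t0 ≤ tSeq t0 k
  | 0 => le_rfl
  | k + 1 => by have := tSeq_ge t0 k; simp only [tSeq]; omega

omit hμ in
lemma tSeq_le (t0 : ℕ) (h : 5 ≤ t0) : ∀ k, (tSeq t0 k : ℝ) ≤ (8 / 5) ^ k * t0
  | 0 => by simp [tSeq]
  | k + 1 => by
    have h1 := tSeq_le t0 h k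
    have h2 := tSeq_ge t0 k
    have h3 : 5 * tSeq t0 (k + 1) ≤ 8 * tSeq t0 k := by simp only [tSeq]; omega
    have h4 : (5 : ℝ) * tSeq t0 (k + 1) ≤ 8 * tSeq t0 k := by exact_mod_cast h3
    rw [pow_succ]; linarith

/-- Tassion's theorem. -/
theorem tassion {c : ℝ} (hc : 0 < c) (hc1 : c ≤ 1) (N0 : ℕ)
    (hsq : ∀ n : ℕ, N0 ≤ n → c ≤ hP μ (2 * n) (2 * n)) (K n0 : ℕ) :
    ∃ n : ℕ, n0 ≤ n ∧ 1 ≤ n ∧ c * gT c ^ (8 * K) ≤ hP μ (K * n) n := by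
  set c2 := sq1 (sq1 c) with hc2
  have hc2p : 0 < c2 := sq1_pos (sq1_pos hc)
  have hα : ∀ s : ℕ, N0 ≤ s → ∃ a : ℕ, a ≤ s ∧ c2 ≤ μ.real (Hev s 0 a) ∧ c2 ≤ μ.real (Hev s a s) :=
    fun s hs => hμ.exists_alpha hc.le hc1 (hsq s hs)
  choose! α hα1 hα2 hα3 using hα
  set t0 := max (max N0 n0) 5 with ht0
  have t0N : N0 ≤ t0 := (le_max_left _ _).trans (le_max_left _ _)
  have t0n : n0 ≤ t0 := (le_max_right _ _).trans (le_max_left _ _)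
  have t05 : 5 ≤ t0 := le_max_right _ _
  let t := tSeq t0
  have hex : ∃ k, α (2 * t (k + 1)) ≤ 2 * α (2 * t k) := by
    by_contra hcon
    push Not at hcon
    have grow : ∀ k, 2 ^ k ≤ α (2 * t k) + 1 := by
      intro k
      induction k with
      | zero => simp
      | succ k ih => have := hcon k; rw [pow_succ]; omega
    have bound : ∀ k : ℕ, (2 : ℝ) ^ k ≤ 3 * t0 * (8 / 5) ^ k := by
      intro k
      have h1 := grow k
      have tk : t0 ≤ t k := tSeq_ge t0 k
      have h2 := hα1 (2 * t k) (by omega)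
      have h3 : (2 : ℝ) ^ k ≤ 3 * t k := by
        have : 2 ^ k ≤ 3 * t k := by omega
        exact_mod_cast this
      have := tSeq_le t0 t05 k
      have : (t k : ℝ) ≤ (8 / 5) ^ k * t0 := this
      linarith
    have h54 : ∀ k : ℕ, (5 / 4 : ℝ) ^ k ≤ 3 * t0 := by
      intro k
      have := bound k
      have e : (2 : ℝ) ^ k = (5 / 4) ^ k * (8 / 5) ^ k := by rw [← mul_pow]; norm_num
      rw [e] at this
      exact le_of_mul_le_mul_right this (by positivity)
    obtain ⟨k, hk⟩ := pow_unbounded_of_one_lt (3 * (t0 : ℝ)) (by norm_num : (1 : ℝ) < 5 / 4)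
    exact absurd (h54 k) (by linarith)
  obtain ⟨k, hk⟩ := hex
  have tk : t0 ≤ t k := tSeq_ge t0 k
  have tk1 : t (k + 1) = (3 * t k + 1) / 2 := rfl
  set s' := 2 * t k with hs'
  set s := 2 * t (k + 1) with hs
  have hs1 : 3 * s' ≤ 2 * s := by omega
  have hs2 : 5 * s ≤ 8 * s' := by omega
  have step := hμ.tassion_step (s' := s') (s := s) (α := α s') (β := α s) (by positivity)
    (by exact_mod_cast hα1 s' (by omega)) (by omega) (by omega) (by exact_mod_cast hk) hc.le hc2p.le
    (hsq s' (by omega)) (hα3 s' (by omega)) (hα2 s (by omega))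
  set H : ℕ := s + 2 * s' with hH
  let e : ℤ := 3 * s - 4 * s'
  have hsqH : c ≤ hP μ H H := by
    have := hsq (t (k + 1) + 2 * t k) (by omega)
    have e : (2 * ((t (k + 1) + 2 * t k : ℕ) : ℤ)) = H := by rw [hH]; push_cast; omega
    rwa [e] at this
  have step' : c2 ^ 6 * c ≤ hP μ (H + e) H := by
    have e : (4 * (s : ℤ) - 2 * s') = H + e := by simp only [hH, e]; push_cast; ring
    rw [e] at step
    convert step using 2
    rw [hH]; push_cast; ring
  have he : 0 ≤ e := by omega
  have iter : ∀ j : ℕ, c * gT c ^ j ≤ hP μ (H + j * e) H := by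
    intro j
    induction j with
    | zero => simpa using hsqH
    | succ j ih =>
      have hje : 0 ≤ (j : ℤ) * e := by positivity
      have g := hμ.hP_glue (w := H + j * e) (w' := H + e) (e := H) (h := H) (by positivity)
        (by omega) (by omega)
      have e1 : (H : ℤ) + j * e + (H + e) - H = H + ((j + 1 : ℕ) : ℤ) * e := by push_cast; ring
      rw [e1] at g
      refine le_trans ?_ g
      calc c * gT c ^ (j + 1) = (c * gT c ^ j) * (c2 ^ 6 * c) * c := by
            rw [pow_succ]; simp only [gT, ← hc2]; ring
        _ ≤ _ := mul_le_mul (mul_le_mul ih step' (by positivity) measureReal_nonneg) hsqH hc.le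
            (mul_nonneg measureReal_nonneg measureReal_nonneg)
  refine ⟨H, by omega, by omega, (iter (8 * K)).trans (hμ.hP_anti (by positivity) ?_ le_rfl)⟩
  have : (H : ℤ) ≤ 8 * e := by simp only [hH, e]; push_cast; omega
  push_cast
  nlinarith

/-- One arm from the origin gives crossings of squares. -/
lemma square_of_arm {θ : ℝ} (hθ : 0 ≤ θ) (n : ℕ)
    (h : θ ≤ μ.real (Ev (BB n) {(0, 0)} {v | (n : ℤ) ≤ nrm v})) :
    (θ / 4) ^ 2 ≤ hP μ (2 * n) (2 * n) := by
  have := hμ.prob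
  set R : Set EdgeCfg := Ev (BB n) {(0, 0)} {v | (n : ℤ) ≤ v.1} with hR
  set L : Set EdgeCfg := Ev (BB n) {(0, 0)} {v | v.1 ≤ -(n : ℤ)} with hL
  set T : Set EdgeCfg := Ev (BB n) {(0, 0)} {v | (n : ℤ) ≤ v.2} with hT
  set B : Set EdgeCfg := Ev (BB n) {(0, 0)} {v | v.2 ≤ -(n : ℤ)} with hB
  have z : ∀ v : V, v ∈ ({(0, 0)} : Set V) ↔ v.1 = 0 ∧ v.2 = 0 := by
    intro v; simp [Prod.ext_iff]
  have eL : μ.real L = μ.real R := by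
    refine hμ.inv_Ev' rxE_lat (bx_finite _ _ _ _) ?_ ?_ ?_ <;> intro v <;>
      simp only [rxE_apply, bx, Set.mem_ofPred_eq, z] <;> omega
  have eT : μ.real T = μ.real R := by
    refine hμ.inv_Ev' swE_lat (bx_finite _ _ _ _) ?_ ?_ ?_ <;> intro v <;>
      simp only [swE_apply, bx, Set.mem_ofPred_eq, z] <;> omega
  have eB : μ.real B = μ.real T := by
    refine hμ.inv_Ev' ryE_lat (bx_finite _ _ _ _) ?_ ?_ ?_ <;> intro v <;>
      simp only [ryE_apply, bx, Set.mem_ofPred_eq, z] <;> omega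
  have sub : Ev (BB n) {(0, 0)} {v | (n : ℤ) ≤ nrm v} ⊆ (R ∪ L) ∪ (T ∪ B) := by
    rintro η ⟨u, hu, v, hv, h⟩
    have : nrm v = n := le_antisymm (mem_BB.1 h.mem_right) hv
    rcases nrm_eq this with k | k | k | k
    · exact Or.inl (Or.inl ⟨u, hu, v, k.ge, h⟩)
    · exact Or.inl (Or.inr ⟨u, hu, v, k.le, h⟩)
    · exact Or.inr (Or.inl ⟨u, hu, v, k.ge, h⟩)
    · exact Or.inr (Or.inr ⟨u, hu, v, k.le, h⟩)
  have h1 := hμ.mono sub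
  have h2 := measureReal_union_le (μ := μ) (R ∪ L) (T ∪ B)
  have h3 := measureReal_union_le (μ := μ) R L
  have h4 := measureReal_union_le (μ := μ) T B
  have hR4 : θ / 4 ≤ μ.real R := by linarith
  have sub2 : R ∩ L ⊆ LR (-n) n (-n) n := by
    rintro η ⟨⟨u, hu, v, hv, h⟩, ⟨u', hu', v', hv', h'⟩⟩
    rw [Set.mem_singleton_iff] at hu hu'
    subst hu hu'
    exact ⟨v', hv', v, hv, h'.symm.trans h⟩
  have h5 := hμ.pos_assoc (A := R) (B := L) (Ev.li (bx_finite _ _ _ _) _ _) (Ev.li (bx_finite _ _ _ _) _ _)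
  have h6 := hμ.mono sub2
  rw [hμ.LR_eq, show (n : ℤ) - -n = 2 * n by ring] at h6
  rw [eL] at h5
  refine le_trans ?_ (h5.trans h6)
  rw [sq]; exact mul_le_mul hR4 hR4 (by positivity) measureReal_nonneg

end Perc
end DaC


namespace DaC

/-! ## Part 1d: from one-arm events to crossings with high probability -/

lemma Ev_sub_arm {R S T : Set V} {M L : ℤ} (hS : S ⊆ BB M) (hT : ∀ v ∈ T, L ≤ nrm v) (hML : M ≤ L) :
    Ev R S T ⊆ Ev (BB L) (BB M) {v | L ≤ nrm v} := by
  rintro η ⟨u, hu, v, hv, h⟩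
  obtain ⟨v', e, h'⟩ := h.haltAt nrm lip_nrm L ((mem_BB.1 (hS hu)).trans hML) (hT v hv)
  exact ⟨u, hS hu, v', e.ge, h'.mono fun x hx => mem_BB.2 hx.2⟩

/-- Arm event. -/
def arm (m N : ℕ) : Set EdgeCfg := Ev (BB N) (BB m) {v | (N : ℤ) ≤ nrm v}

/-- There is a circuit around `BB m` inside `BB M`. -/
def circs (m M : ℕ) : Set EdgeCfg := {η | ∃ N : ℕ, m ≤ N ∧ 2 * N ≤ M ∧ η ∈ circ N}

lemma ann_finite (N : ℤ) : (ann N).Finite := (bx_finite _ _ _ _).subset Set.diff_subset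

lemma circs_dep (m M : ℕ) : Dep (BB M) (circs m M) := by
  rintro η η' h ⟨N, h1, h2, h3⟩
  refine ⟨N, h1, h2, (circ_dep (by positivity)).mono ?_ η η' h h3⟩
  refine Set.diff_subset.trans (bx_mono ?_ ?_ ?_ ?_) <;> omega

namespace Perc
variable {μ : Measure EdgeCfg} (hμ : Perc μ)
include hμ

lemma zero_one {ε : ℕ → ℝ} (hM : Mix μ ε) (hε : Filter.Tendsto ε Filter.atTop (nhds 0)) {θ : ℝ}
    (hθ : 0 < θ) (harm : ∀ n : ℕ, θ ≤ μ.real (Ev (BB n) {(0, 0)} {v | (n : ℤ) ≤ nrm v})) :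
    ∀ δ > 0, ∃ m : ℕ, ∀ N : ℕ, m ≤ N → 1 - δ ≤ μ.real (arm m N) := by
  have := hμ.prob
  set p : ℕ → ℕ → ℝ := fun m N => μ.real (arm m N) with hp
  have anti : ∀ m N N', m ≤ N → N ≤ N' → p m N' ≤ p m N := fun m N N' h h' =>
    hμ.mono (Ev_sub_arm subset_rfl (fun v hv => le_trans (by exact_mod_cast h') hv) (by exact_mod_cast h))
  have bdd : ∀ m, BddBelow (Set.range fun N => p m (m + N)) := fun m =>
    ⟨0, by rintro _ ⟨N, rfl⟩; exact measureReal_nonneg⟩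
  let a : ℕ → ℝ := fun m => ⨅ N, p m (m + N)
  have ale : ∀ m N, m ≤ N → a m ≤ p m N := by
    intro m N h
    obtain ⟨k, rfl⟩ := Nat.exists_eq_add_of_le h
    exact ciInf_le (bdd m) k
  have aex : ∀ m, ∀ δ > 0, ∃ N0, m ≤ N0 ∧ ∀ N, N0 ≤ N → p m N ≤ a m + δ := by
    intro m δ hδ
    obtain ⟨k, hk⟩ := exists_lt_of_ciInf_lt (show a m < a m + δ by linarith)
    exact ⟨m + k, by omega, fun N hN => (anti m (m + k) N (by omega) hN).trans hk.le⟩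
  have a1 : ∀ m, a m ≤ 1 := fun m => (ale m m le_rfl).trans (hμ.le_one _)
  have bddA : BddAbove (Set.range a) := ⟨1, by rintro _ ⟨m, rfl⟩; exact a1 m⟩
  let A : ℝ := ⨆ m, a m
  have aA : ∀ m, a m ≤ A := fun m => le_ciSup bddA m
  have Aex : ∀ δ > 0, ∃ m, A - δ < a m := fun δ hδ =>
    exists_lt_of_lt_ciSup (show A - δ < A by linarith)
  have A1 : A ≤ 1 := ciSup_le a1
  have Aθ : θ ≤ A := by
    refine le_trans ?_ (aA 0)
    refine le_ciInf fun N => (harm (0 + N)).trans (hμ.mono ?_)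
    refine Ev.mono subset_rfl ?_ subset_rfl
    rintro v rfl
    simp [bx]
  have main : ∀ δ > 0, A - 3 * δ ≤ (A + δ) ^ 2 + δ := by
    intro δ hδ
    obtain ⟨m, hm⟩ := Aex δ hδ
    obtain ⟨N1, hN1, hN1'⟩ := aex m δ hδ
    obtain ⟨N2, hN2⟩ := Filter.eventually_atTop.1 (hε.eventually (gt_mem_nhds hδ))
    set N := max (max N1 N2) 1 with hN
    have N_1 : N1 ≤ N := (le_max_left _ _).trans (le_max_left _ _)
    have N_2 : N2 ≤ N := (le_max_right _ _).trans (le_max_left _ _)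
    have N_3 : 1 ≤ N := le_max_right _ _
    obtain ⟨L, hL, hL'⟩ := aex (m + 3 * N) δ hδ
    let t : V := (-(3 * (N : ℤ)), 0)
    have htr : ∀ n : ℕ, μ.real (Ev (trE t ⁻¹' (BB n)) (trE t ⁻¹' (BB m)) (trE t ⁻¹' {v | (n : ℤ) ≤ nrm v})) = p m n :=
      fun n => hμ.inv_Ev (trE_lat t) (bx_finite _ _ _ _) _ _
    set T : ℕ → Set EdgeCfg := fun n => Ev (trE t ⁻¹' (BB n)) (trE t ⁻¹' (BB m)) (trE t ⁻¹' {v | (n : ℤ) ≤ nrm v}) with hT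
    have s1 : arm m (L + 3 * N) ⊆ arm (m + 3 * N) L :=
      Ev_sub_arm (bx_mono (by push_cast; omega) (by push_cast; omega) (by push_cast; omega) (by push_cast; omega))
        (fun v hv => le_trans (by push_cast; omega) hv) (by exact_mod_cast hL)
    have s2 : T (L + 3 * N) ⊆ arm (m + 3 * N) L := by
      refine Ev_sub_arm ?_ ?_ (by exact_mod_cast hL)
      · rintro v hv
        simp only [Set.mem_preimage, trE_apply, bx, Set.mem_ofPred_eq, t] at hv ⊢
        push_cast; omega
      · intro v hv
        simp only [Set.mem_preimage, trE_apply, Set.mem_ofPred_eq, t] at hv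
        by_contra hcon
        push Not at hcon
        have h1 : nrm v ≤ (L : ℤ) - 1 := by omega
        rw [nrm_le] at h1
        have h2 : nrm (v.1 + -(3 * (N : ℤ)), v.2 + 0) ≤ (L : ℤ) + 3 * N - 1 := by
          rw [nrm_le]; simp only []; omega
        push_cast at hv; omega
    have k1 := measureReal_union_add_inter (μ := μ) (s := arm m (L + 3 * N)) (t := T (L + 3 * N))
      (Ev.li ((bx_finite _ _ _ _).preimage (trE t).injective.injOn) _ _).meas
    have k2 : μ.real (arm m (L + 3 * N) ∪ T (L + 3 * N)) ≤ A + δ :=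
      (hμ.mono (Set.union_subset s1 s2)).trans ((hL' L le_rfl).trans (by linarith [aA (m + 3 * N)]))
    have k3 : a m ≤ μ.real (arm m (L + 3 * N)) := ale _ _ (by omega)
    have k4 : a m ≤ μ.real (T (L + 3 * N)) := by rw [htr]; exact ale _ _ (by omega)
    have s3 : arm m (L + 3 * N) ⊆ arm m N :=
      Ev_sub_arm subset_rfl (fun v hv => le_trans (by push_cast; omega) hv) (by exact_mod_cast (by omega : m ≤ N))
    have s4 : T (L + 3 * N) ⊆ T N := by
      have e1 := Perc.act_Ev (g := trE (-t)) (trE_lat _)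
      rintro η ⟨u, hu, v, hv, h⟩
      have hle : N ≤ L + 3 * N := by omega
      obtain ⟨v', e, h'⟩ := h.haltAt (fun x => nrm (trE t x))
        (fun x y hxy => lip_nrm _ _ (((trE_lat t).adj x y).2 hxy)) N
        ((mem_BB.1 hu).trans (by exact_mod_cast (by omega : m ≤ N)))
        (le_trans (by push_cast; omega) hv)
      exact ⟨u, hu, v', e.ge, h'.mono fun x hx => (mem_BB (v := trE t x)).2 hx.2⟩
    have k5 := hμ.mono (Set.inter_subset_inter s3 s4)
    have k6 := hM N N_3 (BB N) (trE t ⁻¹' (BB N)) (arm m N) (T N)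
      (bx_mono (by omega) (by omega) (by omega) (by omega))
      (by rintro v hv
          simp only [Set.mem_preimage, trE_apply, bx, Set.mem_ofPred_eq, t] at hv ⊢
          omega)
      (by rintro u hu v hv
          simp only [Set.mem_preimage, trE_apply, bx, Set.mem_ofPred_eq, t] at hu hv
          by_contra hcon
          push Not at hcon
          have h1 : nrm (u - v) ≤ (N : ℤ) - 1 := by omega
          rw [nrm_le] at h1
          simp only [Prod.fst_sub, Prod.snd_sub] at h1
          omega) (Ev.dep _ _ _) (Ev.dep _ _ _)
    have k7 : μ.real (arm m N) ≤ A + δ := (hN1' N N_1).trans (by linarith [aA m])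
    have k8 : μ.real (T N) ≤ A + δ := by rw [htr]; exact k7
    have k9 := mul_le_mul k7 k8 measureReal_nonneg (by linarith)
    have k10 := hN2 N N_2
    nlinarith
  have A_ge : 1 ≤ A := by
    by_contra hcon
    push Not at hcon
    have hA0 : 0 < A := lt_of_lt_of_le hθ Aθ
    have := main (A * (1 - A) / 10) (by apply div_pos (mul_pos hA0 (by linarith)); norm_num)
    set x := A * (1 - A) with hx
    have hx0 : 0 < x := mul_pos hA0 (by linarith)
    have hx1 : x < 1 := by nlinarith
    nlinarith
  intro δ hδ
  obtain ⟨m, hm⟩ := Aex δ hδ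
  exact ⟨m, fun N hN => by linarith [ale m N hN]⟩

lemma circuits {ε : ℕ → ℝ} (hM : Mix μ ε) (hε : Filter.Tendsto ε Filter.atTop (nhds 0)) {g : ℝ}
    (hg : 0 < g) (hc : ∀ n0 : ℕ, ∃ N : ℕ, n0 ≤ N ∧ g ≤ μ.real (circ N)) (m : ℕ) :
    ∀ δ > 0, ∃ M : ℕ, m ≤ M ∧ 1 - δ ≤ μ.real (circs m M) := by
  have := hμ.prob
  intro δ hδ
  have hg1 : g ≤ 1 := by obtain ⟨N, _, h⟩ := hc 0; exact h.trans (hμ.le_one _)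
  have key : ∀ k : ℕ, ∃ M : ℕ, m ≤ M ∧ 1 - μ.real (circs m M) ≤ (1 - g) ^ k + δ / 2 := by
    intro k
    induction k with
    | zero => exact ⟨m, le_rfl, by simp; linarith [measureReal_nonneg (μ := μ) (s := circs m m)]⟩
    | succ k ih =>
      obtain ⟨M, hmM, hk⟩ := ih
      obtain ⟨n2, hn2⟩ := Filter.eventually_atTop.1
        (hε.eventually (gt_mem_nhds (show 0 < g * δ / 2 by positivity)))
      obtain ⟨N, hN, hgN⟩ := hc (4 * M + 2 * n2 + 4)
      have hn : n2 ≤ N / 2 := by omega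
      refine ⟨2 * N, by omega, ?_⟩
      have mix := hM (N / 2) (by omega) (BB M) (ann N) (circs m M)ᶜ (circ N)ᶜ
        (bx_mono (by push_cast; omega) (by push_cast; omega) (by push_cast; omega) (by push_cast; omega))
        (Set.diff_subset.trans
          (bx_mono (by push_cast; omega) (by push_cast; omega) (by push_cast; omega) (by push_cast; omega)))
        (by rintro u hu v ⟨-, hv⟩
            by_contra hcon
            push Not at hcon
            apply hv
            have h1 : nrm (u - v) ≤ ((N / 2 : ℕ) : ℤ) - 1 := by omega
            rw [nrm_le] at h1
            rw [mem_BB] at hu ⊢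
            rw [nrm_le] at hu ⊢
            simp only [Prod.fst_sub, Prod.snd_sub] at h1
            omega)
        (circs_dep m M).compl (circ_dep (by positivity)).compl
      have mC : MeasurableSet (circs m M) := (circs_dep m M).measurable (bx_finite _ _ _ _)
      have mC' : MeasurableSet (circs m (2 * N)) := (circs_dep m _).measurable (bx_finite _ _ _ _)
      have e1 := probReal_compl_eq_one_sub (μ := μ) mC
      have e2 := probReal_compl_eq_one_sub (μ := μ) (circ_li N).meas
      have e3 := probReal_compl_eq_one_sub (μ := μ) mC'
      have sub : (circs m (2 * N))ᶜ ⊆ (circs m M)ᶜ ∩ (circ N)ᶜ := by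
        intro η hη
        refine ⟨fun ⟨N', h1, h2, h3⟩ => hη ⟨N', h1, by omega, h3⟩, fun h => hη ⟨N, by omega, le_rfl, h⟩⟩
      have := hμ.mono sub
      have h3 := hn2 (N / 2) hn
      rw [← e3]
      rw [e1, e2] at mix
      have h4 : (1 - μ.real (circs m M)) * (1 - μ.real (circ N)) ≤ ((1 - g) ^ k + δ / 2) * (1 - g) :=
        mul_le_mul hk (by linarith) (by linarith [hμ.le_one (circ N)])
          (by have : 0 ≤ (1 - g) ^ k := pow_nonneg (by linarith) _
              linarith)
      rw [pow_succ]
      nlinarith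
  have ht : Filter.Tendsto (fun k : ℕ => (1 - g) ^ k) Filter.atTop (nhds 0) :=
    tendsto_pow_atTop_nhds_zero_of_lt_one (by linarith) (by linarith)
  obtain ⟨k, hk⟩ := (ht.eventually (gt_mem_nhds (show 0 < δ / 2 by positivity))).exists
  obtain ⟨M, h1, h2⟩ := key k
  exact ⟨M, h1, by linarith⟩

lemma squares_to_one {ε : ℕ → ℝ} (hM : Mix μ ε) (hε : Filter.Tendsto ε Filter.atTop (nhds 0)) {θ : ℝ}
    (hθ : 0 < θ) (harm : ∀ n : ℕ, θ ≤ μ.real (Ev (BB n) {(0, 0)} {v | (n : ℤ) ≤ nrm v})) :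
    ∀ δ > 0, ∃ N0 : ℕ, ∀ N : ℕ, N0 ≤ N → 1 - δ ≤ hP μ (2 * N) (2 * N) := by
  have := hμ.prob
  have hθ1 : θ ≤ 1 := (harm 0).trans (hμ.le_one _)
  have hc : 0 < (θ / 4) ^ 2 := by positivity
  have hc1 : (θ / 4) ^ 2 ≤ 1 := by nlinarith
  have hgT : 0 < gT ((θ / 4) ^ 2) := mul_pos (pow_pos (sq1_pos (sq1_pos hc)) _) (pow_pos hc _)
  have circ' : ∀ n0 : ℕ, ∃ N : ℕ, n0 ≤ N ∧
      ((θ / 4) ^ 2 * gT ((θ / 4) ^ 2) ^ (8 * 4)) ^ 4 ≤ μ.real (circ N) := by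
    intro n0
    obtain ⟨n, h1, h2, h3⟩ := hμ.tassion hc hc1 0 (fun n _ => hμ.square_of_arm hθ.le n (harm n)) 4 n0
    refine ⟨n, h1, le_trans ?_ (hμ.circ_ge n)⟩
    exact pow_le_pow_left₀ (by positivity) h3 4
  intro δ hδ
  set d := min (δ / 3) 1 with hd
  have d0 : 0 < d := lt_min (by positivity) one_pos
  have dδ : d ≤ δ / 3 := min_le_left _ _
  obtain ⟨m, hm⟩ := hμ.zero_one hM hε hθ harm (d ^ 4) (by positivity)
  obtain ⟨M, hmM, hMc⟩ := hμ.circuits hM hε (by positivity) circ' m d d0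
  refine ⟨M, fun N hN => ?_⟩
  set R : Set EdgeCfg := Ev (BB N) (BB m) {v | (N : ℤ) ≤ v.1} with hR
  set L : Set EdgeCfg := Ev (BB N) (BB m) {v | v.1 ≤ -(N : ℤ)} with hL
  set T : Set EdgeCfg := Ev (BB N) (BB m) {v | (N : ℤ) ≤ v.2} with hT
  set B : Set EdgeCfg := Ev (BB N) (BB m) {v | v.2 ≤ -(N : ℤ)} with hB
  have eL : μ.real L = μ.real R := by
    refine hμ.inv_Ev' rxE_lat (bx_finite _ _ _ _) ?_ ?_ ?_ <;> intro v <;>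
      simp only [rxE_apply, bx, Set.mem_ofPred_eq] <;> omega
  have eT : μ.real T = μ.real R := by
    refine hμ.inv_Ev' swE_lat (bx_finite _ _ _ _) ?_ ?_ ?_ <;> intro v <;>
      simp only [swE_apply, bx, Set.mem_ofPred_eq] <;> omega
  have eB : μ.real B = μ.real T := by
    refine hμ.inv_Ev' ryE_lat (bx_finite _ _ _ _) ?_ ?_ ?_ <;> intro v <;>
      simp only [ryE_apply, bx, Set.mem_ofPred_eq] <;> omega
  have sub : arm m N ⊆ (R ∪ L) ∪ (T ∪ B) := by
    rintro η ⟨u, hu, v, hv, h⟩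
    have : nrm v = N := le_antisymm (mem_BB.1 h.mem_right) hv
    rcases nrm_eq this with k | k | k | k
    · exact Or.inl (Or.inl ⟨u, hu, v, k.ge, h⟩)
    · exact Or.inl (Or.inr ⟨u, hu, v, k.le, h⟩)
    · exact Or.inr (Or.inl ⟨u, hu, v, k.ge, h⟩)
    · exact Or.inr (Or.inr ⟨u, hu, v, k.le, h⟩)
  have lR : LI R := Ev.li (bx_finite _ _ _ _) _ _
  have lL : LI L := Ev.li (bx_finite _ _ _ _) _ _
  have lT : LI T := Ev.li (bx_finite _ _ _ _) _ _
  have lB : LI B := Ev.li (bx_finite _ _ _ _) _ _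
  have q1 := hμ.sqrt_trick lR lL
  have q2 := hμ.sqrt_trick lT lB
  have q3 := hμ.sqrt_trick (lR.union lL) (lT.union lB)
  have q4 := hμ.mono sub
  have q5 := hm N (hmM.trans hN)
  rw [eL] at q1
  rw [eB, eT] at q2
  have x1 := hμ.le_one R
  set x := μ.real R with hx
  have q6 : (1 - x) ^ 4 ≤ d ^ 4 := by
    have : (1 - x) * (1 - x) * ((1 - x) * (1 - x)) ≤ _ :=
      (mul_le_mul q1 q2 (mul_nonneg (by linarith) (by linarith)) (by linarith [hμ.le_one (R ∪ L)])).trans q3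
    calc (1 - x) ^ 4 = (1 - x) * (1 - x) * ((1 - x) * (1 - x)) := by ring
      _ ≤ _ := by linarith
  have q7 : 1 - x ≤ d := le_of_pow_le_pow_left₀ (by norm_num) d0.le q6
  have sub2 : R ∩ L ∩ circs m M ⊆ LR (-N) N (-N) N := by
    rintro η ⟨⟨⟨u, hu, v, hv, h⟩, ⟨u', hu', v', hv', h'⟩⟩, n, hn1, hn2, hn⟩
    obtain ⟨z, hz, z', hz', hzz⟩ := id hn.1.1
    rw [mem_BB] at hu hu'
    simp only [Set.mem_ofPred_eq] at hv hv'
    have nv : (N : ℤ) ≤ nrm v := by unfold nrm; exact le_max_of_le_left (hv.trans (le_abs_self _))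
    have nv' : (N : ℤ) ≤ nrm v' := by
      unfold nrm; exact le_max_of_le_left (le_trans (by omega) (neg_abs_le _ |> neg_le_neg |>.trans_eq (neg_neg _)))
    obtain ⟨x, x1, x2⟩ := circ_hit (by positivity) hn hzz hz hz' h (by omega) (by omega)
    obtain ⟨y, y1, y2⟩ := circ_hit (by positivity) hn hzz hz hz' h' (by omega) (by omega)
    have inc : BB (2 * (n : ℤ)) ⊆ BB N := bx_mono (by omega) (by omega) (by omega) (by omega)
    exact ⟨v', hv', v, hv, h'.symm.trans (y1.trans ((y2.symm.mono inc).trans ((x2.mono inc).trans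
      (x1.symm.trans h))))⟩
  have r1 := hμ.mono sub2
  rw [hμ.LR_eq, show (N : ℤ) - -N = 2 * N by ring] at r1
  have r2 := hμ.inter_fail (lR.inter lL).meas ((circs_dep m M).measurable (bx_finite _ _ _ _))
  have r3 := hμ.inter_fail lR.meas lL.meas
  linarith

lemma long_to_one {ε : ℕ → ℝ} (hM : Mix μ ε) (hε : Filter.Tendsto ε Filter.atTop (nhds 0)) {θ : ℝ}
    (hθ : 0 < θ) (harm : ∀ n : ℕ, θ ≤ μ.real (Ev (BB n) {(0, 0)} {v | (n : ℤ) ≤ nrm v})) :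
    ∀ δ > 0, ∀ n0 : ℕ, ∃ n : ℕ, n0 ≤ n ∧ 1 ≤ n ∧ 1 - δ < hP μ (2 * n) n := by
  intro δ hδ n0
  have cont : Continuous fun c : ℝ => c * gT c ^ (8 * 2) := by unfold gT sq1; fun_prop
  have h1 : (1 : ℝ) * gT 1 ^ (8 * 2) = 1 := by simp [gT, sq1]
  have ev := cont.continuousAt.eventually (lt_mem_nhds (show 1 - δ < (fun c : ℝ => c * gT c ^ (8 * 2)) 1 by
    simp only [h1]; linarith))
  obtain ⟨r, hr, hr'⟩ := Metric.eventually_nhds_iff.1 ev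
  set c := 1 - min (r / 2) (1 / 2) with hc
  have m0 : 0 < min (r / 2) (1 / 2 : ℝ) := lt_min (by linarith) (by norm_num)
  have m1 : min (r / 2) (1 / 2 : ℝ) ≤ r / 2 := min_le_left _ _
  have m2 : min (r / 2) (1 / 2 : ℝ) ≤ 1 / 2 := min_le_right _ _
  have hcr := @hr' c (by rw [Real.dist_eq, abs_lt]; constructor <;> linarith)
  obtain ⟨N0, hN0⟩ := hμ.squares_to_one hM hε hθ harm (min (r / 2) (1 / 2)) m0
  obtain ⟨n, k1, k2, k3⟩ := hμ.tassion (c := c) (by linarith) (by linarith) N0 hN0 2 n0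
  exact ⟨n, k1, k2, lt_of_lt_of_le hcr (by exact_mod_cast k3)⟩

/-! ### Renormalization -/

lemma strip_fail (n : ℕ) (j : ℕ) :
    1 - hP μ ((2 + j) * n) n ≤ (1 + 2 * j) * (1 - hP μ (2 * n) n) := by
  induction j with
  | zero => simp
  | succ j ih =>
    have g := hμ.hP_glue' (w := (2 + j) * n) (w' := 2 * n) (e := n) (h := n) (by positivity)
      (by nlinarith) (by omega)
    have e : (2 + (j : ℤ)) * n + 2 * n - n = (2 + ((j + 1 : ℕ) : ℤ)) * n := by push_cast; ring
    rw [e] at g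
    have a := hμ.hP_anti (w := n) (w' := 2 * n) (h := n) (h' := n) (by positivity) (by omega) le_rfl
    push_cast at g ⊢
    linarith

lemma renorm_step {ε : ℕ → ℝ} (hM : Mix μ ε) (n : ℕ) (hn : 1 ≤ n) :
    1 - hP μ (2 * (5 * n : ℕ)) (5 * n : ℕ) ≤ (17 * (1 - hP μ (2 * n) n)) ^ 2 + ε n := by
  have := hμ.prob
  have s := hμ.strip_fail n 8
  norm_num at s
  have k1 := hμ.LR_eq 0 (10 * n) 0 n
  have k2 := hμ.LR_eq 0 (10 * n) (4 * n) (5 * n)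
  have k3 := hμ.LR_eq 0 (10 * n) 0 (5 * n)
  rw [show 5 * (n : ℤ) - 4 * n = n by ring] at k2
  simp only [sub_zero] at k1 k2 k3
  have mix := hM n hn (bx 0 (10 * n) 0 n) (bx 0 (10 * n) (4 * n) (5 * n))
    (LR 0 (10 * n) 0 n)ᶜ (LR 0 (10 * n) (4 * n) (5 * n))ᶜ
    (bx_mono (by omega) (by omega) (by omega) (by omega))
    (bx_mono (by omega) (by omega) (by omega) (by omega))
    (by rintro u hu v hv
        simp only [bx, Set.mem_ofPred_eq] at hu hv
        by_contra hcon
        push Not at hcon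
        have h1 : nrm (u - v) ≤ (n : ℤ) - 1 := by omega
        rw [nrm_le] at h1
        simp only [Prod.fst_sub, Prod.snd_sub] at h1
        omega)
    (LR.dep _ _ _ _).compl (LR.dep _ _ _ _).compl
  have e1 := probReal_compl_eq_one_sub (μ := μ) (LR.li 0 (10 * n) 0 n).meas
  have e2 := probReal_compl_eq_one_sub (μ := μ) (LR.li 0 (10 * n) (4 * n) (5 * n)).meas
  have e3 := probReal_compl_eq_one_sub (μ := μ) (LR.li 0 (10 * n) 0 (5 * n)).meas
  have sub : (LR 0 (10 * n) 0 (5 * n))ᶜ ⊆ (LR 0 (10 * n) 0 n)ᶜ ∩ (LR 0 (10 * n) (4 * n) (5 * n))ᶜ := by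
    refine Set.subset_inter (Set.compl_subset_compl.2 ?_) (Set.compl_subset_compl.2 ?_)
    · exact LR.shrink le_rfl (by positivity) le_rfl le_rfl (by omega)
    · exact LR.shrink le_rfl (by positivity) le_rfl (by positivity) le_rfl
  have := hμ.mono sub
  rw [e1, e2, k1, k2] at mix
  rw [e3, k3] at this
  push_cast
  rw [show 2 * (5 * (n : ℤ)) = 10 * n by ring]
  have h1 := hμ.hP_le_one (10 * n) n
  have h2 := hμ.hP_le_one (2 * n) n
  have : (1 - hP μ (10 * n) n) * (1 - hP μ (10 * n) n) ≤ (17 * (1 - hP μ (2 * n) n)) ^ 2 := by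
    have s' : 1 - hP μ (10 * n) n ≤ 17 * (1 - hP μ (2 * n) n) := by linarith
    rw [sq]; exact mul_le_mul s' s' (by linarith) (by linarith)
  linarith

/-- The event at scale `m` used for the infinite cluster. -/
def Zev (m : ℤ) : Set EdgeCfg := circ m ∩ LR 0 (10 * m) 0 m

lemma Zev_fail (m : ℕ) : 1 - μ.real (Zev m) ≤ 37 * (1 - hP μ (2 * m) m) := by
  have s := hμ.strip_fail m 8
  have s2 := hμ.strip_fail m 2
  norm_num at s s2
  have c := hμ.circ_ge m
  have := hμ.inter_fail (circ_li m).meas (LR.li 0 (10 * m) 0 m).meas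
  have k1 := hμ.LR_eq 0 (10 * m) 0 m
  simp only [sub_zero] at k1
  rw [k1] at this
  have h1 := hμ.hP_le_one (4 * m) m
  have h0 := hμ.hP_nonneg (4 * m) m
  have b := one_add_mul_le_pow (a := hP μ (4 * m) m - 1) (by linarith) 4
  rw [add_sub_cancel] at b
  norm_num at b
  unfold Zev
  linarith

lemma renorm_summable {ε : ℕ → ℝ} (hM : Mix μ ε) {C : ℝ} (hC : 0 ≤ C) (hε : ∀ n : ℕ, 1 ≤ n → ε n ≤ C / n)
    {n : ℕ} (hn : 1 ≤ n) (hnC : 1200 * C ≤ n) (hq : 1 - hP μ (2 * n) n ≤ 1 / 600) :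
    Summable fun k : ℕ => 1 - hP μ (2 * (5 ^ k * n : ℕ)) (5 ^ k * n : ℕ) := by
  set q : ℕ → ℝ := fun k => 1 - hP μ (2 * (5 ^ k * n : ℕ)) (5 ^ k * n : ℕ) with hqd
  have q0 : ∀ k, 0 ≤ q k := fun k => by simp only [hqd]; linarith [hμ.hP_le_one (2 * (5 ^ k * n : ℕ)) (5 ^ k * n : ℕ)]
  have hn0 : (0 : ℝ) < n := by exact_mod_cast hn
  have hCn : C / n ≤ 1 / 1200 := by rw [div_le_iff₀ hn0]; linarith
  have step : ∀ k, q (k + 1) ≤ (17 * q k) ^ 2 + C / n * (1 / 5) ^ k := by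
    intro k
    have h5 : 1 ≤ 5 ^ k * n := Nat.mul_pos (by positivity) hn
    have := hμ.renorm_step hM (5 ^ k * n) h5
    have e := hε _ h5
    have e2 : C / ((5 ^ k * n : ℕ) : ℝ) = C / n * (1 / 5) ^ k := by
      push_cast; rw [one_div_pow]; field_simp
    rw [e2] at e
    simp only [hqd]
    rw [show 5 ^ (k + 1) * n = 5 * (5 ^ k * n) by ring]
    linarith
  have small : ∀ k, q k ≤ 1 / 600 := by
    intro k
    induction k with
    | zero => simpa [hqd] using hq
    | succ k ih =>
      have := step k
      have p1 : (1 / 5 : ℝ) ^ k ≤ 1 := pow_le_one₀ (by norm_num) (by norm_num)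
      have p2 : C / n * (1 / 5) ^ k ≤ 1 / 1200 * 1 := mul_le_mul hCn p1 (by positivity) (by norm_num)
      nlinarith [q0 k]
  have step2 : ∀ k, q (k + 1) ≤ q k / 2 + C / n * (1 / 5) ^ k := by
    intro k
    have h1 := step k
    have h2 := small k
    have h3 := q0 k
    nlinarith
  set b := 10 / 3 * (C / n) with hb
  have b0 : 0 ≤ b := by positivity
  have bd : ∀ k, q k ≤ (q 0 + b) * (1 / 2) ^ k - b * (1 / 5) ^ k := by
    intro k
    induction k with
    | zero => simp
    | succ k ih =>
      have := step2 k
      have e : C / n = 3 / 10 * b := by rw [hb]; ring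
      rw [e] at this
      rw [pow_succ, pow_succ]
      linarith
  refine Summable.of_nonneg_of_le q0 (fun k => (bd k).trans (sub_le_self _ (by positivity))) ?_
  exact (summable_geometric_of_lt_one (by norm_num) (by norm_num)).mul_left _

lemma renorm_ae {ε : ℕ → ℝ} (hM : Mix μ ε) {C : ℝ} (hC : 0 ≤ C) (hε : ∀ n : ℕ, 1 ≤ n → ε n ≤ C / n)
    {n : ℕ} (hn : 1 ≤ n) (hnC : 1200 * C ≤ n) (hq : 1 - hP μ (2 * n) n ≤ 1 / 600) :
    ∀ᵐ η ∂μ, ∃ k0 : ℕ, ∀ k, k0 ≤ k → η ∈ Zev (5 ^ k * n : ℕ) := by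
  have := hμ.prob
  have hs := (hμ.renorm_summable hM hC hε hn hnC hq).mul_left 37
  have mZ : ∀ k : ℕ, MeasurableSet (Zev (5 ^ k * n : ℕ)) := fun k => ((circ_li _).inter (LR.li _ _ _ _)).meas
  have hs2 : Summable fun k : ℕ => μ.real (Zev (5 ^ k * n : ℕ))ᶜ := by
    refine Summable.of_nonneg_of_le (fun _ => measureReal_nonneg) (fun k => ?_) hs
    rw [probReal_compl_eq_one_sub (mZ k)]
    exact hμ.Zev_fail _
  have hs3 : ∑' k : ℕ, μ (Zev (5 ^ k * n : ℕ))ᶜ ≠ ∞ := by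
    have e : ∀ k : ℕ, μ (Zev (5 ^ k * n : ℕ))ᶜ = ENNReal.ofReal (μ.real (Zev (5 ^ k * n : ℕ))ᶜ) := fun k => by
      rw [ofReal_measureReal]
    simp_rw [e]
    exact hs2.tsum_ofReal_ne_top
  filter_upwards [ae_eventually_notMem hs3] with η hη
  obtain ⟨k0, h⟩ := Filter.eventually_atTop.1 hη
  exact ⟨k0, fun k hk => by simpa using h k hk⟩

end Perc

/-- Deterministic consequence of all events `Zev` at large scales. -/
lemma chain_infinite {η : EdgeCfg} {n k0 : ℕ} (hn : 1 ≤ n)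
    (h : ∀ k, k0 ≤ k → η ∈ Perc.Zev (5 ^ k * n : ℕ)) :
    ∃ z : V, (∀ L : ℤ, ∃ v, L ≤ nrm v ∧ CI η Set.univ z v) ∧
      ∀ (η' : EdgeCfg) (u : V), (∀ L : ℤ, ∃ v, L ≤ nrm v ∧ CI η' Set.univ u v) →
        ∃ x, CI η' Set.univ u x ∧ CI η Set.univ z x := by
  have hz : ∀ k, k0 ≤ k → ∃ z z' : V, z.2 ≤ -(2 * ((5 ^ k * n : ℕ) : ℤ)) ∧
      2 * ((5 ^ k * n : ℕ) : ℤ) ≤ z'.2 ∧ CI η (bx ((5 ^ k * n : ℕ) : ℤ) (2 * ((5 ^ k * n : ℕ) : ℤ))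
        (-(2 * ((5 ^ k * n : ℕ) : ℤ))) (2 * ((5 ^ k * n : ℕ) : ℤ))) z z' := by
    intro k hk
    obtain ⟨z, h1, z', h2, h3⟩ := (h k hk).1.1.1
    exact ⟨z, z', h1, h2, h3⟩
  choose! z z' hz1 hz2 hz3 using hz
  have big : ∀ k : ℕ, (k : ℤ) ≤ ((5 ^ k * n : ℕ) : ℤ) := by
    intro k
    have h1 : k < 5 ^ k := Nat.lt_pow_self (by norm_num)
    have h2 : 5 ^ k * 1 ≤ 5 ^ k * n := Nat.mul_le_mul_left _ hn
    have : k ≤ 5 ^ k * n := by omega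
    exact_mod_cast this
  have link : ∀ j : ℕ, CI η Set.univ (z k0) (z (k0 + j)) := by
    intro j
    induction j with
    | zero => exact CI.refl (Set.mem_univ _)
    | succ j ih =>
      refine ih.trans ?_
      have hk : k0 ≤ k0 + j := by omega
      have hk1 : k0 ≤ k0 + (j + 1) := by omega
      obtain ⟨u, hu, v, hv, hs⟩ := (h (k0 + j) hk).2
      set m : ℤ := ((5 ^ (k0 + j) * n : ℕ) : ℤ) with hm
      have hm0 : 0 ≤ m := by positivity
      have e5 : ((5 ^ (k0 + (j + 1)) * n : ℕ) : ℤ) = 5 * m := by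
        rw [hm, ← add_assoc, pow_succ]; push_cast; ring
      have a1 := hz1 _ hk1
      have a2 := hz2 _ hk1
      have a3 := hz3 _ hk1
      have b1 := hz1 _ hk
      have b2 := hz2 _ hk
      have b3 := hz3 _ hk
      rw [e5] at a1 a2 a3
      simp only [Set.mem_ofPred_eq] at hu hv
      obtain ⟨x, x1, x2⟩ := hs.cross b3 (a := m) (b := 2 * m) (c := 0) (d := m)
        (fun x hx => hx.2.2) (fun x hx => ⟨hx.1, hx.2.1⟩) (by omega) (by omega) (by omega) (by omega)
      obtain ⟨y, y1, y2⟩ := hs.cross a3 (a := 5 * m) (b := 2 * (5 * m)) (c := 0) (d := m)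
        (fun x hx => hx.2.2) (fun x hx => ⟨hx.1, hx.2.1⟩) (by omega) (by omega) (by omega) (by omega)
      exact (x2.mono (Set.subset_univ _)).trans ((x1.symm.trans y1).mono (Set.subset_univ _) |>.trans
        (y2.symm.mono (Set.subset_univ _)))
  refine ⟨z k0, ?_, ?_⟩
  · intro L
    refine ⟨z (k0 + L.toNat), ?_, link _⟩
    have h1 := hz1 (k0 + L.toNat) (by omega)
    have h2 := big (k0 + L.toNat)
    by_contra hcon
    push Not at hcon
    have h3 : nrm (z (k0 + L.toNat)) ≤ L - 1 := by omega
    rw [nrm_le] at h3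
    rw [Nat.cast_add] at h2
    generalize ((5 ^ (k0 + L.toNat) * n : ℕ) : ℤ) = m at *
    omega
  · intro η' u hu
    let k := k0 + (nrm u).toNat
    have hk : k0 ≤ k := by omega
    obtain ⟨v, hv, huv⟩ := hu (2 * ((5 ^ k * n : ℕ) : ℤ))
    have h2 := big k
    obtain ⟨x, x1, x2⟩ := circ_hit (by positivity) (h k hk).1 (hz3 k hk) (hz1 k hk) (hz2 k hk) huv
      (by push_cast [k] at h2 ⊢; omega) hv
    exact ⟨x, x1, (link _).trans (x2.mono (Set.subset_univ _))⟩

end DaC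


namespace DaC

/-! ## Part 2a: product measures -/

instance base_prob : IsProbabilityMeasure base := ⟨by simp [base]⟩

lemma base_lt {q : ℝ} (h0 : 0 ≤ q) (h1 : q ≤ 1) : base.real {x | x < q} = q := by
  have e : {x : ℝ | x < q} ∩ Set.Ioc 0 1 = Set.Ioo 0 q := by
    ext x; simp only [Set.mem_inter_iff, Set.mem_ofPred_eq, Set.mem_Ioc, Set.mem_Ioo]
    constructor
    · rintro ⟨h, h', _⟩; exact ⟨h', h⟩
    · rintro ⟨h, h'⟩; exact ⟨h', h, by linarith⟩
  rw [measureReal_def, base, Measure.restrict_apply (show MeasurableSet {x : ℝ | x < q} from measurableSet_Iio), e, Real.volume_Ioo, sub_zero,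
    ENNReal.toReal_ofReal h0]

lemma base_Ico {q s : ℝ} (h0 : 0 ≤ q) (h : q ≤ s) (h1 : s ≤ 1) :
    base.real {x | q ≤ x ∧ x < s} = s - q := by
  have e : {x : ℝ | x < s} = {x | q ≤ x ∧ x < s} ∪ {x | x < q} := by
    ext x; simp only [Set.mem_union, Set.mem_ofPred_eq]
    constructor
    · intro h'; rcases lt_or_ge x q with h2 | h2
      · exact .inr h2
      · exact .inl ⟨h2, h'⟩
    · rintro (h' | h'); exacts [h'.2, h'.trans_le h]
  have e2 := measureReal_union (μ := base) (s₁ := {x | q ≤ x ∧ x < s}) (s₂ := {x : ℝ | x < q})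
    (by rw [Set.disjoint_left]; rintro x ⟨h, _⟩ h'; exact absurd h' (not_lt.2 h)) measurableSet_Iio
  rw [← e, base_lt h0 (h.trans h1), base_lt (h0.trans h) h1] at e2
  linarith

/-- Dependence on a set of coordinates. -/
def DepC {ι : Type*} (S : Set ι) (A : Set (ι → ℝ)) : Prop :=
  ∀ ω ω' : ι → ℝ, (∀ i ∈ S, ω i = ω' i) → ω ∈ A → ω' ∈ A

lemma DepC.mono {ι : Type*} {S T : Set ι} {A : Set (ι → ℝ)} (h : DepC S A) (hST : S ⊆ T) : DepC T A :=
  fun ω ω' e hx => h ω ω' (fun i hi => e i (hST hi)) hx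

lemma DepC.inter {ι : Type*} {S : Set ι} {A B : Set (ι → ℝ)} (h : DepC S A) (h' : DepC S B) :
    DepC S (A ∩ B) := fun ω ω' e hx => ⟨h ω ω' e hx.1, h' ω ω' e hx.2⟩

lemma DepC.compl {ι : Type*} {S : Set ι} {A : Set (ι → ℝ)} (h : DepC S A) : DepC S Aᶜ :=
  fun ω ω' e hx hx' => hx (h ω' ω (fun i hi => (e i hi).symm) hx')

noncomputable def PI (ι : Type) : Measure (ι → ℝ) := Measure.infinitePi fun _ => base

instance PI_prob (ι : Type) : IsProbabilityMeasure (PI ι) := by unfold PI; infer_instance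

lemma DepC.meas_iSup {ι : Type} {S : Set ι} {A : Set (ι → ℝ)} (h : DepC S A) (hA : MeasurableSet A) :
    MeasurableSet[⨆ i ∈ S, MeasurableSpace.comap (fun ω : ι → ℝ => ω i) inferInstance] A := by
  classical
  let ρ : (ι → ℝ) → (ι → ℝ) := fun ω i => if i ∈ S then ω i else 0
  have e : A = ρ ⁻¹' A := by
    ext ω
    exact ⟨fun hω => h _ _ (fun i hi => by simp [ρ, hi]) hω, fun hω => h _ _ (fun i hi => by simp [ρ, hi]) hω⟩
  rw [e]
  have hρ : @Measurable _ _ (⨆ i ∈ S, MeasurableSpace.comap (fun ω : ι → ℝ => ω i) inferInstance) _ ρ := by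
    refine @measurable_pi_lambda _ _ _ (_) _ _ fun i => ?_
    by_cases hi : i ∈ S
    · simp only [ρ, hi, if_true]
      have h1 : @Measurable _ _ (MeasurableSpace.comap (fun ω : ι → ℝ => ω i) inferInstance) _ (fun ω : ι → ℝ => ω i) :=
        comap_measurable _
      exact h1.mono (le_iSup₂_of_le i hi le_rfl) le_rfl
    · simp only [ρ, hi, if_false]
      exact @measurable_const _ _ _ (_) _
  exact hρ hA

lemma pi_indep {ι : Type} {S T : Set ι} {A B : Set (ι → ℝ)} (hA : MeasurableSet A) (hB : MeasurableSet B)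
    (dA : DepC S A) (dB : DepC T B) (hST : Disjoint S T) :
    (PI ι).real (A ∩ B) = (PI ι).real A * (PI ι).real B := by
  have h1 : ProbabilityTheory.iIndepFun (fun i (ω : ι → ℝ) => ω i) (PI ι) :=
    ProbabilityTheory.iIndepFun_infinitePi (X := fun i x => x) (by fun_prop)
  have h2 := ProbabilityTheory.indep_iSup_of_disjoint (fun i => (measurable_pi_apply i).comap_le) h1.iIndep hST
  have := (ProbabilityTheory.Indep_iff _ _ _).1 h2 A B (dA.meas_iSup hA) (dB.meas_iSup hB)
  simp only [measureReal_def, this, ENNReal.toReal_mul]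

lemma pi_coord {ι : Type} (i : ι) {s : Set ℝ} (hs : MeasurableSet s) :
    (PI ι).real {ω | ω i ∈ s} = base.real s := by
  have := Measure.infinitePi_map_eval (fun _ : ι => base) i
  conv_rhs => rw [← this]
  rw [map_measureReal_apply (by fun_prop) hs]; rfl

lemma pi_coord_indep {ι : Type} (i : ι) {s : Set ℝ} (hs : MeasurableSet s) {G : Set (ι → ℝ)}
    (hG : MeasurableSet G) (dG : DepC {i}ᶜ G) :
    (PI ι).real ({ω | ω i ∈ s} ∩ G) = base.real s * (PI ι).real G := by
  rw [← pi_coord i hs]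
  refine pi_indep (S := {i}) (T := {i}ᶜ) (measurable_pi_apply i hs) hG ?_ dG disjoint_compl_right
  intro ω ω' e h
  have := e i rfl
  simp only [Set.mem_ofPred_eq] at *
  rwa [← this]

/-- Splitting according to one coordinate. -/
lemma pi_split {ι : Type} (i : ι) {q : ℝ} (h0 : 0 ≤ q) (h1 : q ≤ 1) {E G H : Set (ι → ℝ)}
    (hG : MeasurableSet G) (hH : MeasurableSet H) (dG : DepC {i}ᶜ G) (dH : DepC {i}ᶜ H)
    (h : ∀ ω, ω ∈ E ↔ (ω i < q ∧ ω ∈ G) ∨ (¬ ω i < q ∧ ω ∈ H)) :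
    (PI ι).real E = q * (PI ι).real G + (1 - q) * (PI ι).real H := by
  have hm : MeasurableSet {x : ℝ | x < q} := measurableSet_Iio
  have e : E = ({ω | ω i ∈ {x | x < q}} ∩ G) ∪ ({ω | ω i ∈ {x | x < q}ᶜ} ∩ H) := by
    ext ω; rw [h]; rfl
  rw [e, measureReal_union, pi_coord_indep i hm hG dG, pi_coord_indep i hm.compl hH dH,
    probReal_compl_eq_one_sub hm, base_lt h0 h1]
  · rw [Set.disjoint_left]; rintro ω ⟨h1, _⟩ ⟨h2, _⟩; exact h2 h1
  · exact (measurable_pi_apply i hm.compl).inter hH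

lemma pi_reindex {ι κ : Type} {j : κ → ι} (hj : Function.Injective j) :
    (PI ι).map (fun ω k => ω (j k)) = PI κ :=
  Measure.map_infinitePi_infinitePi_of_inj hj

/-- Product of the two label spaces. -/
lemma pi_sum {ι κ : Type} : ((PI ι).prod (PI κ)).map (fun q => Sum.elim q.1 q.2) = PI (ι ⊕ κ) := by
  classical
  have hm : Measurable (fun q : (ι → ℝ) × (κ → ℝ) => (Sum.elim q.1 q.2 : ι ⊕ κ → ℝ)) := by
    refine measurable_pi_lambda _ fun i => ?_
    rcases i with i | i <;> simp only [Sum.elim_inl, Sum.elim_inr] <;> fun_prop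
  refine Measure.eq_infinitePi _ fun s t ht => ?_
  rw [Measure.map_apply hm (MeasurableSet.pi s.countable_toSet fun i _ => ht i)]
  have e : (fun q : (ι → ℝ) × (κ → ℝ) => (Sum.elim q.1 q.2 : ι ⊕ κ → ℝ)) ⁻¹' (Set.pi s t) =
      (Set.pi (s.toLeft : Set ι) fun i => t (.inl i)) ×ˢ (Set.pi (s.toRight : Set κ) fun i => t (.inr i)) := by
    ext q
    simp only [Set.mem_preimage, Set.mem_pi, Set.mem_prod, Finset.mem_coe, Finset.mem_toLeft, Finset.mem_toRight]
    constructor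
    · intro h; exact ⟨fun i hi => h _ hi, fun i hi => h _ hi⟩
    · rintro ⟨h1, h2⟩ (i | i) hi; exacts [h1 i hi, h2 i hi]
  rw [e, Measure.prod_prod, PI, PI, Measure.infinitePi_pi _ (fun i _ => ht _), Measure.infinitePi_pi _ (fun i _ => ht _)]
  conv_rhs => rw [← Finset.toLeft_disjSum_toRight (u := s)]
  rw [Finset.prod_disjSum]

/-- Dependence on two sets of coordinates. -/
def DepP {ι κ : Type} (S : Set ι) (T : Set κ) (A : Set ((ι → ℝ) × (κ → ℝ))) : Prop :=
  ∀ ω ω' : (ι → ℝ) × (κ → ℝ), (∀ i ∈ S, ω.1 i = ω'.1 i) → (∀ i ∈ T, ω.2 i = ω'.2 i) → ω ∈ A → ω' ∈ A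

lemma prod_indep {ι κ : Type} {S S' : Set ι} {T T' : Set κ} {A B : Set ((ι → ℝ) × (κ → ℝ))}
    (hA : MeasurableSet A) (hB : MeasurableSet B) (dA : DepP S T A) (dB : DepP S' T' B)
    (hS : Disjoint S S') (hT : Disjoint T T') :
    ((PI ι).prod (PI κ)).real (A ∩ B) = ((PI ι).prod (PI κ)).real A * ((PI ι).prod (PI κ)).real B := by
  let f : (ι ⊕ κ → ℝ) → (ι → ℝ) × (κ → ℝ) := fun ω => (fun i => ω (.inl i), fun i => ω (.inr i))
  have hf : Measurable f := by fun_prop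
  have hm : Measurable (fun q : (ι → ℝ) × (κ → ℝ) => (Sum.elim q.1 q.2 : ι ⊕ κ → ℝ)) := by
    refine measurable_pi_lambda _ fun i => ?_
    rcases i with i | i <;> simp only [Sum.elim_inl, Sum.elim_inr] <;> fun_prop
  have e : (PI (ι ⊕ κ)).map f = (PI ι).prod (PI κ) := by
    rw [← pi_sum, Measure.map_map hf hm]
    exact Measure.map_id
  have key : ∀ {S : Set ι} {T : Set κ} {A}, DepP S T A → DepC (Sum.inl '' S ∪ Sum.inr '' T) (f ⁻¹' A) := by
    intro S T A d ω ω' h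
    exact d _ _ (fun i hi => h _ (.inl ⟨i, hi, rfl⟩)) (fun i hi => h _ (.inr ⟨i, hi, rfl⟩))
  rw [← e, map_measureReal_apply hf hA, map_measureReal_apply hf hB, map_measureReal_apply hf (hA.inter hB),
    Set.preimage_inter]
  refine pi_indep (hf hA) (hf hB) (key dA) (key dB) ?_
  rw [Set.disjoint_left] at *
  rintro x (⟨i, hi, rfl⟩ | ⟨i, hi, rfl⟩) (⟨j, hj, h⟩ | ⟨j, hj, h⟩)
  · cases h; exact hS hi hj
  · cases h
  · cases h
  · cases h; exact hT hi hj

/-! Harris inequality for threshold configurations. -/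

noncomputable def thr {ι : Type} (q : ℝ) (ω : ι → ℝ) : ι → Bool := fun i => boolOf (ω i < q)

lemma boolOf_iff {P : Prop} : boolOf P = true ↔ P := by simp [boolOf]

lemma boolOf_meas {α : Type*} [MeasurableSpace α] {P : α → Prop} (h : MeasurableSet {x | P x}) :
    Measurable fun x => boolOf (P x) := by
  refine measurable_to_bool ?_
  convert h using 1
  ext x; simp [boolOf]

lemma thr_meas {ι : Type} (q : ℝ) : Measurable (thr (ι := ι) q) := by
  refine measurable_pi_lambda _ fun i => boolOf_meas ?_
  exact measurable_pi_apply i measurableSet_Iio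

def DepB {ι : Type} (S : Set ι) (A : Set (ι → Bool)) : Prop :=
  ∀ β β' : ι → Bool, (∀ i ∈ S, β i = β' i) → β ∈ A → β' ∈ A
def IncB {ι : Type} (A : Set (ι → Bool)) : Prop :=
  ∀ β β' : ι → Bool, (∀ i, β i = true → β' i = true) → β ∈ A → β' ∈ A

lemma DepB.meas {ι : Type} {S : Set ι} (hS : S.Finite) {A : Set (ι → Bool)} (h : DepB S A) :
    MeasurableSet A := by
  have : Finite S := hS
  let f : (ι → Bool) → (S → Bool) := fun β i => β i
  have hf : Measurable f := by fun_prop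
  have : A = f ⁻¹' (f '' A) := by
    ext β
    refine ⟨fun h => ⟨β, h, rfl⟩, ?_⟩
    rintro ⟨β', h', e⟩
    exact h β' β (fun i hi => congrFun e ⟨i, hi⟩) h'
  rw [this]
  exact hf (Set.toFinite _).measurableSet

open Classical in
/-- Split a threshold event at one coordinate. -/
lemma thr_split {ι : Type} (i : ι) {q : ℝ} (h0 : 0 ≤ q) (h1 : q ≤ 1) {A : Set (ι → Bool)} (hA : MeasurableSet A) :
    (PI ι).real (thr q ⁻¹' A) = q * (PI ι).real (thr q ⁻¹' {β | Function.update β i true ∈ A}) +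
      (1 - q) * (PI ι).real (thr q ⁻¹' {β | Function.update β i false ∈ A}) := by
  have hm : ∀ b : Bool, MeasurableSet {β : ι → Bool | Function.update β i b ∈ A} := fun b =>
    measurable_update_left hA
  have hd : ∀ b : Bool, DepC {i}ᶜ (thr q ⁻¹' {β : ι → Bool | Function.update β i b ∈ A}) := by
    intro b ω ω' e h
    simp only [Set.mem_preimage, Set.mem_ofPred_eq] at *
    convert h using 1
    ext k
    by_cases hk : k = i
    · subst hk; simp
    · simp [hk, thr, e k hk]
  refine pi_split i h0 h1 (thr_meas q (hm true)) (thr_meas q (hm false)) (hd _) (hd _) fun ω => ?_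
  simp only [Set.mem_preimage, Set.mem_ofPred_eq]
  by_cases h : ω i < q
  · have : Function.update (thr q ω) i true = thr q ω := by
      rw [Function.update_eq_self_iff]; simp [thr, boolOf, h]
    simp [h, this]
  · have : Function.update (thr q ω) i false = thr q ω := by
      rw [Function.update_eq_self_iff]; simp [thr, boolOf, h]
    simp [h, this]

lemma two_point {q a0 a1 b0 b1 c0 c1 : ℝ} (h0 : 0 ≤ q) (h1 : q ≤ 1) (ha : a0 ≤ a1) (hb : b0 ≤ b1)
    (hc0 : a0 * b0 ≤ c0) (hc1 : a1 * b1 ≤ c1) :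
    (q * a1 + (1 - q) * a0) * (q * b1 + (1 - q) * b0) ≤ q * c1 + (1 - q) * c0 := by
  have k : 0 ≤ q * (1 - q) * ((a1 - a0) * (b1 - b0)) :=
    mul_nonneg (mul_nonneg h0 (by linarith)) (mul_nonneg (by linarith) (by linarith))
  have k1 := mul_le_mul_of_nonneg_left hc1 h0
  have k0 := mul_le_mul_of_nonneg_left hc0 (by linarith : 0 ≤ 1 - q)
  nlinarith

open Classical in
lemma harris {ι : Type} {q : ℝ} (h0 : 0 ≤ q) (h1 : q ≤ 1) (s : Finset ι) : ∀ (A B : Set (ι → Bool)),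
    DepB s A → DepB s B → IncB A → IncB B →
    (PI ι).real (thr q ⁻¹' A) * (PI ι).real (thr q ⁻¹' B) ≤ (PI ι).real (thr q ⁻¹' (A ∩ B)) := by
  induction s using Finset.induction_on with
  | empty =>
    intro A B dA dB _ _
    have key : ∀ A : Set (ι → Bool), DepB (∅ : Finset ι) A → A = ∅ ∨ A = Set.univ := by
      intro A d
      rcases A.eq_empty_or_nonempty with h | ⟨β, h⟩
      · exact .inl h
      · exact .inr (Set.eq_univ_of_forall fun β' => d β β' (by simp) h)
    rcases key A dA with rfl | rfl <;> rcases key B dB with rfl | rfl <;> simp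
  | insert i s hi ih =>
    intro A B dA dB iA iB
    have mA := dA.meas (Finset.finite_toSet _)
    have mB := dB.meas (Finset.finite_toSet _)
    have hd : ∀ (A : Set (ι → Bool)), DepB (insert i s : Finset ι) A → ∀ b : Bool,
        DepB s {β : ι → Bool | Function.update β i b ∈ A} := by
      intro A dA b β β' e h
      refine dA _ _ (fun k hk => ?_) h
      by_cases hk' : k = i
      · subst hk'; simp
      · simp [hk', e k (by simpa [hk'] using hk)]
    have hi' : ∀ (A : Set (ι → Bool)), IncB A → ∀ b : Bool, IncB {β : ι → Bool | Function.update β i b ∈ A} := by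
      intro A iA b β β' e h
      refine iA _ _ (fun k hk => ?_) h
      by_cases hk' : k = i
      · subst hk'; simpa using hk
      · simp [hk'] at hk ⊢; exact e k hk
    have hle : ∀ (A : Set (ι → Bool)), IncB A → 
        (PI ι).real (thr q ⁻¹' {β | Function.update β i false ∈ A}) ≤
        (PI ι).real (thr q ⁻¹' {β | Function.update β i true ∈ A}) := by
      intro A iA
      refine measureReal_mono fun ω h => iA _ _ (fun k hk => ?_) h
      by_cases hk' : k = i
      · subst hk'; simp
      · simp [hk'] at hk ⊢; exact hk
    rw [thr_split i h0 h1 mA, thr_split i h0 h1 mB, thr_split i h0 h1 (mA.inter mB)]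
    exact two_point h0 h1 (hle A iA) (hle B iB)
      (ih _ _ (hd A dA _) (hd B dB _) (hi' A iA _) (hi' B iB _))
      (ih _ _ (hd A dA _) (hd B dB _) (hi' A iA _) (hi' B iB _))

end DaC


namespace DaC

/-! ## Part 2b: the labels are i.i.d. uniform -/

lemma bit_meas (n : ℕ) : Measurable (bit n) := by
  unfold bit
  refine boolOf_meas ?_
  have : Measurable fun x : ℝ => ⌊x * 2 ^ (n + 1)⌋ := Int.measurable_floor.comp (by fun_prop)
  exact this (t := {k : ℤ | k % 2 = 1}) trivial

lemma bit_succ (n : ℕ) (x : ℝ) (k : ℤ) : bit (n + 1) x = bit n (2 * x - k) := by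
  unfold bit
  have : (2 * x - k) * 2 ^ (n + 1) = x * 2 ^ (n + 1 + 1) - ((2 * (k * 2 ^ n) : ℤ) : ℝ) := by
    push_cast; ring
  rw [this, Int.floor_sub_intCast]
  congr 1
  simp only [eq_iff_iff]
  omega

lemma bit_zero {x : ℝ} (h0 : 0 < x) (h1 : x < 1) : bit 0 x = true ↔ 1 / 2 ≤ x := by
  unfold bit
  rw [boolOf_iff]
  rcases lt_or_ge x (1 / 2) with h | h
  · have : ⌊x * 2 ^ (0 + 1)⌋ = 0 := by rw [Int.floor_eq_iff]; norm_num; constructor <;> linarith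
    rw [this]; simp; linarith
  · have : ⌊x * 2 ^ (0 + 1)⌋ = 1 := by rw [Int.floor_eq_iff]; norm_num; constructor <;> linarith
    rw [this]; simp; linarith

lemma base_eq : base = volume.restrict (Set.Ioo 0 1) := by
  unfold base; exact Measure.restrict_congr_set Ioo_ae_eq_Ioc.symm

lemma base_half (A : Set ℝ) (hA : MeasurableSet A) (b : Bool) :
    base {x | bit 0 x = b ∧ 2 * x - (if b then 1 else 0 : ℤ) ∈ A} = 2⁻¹ * base A := by
  have hset : MeasurableSet {x : ℝ | bit 0 x = b ∧ 2 * x - (if b then 1 else 0 : ℤ) ∈ A} := by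
    refine MeasurableSet.inter (bit_meas 0 (t := {b}) trivial) ?_
    exact (by fun_prop : Measurable fun x : ℝ => 2 * x - ((if b then 1 else 0 : ℤ) : ℝ)) hA
  rw [base_eq, Measure.restrict_apply hset, Measure.restrict_apply hA]
  have e0 : volume ((fun x : ℝ => 2 * x) ⁻¹' ((fun x : ℝ => x + (-(((if b then 1 else 0 : ℤ) : ℤ) : ℝ))) ⁻¹' (A ∩ Set.Ioo 0 1)))
      = 2⁻¹ * volume (A ∩ Set.Ioo 0 1) := by
    rw [Real.volume_preimage_mul_left (by norm_num), measure_preimage_add_right]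
    congr 1
    rw [abs_of_pos (by norm_num), ENNReal.ofReal_inv_of_pos (by norm_num)]; simp
  rw [← e0]
  refine measure_congr ?_
  have hh : ∀ᵐ x : ℝ, x ≠ 1 / 2 := by
    rw [ae_iff]; simp
  filter_upwards [hh] with x hx
  apply propext
  change (x ∈ {x | bit 0 x = b ∧ 2 * x - ((if b = true then 1 else 0 : ℤ) : ℝ) ∈ A} ∩ Set.Ioo 0 1) ↔
    ((2 * x + -((if b = true then 1 else 0 : ℤ) : ℝ)) ∈ A ∩ Set.Ioo 0 1)
  simp only [Set.mem_inter_iff, Set.mem_ofPred_eq, Set.mem_Ioo, ← sub_eq_add_neg]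
  cases b
  · constructor
    · rintro ⟨⟨h1, h2⟩, h3, h4⟩
      have := mt (bit_zero h3 h4).2 (by simp [h1])
      push Not at this
      refine ⟨h2, ?_, ?_⟩ <;> simp <;> linarith
    · rintro ⟨h2, h3, h4⟩
      simp at h3 h4
      have := mt (bit_zero (x := x) (by linarith) (by linarith)).1 (by linarith)
      exact ⟨⟨by simpa using this, h2⟩, by linarith, by linarith⟩
  · constructor
    · rintro ⟨⟨h1, h2⟩, h3, h4⟩
      have := (bit_zero h3 h4).1 h1
      have : 1 / 2 < x := lt_of_le_of_ne this (Ne.symm hx)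
      refine ⟨h2, ?_, ?_⟩ <;> simp <;> linarith
    · rintro ⟨h2, h3, h4⟩
      simp at h3 h4
      have := (bit_zero (x := x) (by linarith) (by linarith)).2 (by linarith)
      exact ⟨⟨this, h2⟩, by linarith, by linarith⟩

noncomputable def fair : Measure Bool := base.map (bit 0)

instance fair_prob : IsProbabilityMeasure fair := by
  unfold fair; exact Measure.isProbabilityMeasure_map (bit_meas 0).aemeasurable

noncomputable def tl (x : ℝ) : ℝ := 2 * x - ((if bit 0 x then 1 else 0 : ℤ) : ℝ)

lemma tl_meas : Measurable tl := by
  unfold tl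
  have : Measurable fun b : Bool => ((if b then 1 else 0 : ℤ) : ℝ) := measurable_from_top
  have h := this.comp (bit_meas 0)
  exact (measurable_const.mul measurable_id).sub h

lemma base_tl (A : Set ℝ) (hA : MeasurableSet A) (t : Set Bool) :
    base {x | bit 0 x ∈ t ∧ tl x ∈ A} = fair t * base A := by
  classical
  have hm : ∀ (A : Set ℝ), MeasurableSet A → ∀ b : Bool, MeasurableSet {x : ℝ | bit 0 x = b ∧ tl x ∈ A} := fun A hA b =>
    MeasurableSet.inter (bit_meas 0 (t := {b}) trivial) (tl_meas hA)
  have key : ∀ (A : Set ℝ), MeasurableSet A → base {x | bit 0 x ∈ t ∧ tl x ∈ A} =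
      (if true ∈ t then 2⁻¹ * base A else 0) + (if false ∈ t then 2⁻¹ * base A else 0) := by
    intro A hA
    have e : {x | bit 0 x ∈ t ∧ tl x ∈ A} = (if true ∈ t then {x | bit 0 x = true ∧ tl x ∈ A} else ∅) ∪
        (if false ∈ t then {x | bit 0 x = false ∧ tl x ∈ A} else ∅) := by
      ext x
      simp only [Set.mem_union]
      by_cases h1 : true ∈ t <;> by_cases h2 : false ∈ t <;> cases h : bit 0 x <;> simp [h1, h2, h]
    rw [e, measure_union]
    · have k := base_half A hA
      have k' : ∀ b, base {x | bit 0 x = b ∧ tl x ∈ A} = 2⁻¹ * base A := by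
        intro b
        rw [← k b]
        congr 1
        ext x
        simp only [Set.mem_ofPred_eq]
        refine and_congr_right fun h => ?_
        unfold tl; rw [h]
      congr 1 <;> split_ifs <;> simp [k']
    · rw [Set.disjoint_left]
      intro x h1 h2
      split_ifs at h1 h2 <;> simp_all
    · split_ifs <;> simp [hm A hA]
  have k2 := key Set.univ MeasurableSet.univ
  have e : fair t = base {x | bit 0 x ∈ t ∧ tl x ∈ Set.univ} := by
    rw [fair, Measure.map_apply (bit_meas 0) trivial]; simp [Set.preimage]
  rw [key A hA, e, k2]
  split_ifs <;> simp [add_mul]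

lemma bit_tl (n : ℕ) (x : ℝ) : bit (n + 1) x = bit n (tl x) := bit_succ n x _

lemma bits_box (N : ℕ) : ∀ t : ℕ → Set Bool,
    base {x | ∀ n < N, bit n x ∈ t n} = ∏ n ∈ Finset.range N, fair (t n) := by
  induction N with
  | zero => intro t; simp
  | succ N ih =>
    intro t
    rw [Finset.prod_range_succ', mul_comm, ← ih fun n => t (n + 1), ← base_tl]
    · congr 1
      ext x
      simp only [Set.mem_ofPred_eq, ← bit_tl]
      constructor
      · intro h; exact ⟨h 0 (by omega), fun n hn => h (n + 1) (by omega)⟩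
      · rintro ⟨h0, h⟩ (_ | n) hn
        · exact h0
        · exact h n (by omega)
    · have : {x : ℝ | ∀ n < N, bit n x ∈ t (n + 1)} = ⋂ n, ⋂ (_ : n < N), (bit n) ⁻¹' (t (n + 1)) := by
        ext x; simp
      rw [this]
      exact MeasurableSet.iInter fun n => MeasurableSet.iInter fun _ => bit_meas n trivial

noncomputable def bits (x : ℝ) : ℕ → Bool := fun n => bit n x

lemma bits_meas : Measurable bits := measurable_pi_lambda _ bit_meas

lemma bits_law : base.map bits = Measure.infinitePi fun _ => fair := by
  classical
  refine Measure.eq_infinitePi _ fun s t ht => ?_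
  rw [Measure.map_apply bits_meas (MeasurableSet.pi s.countable_toSet fun i _ => ht i)]
  obtain ⟨N, hN⟩ : ∃ N, s ⊆ Finset.range N := s.exists_nat_subset_range
  have k := bits_box N fun n => if n ∈ s then t n else Set.univ
  have e : bits ⁻¹' Set.pi s t = {x | ∀ n < N, bit n x ∈ if n ∈ s then t n else Set.univ} := by
    ext x
    simp only [Set.mem_preimage, Set.mem_pi, Finset.mem_coe, Set.mem_ofPred_eq]
    constructor
    · intro h n _
      split_ifs with hn
      · exact h n hn
      · trivial
    · intro h n hn
      have := h n (Finset.mem_range.1 (hN hn))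
      rwa [if_pos hn] at this
  rw [e, k, ← Finset.prod_subset hN (f := fun n => fair (if n ∈ s then t n else Set.univ))]
  · exact Finset.prod_congr rfl fun n hn => by rw [if_pos hn]
  · intro n _ hn; rw [if_neg hn, measure_univ]

noncomputable def sB (b : ℕ → Bool) : ℝ := ∑' k : ℕ, if b k then ((2 : ℝ)⁻¹) ^ (k + 1) else 0

lemma sB_summable (b : ℕ → Bool) : Summable fun k : ℕ => if b k then ((2 : ℝ)⁻¹) ^ (k + 1) else 0 := by
  have h : Summable fun k : ℕ => ((2 : ℝ)⁻¹) ^ (k + 1) :=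
    (summable_nat_add_iff 1).2 (summable_geometric_of_lt_one (by norm_num) (by norm_num))
  refine h.of_nonneg_of_le (fun k => by split_ifs <;> positivity) fun k => by
    split_ifs <;> [exact le_rfl; positivity]

lemma sB_meas : Measurable sB := by
  refine measurable_of_tendsto_metrizable (f := fun N (b : ℕ → Bool) =>
    ∑ k ∈ Finset.range N, if b k then ((2 : ℝ)⁻¹) ^ (k + 1) else 0) (fun N => ?_) ?_
  · refine Finset.measurable_sum _ fun k _ => ?_
    have : Measurable fun b : Bool => (if b then ((2 : ℝ)⁻¹) ^ (k + 1) else 0) := measurable_from_top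
    exact this.comp (measurable_pi_apply k)
  · rw [tendsto_pi_nhds]
    intro b
    exact (sB_summable b).hasSum.tendsto_sum_nat

lemma sB_partial {x : ℝ} (h0 : 0 < x) (h1 : x < 1) (N : ℕ) :
    ∑ k ∈ Finset.range N, (if bits x k then ((2 : ℝ)⁻¹) ^ (k + 1) else 0) = ⌊x * 2 ^ N⌋ / 2 ^ N := by
  induction N with
  | zero =>
    have : ⌊x * 2 ^ 0⌋ = 0 := by rw [Int.floor_eq_iff]; norm_num; constructor <;> linarith
    rw [this]; simp
  | succ N ih =>
    rw [Finset.sum_range_succ, ih]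
    have f1 := Int.floor_le (x * 2 ^ N)
    have f2 := Int.lt_floor_add_one (x * 2 ^ N)
    have g1 := Int.floor_le (x * 2 ^ (N + 1))
    have g2 := Int.lt_floor_add_one (x * 2 ^ (N + 1))
    have h2 : x * 2 ^ (N + 1) = 2 * (x * 2 ^ N) := by ring
    have a1 : 2 * ⌊x * 2 ^ N⌋ ≤ ⌊x * 2 ^ (N + 1)⌋ := by
      rw [Int.le_floor]; push_cast; linarith
    have a2 : ⌊x * 2 ^ (N + 1)⌋ ≤ 2 * ⌊x * 2 ^ N⌋ + 1 := by
      have : ⌊x * 2 ^ (N + 1)⌋ < 2 * ⌊x * 2 ^ N⌋ + 2 := by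
        rw [Int.floor_lt]; push_cast; linarith
      omega
    have hb : bits x N = true ↔ ⌊x * 2 ^ (N + 1)⌋ % 2 = 1 := by unfold bits bit; exact boolOf_iff
    by_cases h : bits x N = true
    · have := hb.1 h
      have e : ⌊x * 2 ^ (N + 1)⌋ = 2 * ⌊x * 2 ^ N⌋ + 1 := by omega
      rw [if_pos h, e]; push_cast; rw [inv_pow]; field_simp; ring
    · have := mt hb.2 h
      have e : ⌊x * 2 ^ (N + 1)⌋ = 2 * ⌊x * 2 ^ N⌋ := by omega
      rw [if_neg h, e]; push_cast; field_simp; ring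

lemma sB_bits {x : ℝ} (h0 : 0 < x) (h1 : x < 1) : sB (bits x) = x := by
  have t1 := (sB_summable (bits x)).hasSum.tendsto_sum_nat
  refine tendsto_nhds_unique t1 ?_
  simp_rw [sB_partial h0 h1]
  have t2 : Filter.Tendsto (fun N : ℕ => x - (2⁻¹ : ℝ) ^ N) Filter.atTop (nhds (x - 0)) :=
    tendsto_const_nhds.sub (tendsto_pow_atTop_nhds_zero_of_lt_one (by norm_num) (by norm_num))
  rw [sub_zero] at t2
  refine tendsto_of_tendsto_of_tendsto_of_le_of_le t2 tendsto_const_nhds (fun N => ?_) (fun N => ?_)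
  · have f2 := Int.lt_floor_add_one (x * 2 ^ N)
    simp only
    rw [le_div_iff₀ (by positivity), sub_mul, inv_pow, inv_mul_cancel₀ (by positivity)]
    linarith
  · have f1 := Int.floor_le (x * 2 ^ N)
    simp only
    rw [div_le_iff₀ (by positivity)]; exact f1

lemma sB_law : (Measure.infinitePi fun _ : ℕ => fair).map sB = base := by
  rw [← bits_law, Measure.map_map sB_meas bits_meas]
  have : sB ∘ bits =ᵐ[base] id := by
    rw [base_eq]
    filter_upwards [ae_restrict_mem measurableSet_Ioo] with x hx
    exact sB_bits hx.1 hx.2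
  rw [Measure.map_congr this, Measure.map_id]

lemma unif_law : base.map (fun x i => unif i x) = PI ℕ := by
  have e : (fun x i => unif i x) = (fun (c : ℕ → ℕ → Bool) i => sB (c i)) ∘
      (MeasurableEquiv.curry ℕ ℕ Bool) ∘ (fun (b : ℕ → Bool) (q : ℕ × ℕ) => b (Nat.pair q.1 q.2)) ∘ bits := by
    ext x i; rfl
  have m1 : Measurable (fun (c : ℕ → ℕ → Bool) i => sB (c i)) :=
    measurable_pi_lambda _ fun i => sB_meas.comp (measurable_pi_apply i)
  have m2 : Measurable (fun (b : ℕ → Bool) (q : ℕ × ℕ) => b (Nat.pair q.1 q.2)) := by fun_prop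
  rw [e, ← Measure.map_map m1 ((MeasurableEquiv.measurable _).comp (m2.comp bits_meas)),
    ← Measure.map_map (MeasurableEquiv.measurable _) (m2.comp bits_meas), ← Measure.map_map m2 bits_meas, bits_law]
  have hinj : Function.Injective fun q : ℕ × ℕ => Nat.pair q.1 q.2 := by
    rintro ⟨a, b⟩ ⟨c, d⟩ h
    have := Nat.pair_eq_pair.1 h
    exact Prod.ext this.1 this.2
  rw [Measure.map_infinitePi_infinitePi_of_inj hinj]
  have := Measure.infinitePi_map_curry (fun (_ _ : ℕ) => fair)
  rw [this, Measure.infinitePi_map_pi _ fun i => sB_meas, sB_law]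
  rfl

/-! The canonical label space. -/

noncomputable def eIx (m : V) : ℕ := 2 * eIdx (m.1 / 2, m.2 / 2) (m.1 - m.1 / 2, m.2 - m.2 / 2)

lemma eIdx_comm (u v : V) : eIdx u v = eIdx v u := min_comm _ _

lemma eIdx_inj {u v u' v' : V} (h : eIdx u v = eIdx u' v') : u + v = u' + v' := by
  have key : ∀ u v : V, ∃ a b : V, eIdx u v = Encodable.encode (a, b) ∧ a + b = u + v := by
    intro u v
    rcases min_choice (Encodable.encode (u, v)) (Encodable.encode (v, u)) with e | e
    · exact ⟨u, v, e, rfl⟩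
    · exact ⟨v, u, e, add_comm _ _⟩
  obtain ⟨a, b, e, s⟩ := key u v
  obtain ⟨a', b', e', s'⟩ := key u' v'
  have := Encodable.encode_injective (e.symm.trans (h.trans e'))
  simp only [Prod.mk.injEq] at this
  rw [← s, ← s', this.1, this.2]

lemma eIx_inj : Function.Injective eIx := by
  intro m m' h
  have := eIdx_inj (Nat.eq_of_mul_eq_mul_left (by norm_num) h)
  simp only [Prod.mk_add_mk, add_sub_cancel, Prod.mk.injEq] at this
  exact Prod.ext this.1 this.2

lemma eIx_adj {a b : V} (h : SqAdj a b) : eIx (a + b) = 2 * eIdx a b := by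
  obtain ⟨a1, a2⟩ := a
  obtain ⟨b1, b2⟩ := b
  unfold eIx
  rw [sqAdj_iff] at h
  simp only [Prod.mk_add_mk] at h ⊢
  by_cases h' : (a1 + b1) / 2 = a1 ∧ (a2 + b2) / 2 = a2
  · rw [show ((a1 + b1) / 2, (a2 + b2) / 2) = (a1, a2) from Prod.ext h'.1 h'.2,
      show (a1 + b1 - (a1 + b1) / 2, a2 + b2 - (a2 + b2) / 2) = (b1, b2) from Prod.ext (by simp only; omega) (by simp only; omega)]
  · rw [show ((a1 + b1) / 2, (a2 + b2) / 2) = (b1, b2) from Prod.ext (by simp only; omega) (by simp only; omega),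
      show (a1 + b1 - (a1 + b1) / 2, a2 + b2 - (a2 + b2) / 2) = (a1, a2) from Prod.ext (by simp only; omega) (by simp only; omega), eIdx_comm]

abbrev Om : Type := V → ℝ
/-- The canonical measure: edge labels (indexed by doubled midpoints) and vertex labels. -/
noncomputable def PP : Measure (Om × Om) := (PI V).prod (PI V)

instance PP_prob : IsProbabilityMeasure PP := by unfold PP; infer_instance

noncomputable def lab (x : ℝ) : Om × Om :=
  (fun m => unif (eIx m) x, fun v => vtxU v x)

lemma unif_meas : Measurable (fun x i => unif i x) := by
  have e : (fun x i => unif i x) = (fun (b : ℕ → Bool) i => sB (fun k => b (Nat.pair i k))) ∘ bits := by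
    ext x i; rfl
  rw [e]
  refine Measurable.comp (measurable_pi_lambda _ fun i => sB_meas.comp ?_) bits_meas
  fun_prop

lemma lab_meas : Measurable lab := by
  have := unif_meas
  refine Measurable.prodMk (measurable_pi_lambda _ fun i => ?_) (measurable_pi_lambda _ fun i => ?_)
  · exact (measurable_pi_apply (eIx i)).comp this
  · exact (measurable_pi_apply (2 * Encodable.encode i + 1)).comp this

lemma lab_law : base.map lab = PP := by
  let j : V ⊕ V → ℕ := Sum.elim eIx (fun v => 2 * Encodable.encode v + 1)
  have hj : Function.Injective j := by
    rintro (a | a) (b | b) h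
    · exact congrArg _ (eIx_inj h)
    · simp only [j, Sum.elim_inl, Sum.elim_inr, eIx] at h; omega
    · simp only [j, Sum.elim_inl, Sum.elim_inr, eIx] at h; omega
    · simp only [j, Sum.elim_inr] at h
      exact congrArg _ (Encodable.encode_injective (by omega))
  let f : (V ⊕ V → ℝ) → Om × Om := fun ω => (fun i => ω (.inl i), fun i => ω (.inr i))
  have hf : Measurable f := by fun_prop
  have hm : Measurable (fun q : Om × Om => (Sum.elim q.1 q.2 : V ⊕ V → ℝ)) := by
    refine measurable_pi_lambda _ fun i => ?_
    rcases i with i | i <;> simp only [Sum.elim_inl, Sum.elim_inr] <;> fun_prop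
  have e : (PI (V ⊕ V)).map f = PP := by
    rw [← pi_sum, Measure.map_map hf hm]
    exact Measure.map_id
  rw [← e, ← pi_reindex hj, ← unif_law, Measure.map_map (by fun_prop) unif_meas, Measure.map_map hf]
  · rfl
  · exact Measurable.comp (by fun_prop) unif_meas

end DaC


namespace DaC

/-! ## Part 2c: Bernoulli bond percolation -/

noncomputable def ofMid (β : V → Bool) : EdgeCfg := fun a b => boolOf (SqAdj a b) && β (a + b)

noncomputable def cfg (q : ℝ) (ω : Om) : EdgeCfg := ofMid (thr q ω)

lemma ofMid_meas : Measurable ofMid := by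
  refine measurable_pi_lambda _ fun a => measurable_pi_lambda _ fun b => ?_
  have : Measurable fun c : Bool => (boolOf (SqAdj a b) && c) := measurable_from_top
  exact this.comp (measurable_pi_apply (a + b))

lemma cfg_meas (q : ℝ) : Measurable (cfg q) := ofMid_meas.comp (thr_meas q)

lemma cfg_iff {q : ℝ} {ω : Om} {a b : V} : cfg q ω a b = true ↔ SqAdj a b ∧ ω (a + b) < q := by
  simp [cfg, ofMid, thr, boolOf_iff]

lemma cfg_comm (q : ℝ) (ω : Om) (a b : V) : cfg q ω a b = cfg q ω b a := by
  simp only [cfg, ofMid, add_comm a b]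
  congr 2
  exact propext sqAdj_comm

lemma ostep_cfg {q : ℝ} {ω : Om} {a b : V} : ostep (cfg q ω) a b ↔ SqAdj a b ∧ ω (a + b) < q := by
  unfold ostep
  rw [cfg_comm q ω b a, cfg_iff]; tauto

lemma cfg_mono {q s : ℝ} (h : q ≤ s) (ω : Om) : cle (cfg q ω) (cfg s ω) := by
  intro a b
  rw [cfg_iff, cfg_iff]
  exact fun h' => ⟨h'.1, h'.2.trans_le h⟩

/-- Midpoints determine the edges. -/
lemma mid_inj {a b c d : V} (h : SqAdj a b) (h' : SqAdj c d) (e : a + b = c + d) :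
    (a = c ∧ b = d) ∨ (a = d ∧ b = c) := by
  rw [sqAdj_iff] at h h'
  have e1 := congrArg Prod.fst e
  have e2 := congrArg Prod.snd e
  simp only [Prod.fst_add, Prod.snd_add] at e1 e2
  simp only [Prod.ext_iff]
  omega

/-- Midpoints of the edges inside `W`. -/
def mids (W : Set V) : Set V := {m | ∃ a ∈ W, ∃ b ∈ W, SqAdj a b ∧ a + b = m}

lemma mids_finite {W : Set V} (h : W.Finite) : (mids W).Finite := by
  refine (Set.Finite.image2 (fun a b => a + b) h h).subset ?_
  rintro m ⟨a, ha, b, hb, _, rfl⟩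
  exact ⟨a, ha, b, hb, rfl⟩

lemma mem_mids {W : Set V} {a b : V} (h : SqAdj a b) : a + b ∈ mids W ↔ a ∈ W ∧ b ∈ W := by
  constructor
  · rintro ⟨c, hc, d, hd, h', e⟩
    rcases mid_inj h h' e.symm with ⟨rfl, rfl⟩ | ⟨rfl, rfl⟩
    · exact ⟨hc, hd⟩
    · exact ⟨hd, hc⟩
  · rintro ⟨ha, hb⟩; exact ⟨a, ha, b, hb, h, rfl⟩

lemma mids_disjoint {W W' : Set V} (h : Disjoint W W') : Disjoint (mids W) (mids W') := by
  rw [Set.disjoint_left] at *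
  rintro m ⟨a, ha, b, hb, hab, rfl⟩ hm
  exact h ha ((mem_mids hab).1 hm).1

lemma cfg_congr {q : ℝ} {W : Set V} {ω ω' : Om} (h : ∀ m ∈ mids W, ω m = ω' m) :
    ∀ a b, a ∈ W → b ∈ W → cfg q ω a b = cfg q ω' a b := by
  intro a b ha hb
  rw [Bool.eq_iff_iff, cfg_iff, cfg_iff]
  refine and_congr_right fun hab => ?_
  rw [h _ ⟨a, ha, b, hb, hab, rfl⟩]

lemma Dep.depC {q : ℝ} {W : Set V} {A : Set EdgeCfg} (h : Dep W A) : DepC (mids W) (cfg q ⁻¹' A) :=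
  fun _ _ e hx => h _ _ (cfg_congr e) hx

noncomputable def bond (q : ℝ) : Measure EdgeCfg := (PI V).map (cfg q)

instance bond_prob (q : ℝ) : IsProbabilityMeasure (bond q) := by
  unfold bond; exact Measure.isProbabilityMeasure_map (cfg_meas q).aemeasurable

lemma bond_real (q : ℝ) {A : Set EdgeCfg} (hA : MeasurableSet A) :
    (bond q).real A = (PI V).real (cfg q ⁻¹' A) := map_measureReal_apply (cfg_meas q) hA

lemma cfg_act {g : V ≃ V} (hg : Lat g) {j : V → V} (hj : ∀ a b, g a + g b = j (a + b)) (q : ℝ) (ω : Om) :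
    act g (cfg q ω) = cfg q (fun k => ω (j k)) := by
  ext a b
  simp only [act, cfg, ofMid, thr, hj]
  congr 2
  exact propext (hg.adj a b)

lemma bond_inv (q : ℝ) (g : V ≃ V) (hg : Lat g) : (bond q).map (act g) = bond q := by
  obtain ⟨j, hj, e⟩ := hg.mid
  rw [bond, Measure.map_map (act_meas g) (cfg_meas q)]
  have : act g ∘ cfg q = cfg q ∘ (fun ω k => ω (j k)) := by
    funext ω; exact cfg_act hg e q ω
  rw [this, ← Measure.map_map (cfg_meas q) (by fun_prop), pi_reindex hj]

lemma bond_perc {q : ℝ} (h0 : 0 ≤ q) (h1 : q ≤ 1) : Perc (bond q) where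
  prob := inferInstance
  inv := bond_inv q
  pa := by
    intro W A B hW dA dB iA iB
    have key : ∀ A : Set EdgeCfg, Dep W A → DepB ((mids_finite hW).toFinset : Finset V) (ofMid ⁻¹' A) := by
      intro A d β β' e hx
      refine d _ _ (fun a b ha hb => ?_) hx
      unfold ofMid
      by_cases hab : SqAdj a b
      · rw [e (a + b) (by simpa using ⟨a, ha, b, hb, hab, rfl⟩)]
      · simp [boolOf, hab]
    have key2 : ∀ A : Set EdgeCfg, Inc A → IncB (ofMid ⁻¹' A) := by
      intro A d β β' e hx
      refine d _ _ (fun a b => ?_) hx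
      unfold ofMid
      simp only [Bool.and_eq_true]
      exact fun h => ⟨h.1, e _ h.2⟩
    have mA := dA.measurable hW
    have mB := dB.measurable hW
    rw [bond_real q mA, bond_real q mB, bond_real q (mA.inter mB)]
    exact harris h0 h1 _ _ _ (key A dA) (key B dB) (key2 A iA) (key2 B iB)

lemma bond_mix (q : ℝ) : Mix (bond q) (fun _ => 0) := by
  intro n hn W W' A B hW hW' hd dA dB
  have mA := dA.measurable ((bx_finite _ _ _ _).subset hW)
  have mB := dB.measurable ((bx_finite _ _ _ _).subset hW')
  rw [bond_real q mA, bond_real q mB, bond_real q (mA.inter mB), add_zero]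
  refine (pi_indep (cfg_meas q mA) (cfg_meas q mB) dA.depC dB.depC (mids_disjoint ?_)).le
  rw [Set.disjoint_left]
  intro a ha ha'
  have := hd a ha a ha'
  simp [nrm] at this
  omega

/-! Measurability of connection events. -/

lemma CI.bounded {η : EdgeCfg} {R : Set V} {u v : V} (h : CI η R u v) :
    ∃ n : ℕ, CI η (R ∩ BB n) u v := by
  obtain ⟨h1, h2⟩ := h
  have hm : ∀ v : V, v ∈ BB ((nrm v).toNat : ℤ) := fun v => mem_BB.2 (by omega)
  have hmon : ∀ {a b : ℕ}, a ≤ b → R ∩ BB a ⊆ R ∩ BB b := fun h => Set.inter_subset_inter_right _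
    (bx_mono (by omega) (by omega) (by omega) (by omega))
  induction h2 with
  | refl => exact ⟨(nrm u).toNat, CI.refl ⟨h1, hm u⟩⟩
  | @tail y z _ h ih =>
    obtain ⟨n, ih⟩ := ih
    refine ⟨max n (nrm z).toNat, CI.tail (ih.mono (hmon (le_max_left _ _))) h.1 ⟨h.2.2, ?_⟩⟩
    exact (hmon (le_max_right n (nrm z).toNat) ⟨h.2.2, hm z⟩).2

lemma CI_meas (R : Set V) (u v : V) : MeasurableSet {η : EdgeCfg | CI η R u v} := by
  have : {η : EdgeCfg | CI η R u v} = ⋃ n : ℕ, {η : EdgeCfg | CI η (R ∩ BB n) u v} := by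
    ext η; simp only [Set.mem_ofPred_eq, Set.mem_iUnion]
    exact ⟨fun h => h.bounded, fun ⟨n, h⟩ => h.mono Set.inter_subset_left⟩
  rw [this]
  refine MeasurableSet.iUnion fun n => Dep.measurable (W := R ∩ BB n) ((bx_finite _ _ _ _).subset Set.inter_subset_right) ?_
  exact fun η η' e h => CI.congr e h

lemma Ev_meas (R S T : Set V) : MeasurableSet (Ev R S T) := by
  have : Ev R S T = ⋃ u ∈ S, ⋃ v ∈ T, {η : EdgeCfg | CI η R u v} := by
    ext η; simp [Ev]
  rw [this]
  exact MeasurableSet.biUnion (Set.to_countable _) fun u _ => MeasurableSet.biUnion (Set.to_countable _) fun v _ => CI_meas R u v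

/-! Boundary pairs of a finite set. -/

def nb (x : V) : Finset V := {(x.1 + 1, x.2), (x.1 - 1, x.2), (x.1, x.2 + 1), (x.1, x.2 - 1)}

lemma mem_nb {x y : V} : y ∈ nb x ↔ SqAdj x y := by
  rw [sqAdj_iff]
  simp only [nb, Finset.mem_insert, Finset.mem_singleton, Prod.ext_iff]
  omega

open Classical in
noncomputable def bd (S : Finset V) : Finset (V × V) :=
  (S ×ˢ S.biUnion nb).filter fun e => SqAdj e.1 e.2 ∧ e.2 ∉ S

lemma mem_bd {S : Finset V} {e : V × V} : e ∈ bd S ↔ e.1 ∈ S ∧ e.2 ∉ S ∧ SqAdj e.1 e.2 := by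
  simp only [bd, Finset.mem_filter, Finset.mem_product, Finset.mem_biUnion]
  constructor
  · rintro ⟨⟨h1, _⟩, h2, h3⟩; exact ⟨h1, h3, h2⟩
  · rintro ⟨h1, h2, h3⟩; exact ⟨⟨h1, e.1, h1, mem_nb.2 h3⟩, h3, h2⟩

noncomputable def phi (q : ℝ) (S : Finset V) : ℝ :=
  q * ∑ e ∈ bd S, (PI V).real (cfg q ⁻¹' {η | CI η S (0, 0) e.1})

end DaC


namespace DaC

/-! ## Part 2d: exponential decay, first half -/

lemma last_exit {η : EdgeCfg} {C : Set V} {u v : V} (h : CI η Set.univ u v) (hu : u ∈ C) (hv : v ∉ C) :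
    ∃ x ∈ C, ∃ y ∉ C, ostep η x y ∧ CI η Cᶜ y v := by
  have key : ∀ u, Relation.ReflTransGen (fun a b => ostep η a b ∧ a ∈ Set.univ ∧ b ∈ Set.univ) u v →
      CI η Cᶜ u v ∨ ∃ x ∈ C, ∃ y ∉ C, ostep η x y ∧ CI η Cᶜ y v := by
    intro u h
    induction h using Relation.ReflTransGen.head_induction_on with
    | refl => exact .inl (CI.refl hv)
    | @head a b hab _ ih =>
      rcases ih with ih | ih
      · by_cases ha : a ∈ C
        · exact .inr ⟨a, ha, b, ih.mem_left, hab.1, ih⟩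
        · exact .inl ((CI.refl (show a ∈ Cᶜ from ha)).tail hab.1 ih.mem_left |>.trans ih)
      · exact .inr ih
  rcases key u h.2 with h | h
  · exact absurd hu h.mem_left
  · exact h

noncomputable def armP (q : ℝ) (N : ℕ) : ℝ :=
  (PI V).real (cfg q ⁻¹' Ev Set.univ {(0, 0)} {v | (N : ℤ) ≤ nrm v})

open Classical in
noncomputable def clus (q : ℝ) (S : Finset V) (ω : Om) : Finset V :=
  S.filter fun x => CI (cfg q ω) S (0, 0) x

lemma mem_clus {q : ℝ} {S : Finset V} {ω : Om} {x : V} :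
    x ∈ clus q S ω ↔ CI (cfg q ω) S (0, 0) x := by
  simp only [clus, Finset.mem_filter]
  exact ⟨fun h => h.2, fun h => ⟨h.mem_right, h⟩⟩

lemma clus_meas (q : ℝ) (S : Finset V) (C0 : Finset V) : MeasurableSet {ω | clus q S ω = C0} := by
  have : {ω | clus q S ω = C0} = ⋂ x : V, {ω | (x ∈ C0) ↔ cfg q ω ∈ {η | CI η S (0, 0) x}} := by
    ext ω
    simp only [Set.mem_ofPred_eq, Set.mem_iInter, Finset.ext_iff, mem_clus]
    exact forall_congr' fun x => Iff.comm
  rw [this]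
  refine MeasurableSet.iInter fun x => ?_
  by_cases hx : x ∈ C0
  · simp only [hx, true_iff]; exact cfg_meas q (CI_meas _ _ _)
  · simp only [hx, false_iff]; exact (cfg_meas q (CI_meas _ _ _)).compl

lemma clus_dep {q : ℝ} {S C0 : Finset V} (h0 : ((0, 0) : V) ∈ S) :
    DepC {m | ∃ a ∈ C0, ∃ b ∈ S, SqAdj a b ∧ a + b = m} {ω | clus q S ω = C0} := by
  intro ω ω' e h
  simp only [Set.mem_ofPred_eq] at *
  have m0 : ((0, 0) : V) ∈ C0 := by rw [← h, mem_clus]; exact CI.refl h0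
  ext x
  rw [mem_clus]
  constructor
  · rintro ⟨_, h2⟩
    induction h2 with
    | refl => exact m0
    | @tail a b _ hab ih =>
      obtain ⟨hab, _, hb⟩ := hab
      rw [ostep_cfg] at hab
      rw [← h, mem_clus] at ih ⊢
      refine ih.tail (ostep_cfg.2 ⟨hab.1, ?_⟩) hb
      rw [e _ ⟨a, ?_, b, hb, hab.1, rfl⟩]
      · exact hab.2
      · rwa [← h, mem_clus]
  · intro hx
    rw [← h, mem_clus] at hx
    obtain ⟨_, h2⟩ := hx
    induction h2 with
    | refl => exact CI.refl h0
    | @tail a b hua hab ih =>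
      obtain ⟨hab, ha, hb⟩ := hab
      rw [ostep_cfg] at hab
      refine ih.tail (ostep_cfg.2 ⟨hab.1, ?_⟩) hb
      rw [← e _ ⟨a, ?_, b, hb, hab.1, rfl⟩]
      · exact hab.2
      · rw [← h, mem_clus]; exact ⟨h0, hua⟩

lemma nrm_sub_le (u v : V) : nrm u ≤ nrm (u - v) + nrm v := by
  have h1 := (nrm_le (v := u - v)).1 le_rfl
  have h2 := (nrm_le (v := v)).1 le_rfl
  simp only [Prod.fst_sub, Prod.snd_sub] at h1
  rw [nrm_le]; omega

lemma armP_from (q : ℝ) (N L : ℕ) (y : V) (hy : nrm y ≤ L) (R : Set V) :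
    (PI V).real (cfg q ⁻¹' Ev R {y} {v | ((N + L : ℕ) : ℤ) ≤ nrm v}) ≤ armP q N := by
  rw [armP, ← bond_real q (Ev_meas _ _ _), ← bond_real q (Ev_meas _ _ _)]
  refine le_trans (measureReal_mono (Ev.mono (Set.subset_univ R) le_rfl le_rfl)) ?_
  rw [← Perc.act_Ev (trE_lat y), ← map_measureReal_apply (act_meas _) (Ev_meas _ _ _), bond_inv q _ (trE_lat y)]
  refine measureReal_mono (Ev.mono (Set.subset_univ _) ?_ ?_)
  · intro v hv
    have hv : trE y v = y := hv
    rw [trE_apply] at hv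
    have h1 := congrArg Prod.fst hv
    have h2 := congrArg Prod.snd hv
    simp only at h1 h2
    have : v = (0, 0) := Prod.ext (by show v.1 = 0; omega) (by show v.2 = 0; omega)
    rw [this]; rfl
  · intro v hv
    have hv : ((N + L : ℕ) : ℤ) ≤ nrm (trE y v) := hv
    have := nrm_sub_le (trE y v) y
    have e : trE y v - y = v := by simp [trE]
    rw [e] at this
    show (N : ℤ) ≤ nrm v
    push_cast at hv
    omega

lemma armP_nonneg (q : ℝ) (N : ℕ) : 0 ≤ armP q N := measureReal_nonneg
lemma armP_le_one (q : ℝ) (N : ℕ) : armP q N ≤ 1 := measureReal_le_one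

open Classical in
lemma armP_step {q : ℝ} (h0 : 0 ≤ q) (h1 : q ≤ 1) {S : Finset V} (hS0 : ((0, 0) : V) ∈ S) {L : ℕ}
    (hSL : ∀ v ∈ S, nrm v ≤ L) (N : ℕ) : armP q (N + (L + 1)) ≤ phi q S * armP q N := by
  set far : Set V := {v | ((N + (L + 1) : ℕ) : ℤ) ≤ nrm v} with hfar
  let G : Finset V → V × V → Set Om := fun C0 e => {ω | clus q S ω = C0} ∩
    ({ω | ω (e.1 + e.2) ∈ {x | x < q}} ∩ cfg q ⁻¹' Ev ((C0 : Set V)ᶜ) {e.2} far)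
  have sub : cfg q ⁻¹' Ev Set.univ {(0, 0)} far ⊆
      ⋃ C0 ∈ S.powerset, ⋃ e ∈ (bd S).filter (fun e => e.1 ∈ C0), G C0 e := by
    rintro ω ⟨u, rfl, v, hv, h⟩
    have hv' : v ∉ S := by
      intro h
      have := hSL v h
      have hv : ((N + (L + 1) : ℕ) : ℤ) ≤ nrm v := hv
      push_cast at hv
      omega
    obtain ⟨x, hx, y, hy, hxy, hyv⟩ := last_exit (C := (clus q S ω : Set V)) h (by
      simp only [Finset.mem_coe, mem_clus]; exact CI.refl hS0)
      (fun h => hv' (by have := mem_clus.1 h; exact this.mem_right))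
    simp only [Finset.mem_coe, mem_clus] at hx hy
    have hyS : y ∉ S := fun hyS => hy (hx.tail hxy hyS)
    simp only [Set.mem_iUnion]
    refine ⟨clus q S ω, Finset.mem_powerset.2 (Finset.filter_subset _ _), (x, y),
      Finset.mem_filter.2 ⟨mem_bd.2 ⟨hx.mem_right, hyS, hxy.1⟩, mem_clus.2 hx⟩, rfl, ?_, ?_⟩
    · exact (ostep_cfg.1 hxy).2
    · exact ⟨y, rfl, v, hv, hyv⟩
  have bound : ∀ C0 ∈ S.powerset, ∀ e ∈ (bd S).filter (fun e => e.1 ∈ C0),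
      (PI V).real (G C0 e) ≤ (PI V).real {ω | clus q S ω = C0} * (q * armP q N) := by
    intro C0 hC0 e he
    rw [Finset.mem_filter, mem_bd] at he
    obtain ⟨⟨he1, he2, he3⟩, he4⟩ := he
    have hC0 := Finset.mem_powerset.1 hC0
    have dF : DepC (mids ((C0 : Set V)ᶜ)) (cfg q ⁻¹' Ev ((C0 : Set V)ᶜ) {e.2} far) := (Ev.dep _ _ _).depC
    have mF : MeasurableSet (cfg q ⁻¹' Ev ((C0 : Set V)ᶜ) {e.2} far) := cfg_meas q (Ev_meas _ _ _)
    have mlt : MeasurableSet {x : ℝ | x < q} := measurableSet_Iio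
    have hne : e.1 + e.2 ∉ mids ((C0 : Set V)ᶜ) := fun h => ((mem_mids he3).1 h).1 he4
    have mlt' : MeasurableSet {ω : Om | ω (e.1 + e.2) ∈ {x | x < q}} :=
      (measurable_pi_apply (e.1 + e.2) : Measurable fun ω : Om => ω (e.1 + e.2)) mlt
    show (PI V).real ({ω | clus q S ω = C0} ∩
      ({ω | ω (e.1 + e.2) ∈ {x | x < q}} ∩ cfg q ⁻¹' Ev ((C0 : Set V)ᶜ) {e.2} far)) ≤ _
    rw [pi_indep (T := insert (e.1 + e.2) (mids ((C0 : Set V)ᶜ))) (clus_meas _ _ _) (mlt'.inter mF) (clus_dep hS0)]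
    · rw [pi_coord_indep _ mlt mF (dF.mono (by rintro m hm rfl; exact hne hm)), base_lt h0 h1]
      refine mul_le_mul_of_nonneg_left (mul_le_mul_of_nonneg_left ?_ h0) measureReal_nonneg
      refine armP_from q N (L + 1) e.2 ?_ _
      have := lip_nrm _ _ he3
      have := hSL _ he1
      push_cast; omega
    · refine DepC.inter ?_ (dF.mono (Set.subset_insert _ _))
      intro ω ω' h hx
      have hx : ω (e.1 + e.2) < q := hx
      rw [h _ (Set.mem_insert _ _)] at hx
      exact hx
    · rw [Set.disjoint_left]
      rintro m ⟨a, ha, b, hb, hab, rfl⟩ hm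
      rcases Set.mem_insert_iff.1 hm with hm | hm
      · rcases mid_inj hab he3 hm with ⟨rfl, rfl⟩ | ⟨rfl, rfl⟩
        · exact he2 hb
        · exact he2 (hC0 ha)
      · exact ((mem_mids hab).1 hm).1 ha
  calc armP q (N + (L + 1)) ≤ (PI V).real (⋃ C0 ∈ S.powerset, ⋃ e ∈ (bd S).filter (fun e => e.1 ∈ C0), G C0 e) :=
        measureReal_mono sub (measure_ne_top _ _)
    _ ≤ ∑ C0 ∈ S.powerset, ∑ e ∈ (bd S).filter (fun e => e.1 ∈ C0), (PI V).real {ω | clus q S ω = C0} * (q * armP q N) := by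
        refine (measureReal_biUnion_finset_le _ _).trans (Finset.sum_le_sum fun C0 hC0 => ?_)
        exact (measureReal_biUnion_finset_le _ _).trans (Finset.sum_le_sum fun e he => bound C0 hC0 e he)
    _ = ∑ e ∈ bd S, (∑ C0 ∈ S.powerset.filter (fun C0 => e.1 ∈ C0), (PI V).real {ω | clus q S ω = C0}) * (q * armP q N) := by
        simp_rw [Finset.sum_mul, Finset.sum_filter]
        exact Finset.sum_comm
    _ = phi q S * armP q N := by
        have : ∀ e : V × V, ∑ C0 ∈ S.powerset.filter (fun C0 => e.1 ∈ C0), (PI V).real {ω | clus q S ω = C0} =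
            (PI V).real (cfg q ⁻¹' {η | CI η S (0, 0) e.1}) := by
          intro e
          rw [← measureReal_biUnion_finset]
          · congr 1
            ext ω
            simp only [Set.mem_iUnion, Finset.mem_filter, Finset.mem_powerset, Set.mem_ofPred_eq, Set.mem_preimage]
            constructor
            · rintro ⟨C0, ⟨_, h⟩, rfl⟩; exact mem_clus.1 h
            · intro h; exact ⟨_, ⟨Finset.filter_subset _ _, mem_clus.2 h⟩, rfl⟩
          · intro C _ C' _ hne
            rw [Function.onFun, Set.disjoint_left]
            rintro ω h h'
            exact hne (h.symm.trans h')
          · intro C _; exact clus_meas _ _ _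
        simp_rw [this]
        rw [← Finset.sum_mul, phi]; ring

lemma armP_anti (q : ℝ) {N M : ℕ} (h : N ≤ M) : armP q M ≤ armP q N := by
  refine measureReal_mono (Set.preimage_mono (Ev.mono le_rfl le_rfl ?_))
  intro v (hv : (M : ℤ) ≤ nrm v)
  show (N : ℤ) ≤ nrm v
  omega

/-- Polynomial decay of any order; we record the order needed. -/
lemma armP_decay {q : ℝ} (h0 : 0 ≤ q) (h1 : q ≤ 1) {S : Finset V} (hS0 : ((0, 0) : V) ∈ S) (hφ : phi q S < 1) :
    ∃ K : ℝ, 0 ≤ K ∧ ∀ n : ℕ, 1 ≤ n → armP q n ≤ K / (n : ℝ) ^ 3 := by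
  obtain ⟨L, hL⟩ : ∃ L : ℕ, ∀ v ∈ S, nrm v ≤ L := by
    refine ⟨(S.sup fun v => (nrm v).toNat), fun v hv => ?_⟩
    have := Finset.le_sup (f := fun v => (nrm v).toNat) hv
    omega
  have hφ0 : 0 ≤ phi q S := mul_nonneg h0 (Finset.sum_nonneg fun _ _ => measureReal_nonneg)
  have pw : ∀ k : ℕ, armP q (k * (L + 1)) ≤ phi q S ^ k := by
    intro k
    induction k with
    | zero => simpa using armP_le_one q 0
    | succ k ih =>
      rw [show (k + 1) * (L + 1) = k * (L + 1) + (L + 1) by ring, pow_succ']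
      exact (armP_step h0 h1 hS0 hL _).trans (mul_le_mul_of_nonneg_left ih hφ0)
  have ht := tendsto_pow_const_mul_const_pow_of_lt_one 3 hφ0 hφ
  obtain ⟨B, hB⟩ := ht.bddAbove_range
  have hB' : ∀ k : ℕ, (k : ℝ) ^ 3 * phi q S ^ k ≤ B := fun k => hB ⟨k, rfl⟩
  have hB0 : 0 ≤ B := by simpa using hB' 0
  refine ⟨(2 * (L + 1)) ^ 3 * (B + 1), by positivity, fun n hn => ?_⟩
  rw [le_div_iff₀ (by positivity)]
  by_cases hk : n < L + 1
  · have : (n : ℝ) ≤ L + 1 := by exact_mod_cast hk.le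
    calc armP q n * (n : ℝ) ^ 3 ≤ 1 * (2 * (L + 1) : ℝ) ^ 3 := by
          refine mul_le_mul (armP_le_one _ _) ?_ (by positivity) (by norm_num)
          gcongr; linarith
      _ ≤ _ := by
          rw [one_mul]
          exact le_mul_of_one_le_right (by positivity) (by linarith)
  · set k := n / (L + 1) with hkd
    have hk1 : 1 ≤ k := by
      rw [hkd]; exact (Nat.one_le_div_iff (by omega)).2 (by omega)
    have e1 : k * (L + 1) ≤ n := Nat.div_mul_le_self _ _
    have e2 : n ≤ 2 * (L + 1) * k := by
      have := Nat.div_add_mod n (L + 1)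
      have := Nat.mod_lt n (show 0 < L + 1 by omega)
      rw [← hkd] at *
      nlinarith
    have e2' : (n : ℝ) ≤ 2 * (L + 1) * k := by exact_mod_cast e2
    have := (armP_anti q e1).trans (pw k)
    calc armP q n * (n : ℝ) ^ 3 ≤ phi q S ^ k * (2 * (L + 1) * k) ^ 3 := by
          refine mul_le_mul this ?_ (by positivity) (by positivity)
          gcongr
      _ = (2 * (L + 1)) ^ 3 * ((k : ℝ) ^ 3 * phi q S ^ k) := by ring
      _ ≤ _ := mul_le_mul_of_nonneg_left ((hB' k).trans (by linarith)) (by positivity)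

end DaC


namespace DaC

/-! ## Part 2e: exponential decay, second half -/

noncomputable def Bf (n : ℕ) : Finset V := (bx_finite (-(n : ℤ)) n (-n) n).toFinset

lemma mem_Bf {n : ℕ} {v : V} : v ∈ Bf n ↔ nrm v ≤ n := by
  rw [Bf, Set.Finite.mem_toFinset]; exact mem_BB

/-- Being connected to the boundary of the box. -/
def toB (q : ℝ) (n : ℕ) (ω : Om) (x : V) : Prop := ∃ v, (n : ℤ) ≤ nrm v ∧ CI (cfg q ω) (BB n) x v

open Classical in
noncomputable def sep (q : ℝ) (n : ℕ) (ω : Om) : Finset V := (Bf n).filter fun x => ¬ toB q n ω x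

lemma mem_sep {q : ℝ} {n : ℕ} {ω : Om} {x : V} : x ∈ sep q n ω ↔ nrm x ≤ n ∧ ¬ toB q n ω x := by
  simp only [sep, Finset.mem_filter, mem_Bf]

lemma toB_meas (q : ℝ) (n : ℕ) (x : V) : MeasurableSet {ω | toB q n ω x} := by
  have : {ω | toB q n ω x} = cfg q ⁻¹' Ev (BB n) {x} {v | (n : ℤ) ≤ nrm v} := by
    ext ω; simp [toB, Ev]
  rw [this]; exact cfg_meas q (Ev_meas _ _ _)

lemma sep_meas (q : ℝ) (n : ℕ) (S : Finset V) : MeasurableSet {ω | sep q n ω = S} := by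
  have : {ω | sep q n ω = S} = ⋂ x : V, {ω | (x ∈ S) ↔ (nrm x ≤ n ∧ ¬ toB q n ω x)} := by
    ext ω
    simp only [Set.mem_ofPred_eq, Set.mem_iInter, Finset.ext_iff, mem_sep]
    exact forall_congr' fun x => Iff.comm
  rw [this]
  refine MeasurableSet.iInter fun x => ?_
  by_cases hx : x ∈ S <;> by_cases hx' : nrm x ≤ n <;> simp only [hx, hx', true_iff, false_iff, true_and, false_and, not_not, not_true, not_false_iff, iff_true, iff_false]
  · exact (toB_meas q n x).compl
  · exact MeasurableSet.const _
  · exact toB_meas q n x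
  · exact MeasurableSet.const _

lemma sep_dep {q : ℝ} {n : ℕ} {S : Finset V} : DepC (mids (S : Set V))ᶜ {ω | sep q n ω = S} := by
  intro ω ω' e h
  simp only [Set.mem_ofPred_eq] at *
  have hS : ∀ x, x ∈ S ↔ nrm x ≤ n ∧ ¬ toB q n ω x := fun x => by rw [← h, mem_sep]
  -- open edges not inside S agree
  have he : ∀ a b, ¬ (a ∈ S ∧ b ∈ S) → ostep (cfg q ω') a b → ostep (cfg q ω) a b := by
    intro a b hab ho
    rw [ostep_cfg] at *
    exact ⟨ho.1, by rw [e _ fun hm => hab ((mem_mids ho.1).1 hm)]; exact ho.2⟩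
  have he' : ∀ a b, ¬ (a ∈ S ∧ b ∈ S) → ostep (cfg q ω) a b → ostep (cfg q ω') a b := by
    intro a b hab ho
    rw [ostep_cfg] at *
    exact ⟨ho.1, by rw [← e _ fun hm => hab ((mem_mids ho.1).1 hm)]; exact ho.2⟩
  have out : ∀ x, toB q n ω x → toB q n ω' x := by
    rintro x ⟨v, hv, hx, hxv⟩
    refine ⟨v, hv, ?_⟩
    induction hxv using Relation.ReflTransGen.head_induction_on with
    | refl => exact CI.refl hx
    | @head a b hab hbv ih =>
      have ib := ih hab.2.2
      have ha : a ∉ S := fun ha => ((hS a).1 ha).2 ⟨v, hv, hx, Relation.ReflTransGen.head hab hbv⟩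
      exact ((CI.refl hab.2.1).tail (he' a b (fun h => ha h.1) hab.1) hab.2.2).trans ib
  ext x
  rw [mem_sep, hS]
  refine and_congr_right fun hx => not_congr ⟨?_, out x⟩
  rintro ⟨v, hv, hx, hxv⟩
  have hvS : toB q n ω v := ⟨v, hv, CI.refl (CI.mem_right ⟨hx, hxv⟩)⟩
  clear hx
  induction hxv using Relation.ReflTransGen.head_induction_on with
  | refl => exact hvS
  | @head a b hab hbv ih =>
    obtain ⟨w, hw, hbw⟩ := ih (mem_BB.1 hab.2.2)
    have hb : b ∉ S := fun hb => ((hS b).1 hb).2 ⟨w, hw, hbw⟩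
    exact ⟨w, hw, ((CI.refl hab.2.1).tail (he a b (fun h => hb h.2) hab.1) hab.2.2).trans hbw⟩

lemma toB_mono {q s : ℝ} (h : q ≤ s) {n : ℕ} {ω : Om} {x : V} (hx : toB q n ω x) : toB s n ω x := by
  obtain ⟨v, hv, h'⟩ := hx
  exact ⟨v, hv, h'.mono_cfg (cfg_mono h ω)⟩

noncomputable def uP (n : ℕ) (q : ℝ) : ℝ := (PI V).real {ω | ¬ toB q n ω (0, 0)}

open Classical in
lemma G_prob {q h : ℝ} (hq : 0 ≤ q) (hh : 0 ≤ h) (h1 : q + h ≤ 1) {n : ℕ} {S : Finset V} {e : V × V} (he : e ∈ bd S) :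
    h * ((PI V).real {ω | sep q n ω = S} * (PI V).real (cfg q ⁻¹' {η | CI η S (0, 0) e.1})) ≤
    (PI V).real (cfg q ⁻¹' {η | CI η S (0, 0) e.1} ∩ ({ω | ω (e.1 + e.2) ∈ {x | q ≤ x ∧ x < q + h}} ∩ {ω | sep q n ω = S})) := by
  obtain ⟨he1, he2, he3⟩ := mem_bd.1 he
  set m := e.1 + e.2 with hm
  let H : Set Om := {ω | sep q n (Function.update ω m 1) = S}
  have hup : ∀ ω : Om, q ≤ ω m → cfg q (Function.update ω m 1) = cfg q ω := by
    intro ω hω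
    unfold cfg
    congr 1
    ext k
    simp only [thr]
    by_cases hk : k = m
    · subst hk; rw [Function.update_self, Bool.eq_iff_iff, boolOf_iff, boolOf_iff]; constructor <;> intro h <;> linarith
    · rw [Function.update_of_ne hk]
  have hsep : ∀ ω : Om, q ≤ ω m → sep q n (Function.update ω m 1) = sep q n ω := by
    intro ω hω
    ext x
    rw [mem_sep, mem_sep, toB, toB, hup ω hω]
  have mJ : MeasurableSet {x : ℝ | q ≤ x ∧ x < q + h} := measurableSet_Ico
  have mH : MeasurableSet H := (sep_meas q n S).preimage measurable_update_left
  have dH : DepC {m}ᶜ H := by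
    intro ω ω' e hx
    have : Function.update ω m 1 = Function.update ω' m 1 := by
      ext k
      by_cases hk : k = m
      · subst hk; simp
      · rw [Function.update_of_ne hk, Function.update_of_ne hk, e k hk]
    show sep q n (Function.update ω' m 1) = S
    rw [← this]; exact hx
  have eq : {ω : Om | ω m ∈ {x | q ≤ x ∧ x < q + h}} ∩ {ω | sep q n ω = S} =
      {ω : Om | ω m ∈ {x | q ≤ x ∧ x < q + h}} ∩ H := by
    ext ω
    refine and_congr_right fun hω => ?_
    show sep q n ω = S ↔ sep q n (Function.update ω m 1) = S
    rw [hsep ω hω.1]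
  have mI : MeasurableSet (cfg q ⁻¹' {η | CI η (S : Set V) (0, 0) e.1}) := cfg_meas q (CI_meas _ _ _)
  have dI : DepC (mids (S : Set V)) (cfg q ⁻¹' {η | CI η (S : Set V) (0, 0) e.1}) :=
    fun ω ω' e hx => CI.congr (cfg_congr e) hx
  have mJ' : MeasurableSet {ω : Om | ω m ∈ {x | q ≤ x ∧ x < q + h}} :=
    (measurable_pi_apply m : Measurable fun ω : Om => ω m) mJ
  rw [pi_indep mI (mJ'.inter (sep_meas q n S)) dI (T := (mids (S : Set V))ᶜ) _ disjoint_compl_right, eq,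
    pi_coord_indep m mJ mH dH, base_Ico hq (by linarith) h1]
  · have hsub : (PI V).real {ω | sep q n ω = S} ≤ (PI V).real H := by
      refine measureReal_mono fun ω hω => ?_
      have hω : sep q n ω = S := hω
      show sep q n (Function.update ω m 1) = S
      rw [hsep ω, hω]
      by_contra hlt
      push Not at hlt
      -- then e.2 is connected to the boundary and so is e.1
      have m1 := mem_sep.1 (hω ▸ he1 : e.1 ∈ sep q n ω)
      have n1 : nrm e.1 < n := by
        by_contra hc
        exact m1.2 ⟨e.1, by omega, CI.refl (mem_BB.2 m1.1)⟩
      have n2 : nrm e.2 ≤ n := by have := lip_nrm _ _ he3; omega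
      have m2 : e.2 ∉ sep q n ω := hω ▸ he2
      rw [mem_sep] at m2
      have : toB q n ω e.2 := by by_contra hc; exact m2 ⟨n2, hc⟩
      obtain ⟨v, hv, hv'⟩ := this
      exact m1.2 ⟨v, hv, ((CI.refl (mem_BB.2 m1.1)).tail (ostep_cfg.2 ⟨he3, hlt⟩) hv'.mem_left).trans hv'⟩
    have h0 : 0 ≤ (PI V).real (cfg q ⁻¹' {η | CI η (S : Set V) (0, 0) e.1}) := measureReal_nonneg
    have := mul_le_mul_of_nonneg_left hsub (mul_nonneg hh h0)
    linarith
  · refine DepC.inter ?_ sep_dep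
    intro ω ω' h' hx
    have hx : ω m ∈ {x | q ≤ x ∧ x < q + h} := hx
    rw [h' m (fun hm' => he2 ((mem_mids he3).1 hm').2)] at hx
    exact hx

open Classical in
lemma u_step (n : ℕ) : ∃ K : ℝ, 0 ≤ K ∧ ∀ q h : ℝ, 0 ≤ q → 0 ≤ h → q + h ≤ 1 →
    (∀ S : Finset V, ((0, 0) : V) ∈ S → 1 ≤ phi q S) → uP n (q + h) ≤ uP n q * (1 - h) + K * h ^ 2 := by
  let Ix : Finset (Σ _ : Finset V, V × V) := ((Bf n).powerset.filter fun S => ((0, 0) : V) ∈ S).sigma fun S => bd S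
  let M : Finset (V × V) := (((Bf n ×ˢ Bf n).image fun e => e.1 + e.2) ×ˢ ((Bf n ×ˢ Bf n).image fun e => e.1 + e.2)).filter
    fun e => e.1 ≠ e.2
  refine ⟨(Ix.card : ℝ) * M.card, by positivity, fun q h hq hh h1 hφ => ?_⟩
  let J : V → Set Om := fun m => {ω | ω m ∈ {x | q ≤ x ∧ x < q + h}}
  have mJ0 : MeasurableSet {x : ℝ | q ≤ x ∧ x < q + h} := measurableSet_Ico
  have mJ : ∀ m, MeasurableSet (J m) := fun m => (measurable_pi_apply m : Measurable fun ω : Om => ω m) mJ0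
  let Bad : Set Om := ⋃ e ∈ M, J e.1 ∩ J e.2
  have mBad : MeasurableSet Bad := Finset.measurableSet_biUnion _ fun e _ => (mJ _).inter (mJ _)
  let G : (Σ _ : Finset V, V × V) → Set Om := fun i => cfg q ⁻¹' {η | CI η i.1 (0, 0) i.2.1} ∩ (J (i.2.1 + i.2.2) ∩ {ω | sep q n ω = i.1})
  have mG : ∀ i, MeasurableSet (G i) := fun i => (cfg_meas q (CI_meas _ _ _)).inter ((mJ _).inter (sep_meas _ _ _))
  have hBad : (PI V).real Bad ≤ M.card * h ^ 2 := by
    refine (measureReal_biUnion_finset_le _ _).trans ?_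
    refine (Finset.sum_le_card_nsmul _ _ (h ^ 2) fun e he => ?_).trans (by rw [nsmul_eq_mul])
    have hne : e.1 ≠ e.2 := (Finset.mem_filter.1 he).2
    have : (PI V).real (J e.1 ∩ J e.2) = h * (PI V).real (J e.2) := by
      rw [pi_coord_indep e.1 mJ0 (mJ e.2), base_Ico hq (by linarith) h1]
      · ring
      · intro ω ω' h' hx
        have hx : ω e.2 ∈ {x | q ≤ x ∧ x < q + h} := hx
        rw [h' e.2 (fun h => hne h.symm)] at hx
        exact hx
    rw [this, pi_coord e.2 mJ0, base_Ico hq (by linarith) h1]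
    apply le_of_eq; ring
  -- facts about members
  have fact : ∀ i ∈ Ix, ∀ ω ∈ G i, nrm i.2.2 ≤ n ∧ nrm i.2.1 ≤ n := by
    rintro ⟨S, e⟩ hi ω ⟨_, _, hω⟩
    simp only [Ix, Finset.mem_sigma, Finset.mem_filter] at hi
    obtain ⟨he1, he2, he3⟩ := mem_bd.1 hi.2
    have hω : sep q n ω = S := hω
    have m1 := mem_sep.1 (hω ▸ he1 : e.1 ∈ sep q n ω)
    have n1 : nrm e.1 < n := by
      by_contra hc
      exact m1.2 ⟨e.1, by omega, CI.refl (mem_BB.2 m1.1)⟩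
    have n2 : nrm e.2 ≤ n := by have := lip_nrm _ _ he3; omega
    exact ⟨n2, m1.1⟩
  have disj : Set.PairwiseDisjoint (Ix : Set (Σ _ : Finset V, V × V)) fun i => G i \ Bad := by
    rintro ⟨S, e⟩ hi ⟨S', e'⟩ hi' hne
    rw [Function.onFun, Set.disjoint_left]
    rintro ω ⟨hg, hb⟩ ⟨hg', _⟩
    have f := fact _ hi ω hg
    have f' := fact _ hi' ω hg'
    have s1 : sep q n ω = S := hg.2.2
    have s2 : sep q n ω = S' := hg'.2.2
    have : S = S' := s1.symm.trans s2
    subst this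
    simp only [Ix, Finset.coe_sigma, Set.mem_sigma_iff, Finset.mem_coe] at hi hi'
    obtain ⟨he1, he2, he3⟩ := mem_bd.1 hi.2
    obtain ⟨he1', he2', he3'⟩ := mem_bd.1 hi'.2
    have hm : e.1 + e.2 ≠ e'.1 + e'.2 := by
      intro hm
      rcases mid_inj he3 he3' hm with ⟨a, b⟩ | ⟨a, b⟩
      · exact hne (by rw [Prod.ext a b])
      · exact he2' (a ▸ he1)
    apply hb
    simp only [Bad, Set.mem_iUnion]
    refine ⟨(e.1 + e.2, e'.1 + e'.2), ?_, hg.2.1, hg'.2.1⟩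
    simp only [M, Finset.mem_filter, Finset.mem_product, Finset.mem_image]
    exact ⟨⟨⟨e, ⟨mem_Bf.2 f.2, mem_Bf.2 f.1⟩, rfl⟩, ⟨e', ⟨mem_Bf.2 f'.2, mem_Bf.2 f'.1⟩, rfl⟩⟩, hm⟩
  have sub : (⋃ i ∈ Ix, G i \ Bad) ⊆ {ω | ¬ toB q n ω (0, 0)} \ {ω | ¬ toB (q + h) n ω (0, 0)} := by
    intro ω hω
    simp only [Set.mem_iUnion] at hω
    obtain ⟨⟨S, e⟩, hi, hg, _⟩ := hω
    have f := fact _ hi ω hg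
    obtain ⟨hc, hJ, hs⟩ := hg
    have hs : sep q n ω = S := hs
    have hc : CI (cfg q ω) S (0, 0) e.1 := hc
    have hJ : q ≤ ω (e.1 + e.2) ∧ ω (e.1 + e.2) < q + h := hJ
    simp only [Ix, Finset.mem_sigma, Finset.mem_filter] at hi
    obtain ⟨he1, he2, he3⟩ := mem_bd.1 hi.2
    have m0 : ((0, 0) : V) ∈ sep q n ω := hs ▸ hi.1.2
    refine ⟨(mem_sep.1 m0).2, fun hn => hn ?_⟩
    have m2 : e.2 ∉ sep q n ω := hs ▸ he2
    rw [mem_sep] at m2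
    have : toB q n ω e.2 := by by_contra hc; exact m2 ⟨f.1, hc⟩
    obtain ⟨v, hv, hv'⟩ := toB_mono (by linarith : q ≤ q + h) this
    have hSB : (S : Set V) ⊆ BB n := fun x hx => mem_BB.2 (mem_sep.1 (hs ▸ hx : x ∈ sep q n ω)).1
    exact ⟨v, hv, (((hc.mono hSB).mono_cfg (cfg_mono (by linarith : q ≤ q + h) ω)).tail (ostep_cfg.2 ⟨he3, hJ.2⟩) hv'.mem_left).trans hv'⟩
  have s1 : ∑ i ∈ Ix, (PI V).real (G i \ Bad) ≤ uP n q - uP n (q + h) := by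
    rw [← measureReal_biUnion_finset disj (fun i _ => (mG i).diff mBad)]
    refine (measureReal_mono sub (measure_ne_top _ _)).trans (le_of_eq ?_)
    rw [measureReal_diff]
    · rfl
    · intro ω hω h'; exact hω (toB_mono (by linarith) h')
    · exact (toB_meas _ _ _).compl
  have s2 : ∀ i ∈ Ix, (PI V).real (G i) - M.card * h ^ 2 ≤ (PI V).real (G i \ Bad) := by
    intro i _
    have := le_measureReal_diff (μ := PI V) (s₁ := G i) (s₂ := Bad) (h := measure_ne_top _ _)
    linarith
  have s3 : h * uP n q ≤ ∑ i ∈ Ix, (PI V).real (G i) := by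
    have e1 : uP n q = ∑ S ∈ (Bf n).powerset.filter (fun S => ((0, 0) : V) ∈ S), (PI V).real {ω | sep q n ω = S} := by
      rw [← measureReal_biUnion_finset]
      · rw [uP]; congr 1
        ext ω
        simp only [Set.mem_iUnion, Finset.mem_filter, Finset.mem_powerset, Set.mem_ofPred_eq]
        constructor
        · intro h; exact ⟨_, ⟨Finset.filter_subset _ _, mem_sep.2 ⟨by simp [nrm], h⟩⟩, rfl⟩
        · rintro ⟨S, ⟨_, h⟩, rfl⟩; exact (mem_sep.1 h).2
      · intro C _ C' _ hne
        rw [Function.onFun, Set.disjoint_left]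
        rintro ω h h'
        exact hne (h.symm.trans h')
      · intro C _; exact sep_meas _ _ _
    rw [e1, Finset.mul_sum, Finset.sum_sigma]
    refine Finset.sum_le_sum fun S hS => ?_
    have hφS := hφ S (Finset.mem_filter.1 hS).2
    rw [phi] at hφS
    set tot := ∑ e ∈ bd S, (PI V).real (cfg q ⁻¹' {η | CI η S (0, 0) e.1}) with htot
    have h0 : 0 ≤ tot := Finset.sum_nonneg fun _ _ => measureReal_nonneg
    have h1' : 1 ≤ tot := by nlinarith
    calc h * (PI V).real {ω | sep q n ω = S} ≤ h * (PI V).real {ω | sep q n ω = S} * tot :=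
          le_mul_of_one_le_right (mul_nonneg hh measureReal_nonneg) h1'
      _ = ∑ e ∈ bd S, h * ((PI V).real {ω | sep q n ω = S} * (PI V).real (cfg q ⁻¹' {η | CI η S (0, 0) e.1})) := by
          rw [htot, Finset.mul_sum]; exact Finset.sum_congr rfl fun e _ => by ring
      _ ≤ _ := Finset.sum_le_sum fun e he => G_prob hq hh h1 he
  have s4 := Finset.sum_le_sum s2
  rw [Finset.sum_sub_distrib, Finset.sum_const, nsmul_eq_mul] at s4
  nlinarith

end DaC


namespace DaC

/-! ## Part 2f: exponential decay, conclusion -/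

lemma phi_mono {p q : ℝ} (h0 : 0 ≤ p) (h : p ≤ q) (S : Finset V) : phi p S ≤ phi q S := by
  unfold phi
  refine mul_le_mul h (Finset.sum_le_sum fun e _ => ?_) (Finset.sum_nonneg fun _ _ => measureReal_nonneg) (h0.trans h)
  exact measureReal_mono (fun ω hω => CI.mono_cfg (cfg_mono h ω) hω) (measure_ne_top _ _)

lemma uP_nonneg (n : ℕ) (q : ℝ) : 0 ≤ uP n q := measureReal_nonneg
lemma uP_le_one (n : ℕ) (q : ℝ) : uP n q ≤ 1 := measureReal_le_one

lemma u_bound {p : ℝ} (h0 : 0 ≤ p) (hp : p < 1 / 2) (hφ : ∀ S : Finset V, ((0, 0) : V) ∈ S → 1 ≤ phi p S) (n : ℕ) :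
    uP n (1 / 2) ≤ Real.exp (-(1 / 2 - p)) := by
  obtain ⟨K, hK, hs⟩ := u_step n
  set d := 1 / 2 - p with hd
  have key : ∀ N : ℕ, 1 ≤ N → uP n (1 / 2) ≤ Real.exp (-d) + K * d ^ 2 * (1 / (N : ℝ)) := by
    intro N hN
    have hN' : (1 : ℝ) ≤ N := by exact_mod_cast hN
    set h := d / N with hh
    have h_nonneg : 0 ≤ h := div_nonneg (by linarith) (by linarith)
    have hNh : N * h = d := by rw [hh]; field_simp
    have it : ∀ k : ℕ, k ≤ N → uP n (p + k * h) ≤ Real.exp (-(k * h)) + k * (K * h ^ 2) := by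
      intro k
      induction k with
      | zero => intro _; simpa using uP_le_one n p
      | succ k ih =>
        intro hk
        have ih := ih (by omega)
        have hk' : ((k : ℝ) + 1) ≤ N := by exact_mod_cast hk
        have hkh : ((k : ℝ) + 1) * h ≤ d := by rw [← hNh]; exact mul_le_mul_of_nonneg_right hk' h_nonneg
        have kn : (0 : ℝ) ≤ k * h := mul_nonneg (Nat.cast_nonneg k) h_nonneg
        have st := hs (p + k * h) h (by linarith) h_nonneg (by nlinarith)
          fun S hS => (hφ S hS).trans (phi_mono h0 (by linarith) S)
        have e : p + ((k + 1 : ℕ) : ℝ) * h = p + k * h + h := by push_cast; ring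
        rw [e]
        have ex : Real.exp (-(((k + 1 : ℕ) : ℝ) * h)) = Real.exp (-(k * h)) * Real.exp (-h) := by
          rw [← Real.exp_add]; congr 1; push_cast; ring
        rw [ex]
        have e1 : 1 - h ≤ Real.exp (-h) := by have := Real.add_one_le_exp (-h); linarith
        have h1 : 0 ≤ 1 - h := by nlinarith
        have a1 : uP n (p + k * h) * (1 - h) ≤ (Real.exp (-(k * h)) + k * (K * h ^ 2)) * (1 - h) :=
          mul_le_mul_of_nonneg_right ih h1
        have a2 : Real.exp (-(k * h)) * (1 - h) ≤ Real.exp (-(k * h)) * Real.exp (-h) :=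
          mul_le_mul_of_nonneg_left e1 (Real.exp_pos _).le
        have a3 : k * (K * h ^ 2) * (1 - h) ≤ k * (K * h ^ 2) :=
          mul_le_of_le_one_right (by positivity) (by linarith)
        push_cast
        nlinarith
    have := it N le_rfl
    rw [hNh] at this
    have e1 : p + d = 1 / 2 := by rw [hd]; ring
    have e2 : N * (K * h ^ 2) = K * d ^ 2 * (1 / (N : ℝ)) := by
      rw [hh]; field_simp
    rw [e1, e2] at this
    exact this
  have lim : Filter.Tendsto (fun N : ℕ => Real.exp (-d) + K * d ^ 2 * (1 / (N : ℝ))) Filter.atTop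
      (nhds (Real.exp (-d) + K * d ^ 2 * 0)) :=
    (tendsto_one_div_atTop_nhds_zero_nat.const_mul _).const_add _
  rw [mul_zero, add_zero] at lim
  exact ge_of_tendsto lim (Filter.eventually_atTop.2 ⟨1, key⟩)

/-- Doubled picture of a configuration. -/
def dbl (t : V) (η : EdgeCfg) (R : Set V) : Set V :=
  {x | (∃ a ∈ R, x = a + a + t) ∨ ∃ a ∈ R, ∃ b ∈ R, ostep η a b ∧ x = a + b + t}

lemma dbl_SC {t : V} {η : EdgeCfg} {R : Set V} {u v : V} (h : CI η R u v) :
    SC (dbl t η R) (u + u + t) (v + v + t) := by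
  obtain ⟨h1, h2⟩ := h
  induction h2 with
  | refl => exact SC.refl (Or.inl ⟨u, h1, rfl⟩)
  | @tail b c _ hbc ih =>
    have hadj := (sqAdj_iff).1 hbc.1.1
    have m1 : b + c + t ∈ dbl t η R := Or.inr ⟨b, hbc.2.1, c, hbc.2.2, hbc.1, rfl⟩
    have m2 : c + c + t ∈ dbl t η R := Or.inl ⟨c, hbc.2.2, rfl⟩
    refine ih.trans (SC.trans (SC.step ih.mem_right m1 ?_) (SC.step m1 m2 ?_)) <;>
    · rw [sqAdj_iff]; simp only [Prod.fst_add, Prod.snd_add]; omega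

noncomputable def dcfg (ω : Om) : EdgeCfg := ofMid fun m => !(thr (1 / 2) ω (m + (1, 1)))

lemma dcfg_iff {ω : Om} {a b : V} : dcfg ω a b = true ↔ SqAdj a b ∧ ¬ ω (a + b + (1, 1)) < 1 / 2 := by
  simp [dcfg, ofMid, thr, boolOf]

lemma base_bool : base.map (fun x => boolOf (x < 1 / 2)) = base.map (fun x => !boolOf (x < 1 / 2)) := by
  have m1 : Measurable fun x : ℝ => boolOf (x < 1 / 2) := boolOf_meas (measurableSet_Iio)
  have m2 : Measurable fun x : ℝ => !boolOf (x < 1 / 2) := (measurable_from_top (f := Bool.not)).comp m1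
  have b1 : base.real {x | x < 1 / 2} = 1 / 2 := base_lt (by norm_num) (by norm_num)
  have b2 : base.real {x : ℝ | x < 1 / 2}ᶜ = 1 / 2 := by
    rw [measureReal_compl (show MeasurableSet {x : ℝ | x < 1 / 2} from measurableSet_Iio), b1]; simp; norm_num
  haveI := Measure.isProbabilityMeasure_map (μ := base) m1.aemeasurable
  haveI := Measure.isProbabilityMeasure_map (μ := base) m2.aemeasurable
  refine Measure.ext_of_singleton fun b => ?_
  rw [← ENNReal.toReal_eq_toReal_iff' (measure_ne_top _ _) (measure_ne_top _ _)]
  change Measure.real _ _ = Measure.real _ _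
  rw [map_measureReal_apply m1 (measurableSet_singleton _), map_measureReal_apply m2 (measurableSet_singleton _)]
  have e1 : (fun x : ℝ => boolOf (x < 1 / 2)) ⁻¹' {true} = {x | x < 1 / 2} := by ext x; simp [boolOf]
  have e2 : (fun x : ℝ => boolOf (x < 1 / 2)) ⁻¹' {false} = {x | x < 1 / 2}ᶜ := by ext x; simp [boolOf]
  have e3 : (fun x : ℝ => !boolOf (x < 1 / 2)) ⁻¹' {false} = {x | x < 1 / 2} := by ext x; simp [boolOf]
  have e4 : (fun x : ℝ => !boolOf (x < 1 / 2)) ⁻¹' {true} = {x | x < 1 / 2}ᶜ := by ext x; simp [boolOf]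
  cases b
  · rw [e2, e3, b1, b2]
  · rw [e1, e4, b1, b2]

lemma dcfg_law : (PI V).map dcfg = bond (1 / 2) := by
  have m1 : Measurable fun x : ℝ => boolOf (x < 1 / 2) := boolOf_meas (measurableSet_Iio)
  have m2 : Measurable fun x : ℝ => !boolOf (x < 1 / 2) := (measurable_from_top (f := Bool.not)).comp m1
  have l1 : (PI V).map (fun ω m => boolOf (ω m < 1 / 2)) = Measure.infinitePi fun _ : V => base.map (fun x => boolOf (x < 1 / 2)) :=
    (Measure.infinitePi_map_pi (μ := fun _ : V => base) (f := fun _ x => boolOf (x < 1 / 2)) fun _ => m1)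
  have l2 : (PI V).map (fun ω m => !boolOf (ω m < 1 / 2)) = Measure.infinitePi fun _ : V => base.map (fun x => !boolOf (x < 1 / 2)) :=
    (Measure.infinitePi_map_pi (μ := fun _ : V => base) (f := fun _ x => !boolOf (x < 1 / 2)) fun _ => m2)
  have mm2 : Measurable (fun (ω : Om) (m : V) => !boolOf (ω m < 1 / 2)) :=
    measurable_pi_lambda _ fun m => m2.comp (measurable_pi_apply m)
  have e1 : dcfg = ofMid ∘ (fun (ω : Om) m => !boolOf (ω m < 1 / 2)) ∘ (fun ω k => ω (k + (1, 1))) := rfl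
  have e2 : cfg (1 / 2) = ofMid ∘ (fun (ω : Om) m => boolOf (ω m < 1 / 2)) := rfl
  rw [bond, e1, e2, ← Measure.map_map ofMid_meas (mm2.comp (by fun_prop)), ← Measure.map_map mm2 (by fun_prop),
    pi_reindex (add_left_injective ((1, 1) : V)), l2, ← base_bool, ← l1]
  exact Measure.map_map ofMid_meas (thr_meas (1 / 2))

lemma dcfg_meas : Measurable dcfg := by
  have m1 : Measurable fun x : ℝ => boolOf (x < 1 / 2) := boolOf_meas (measurableSet_Iio)
  have m2 : Measurable fun x : ℝ => !boolOf (x < 1 / 2) := (measurable_from_top (f := Bool.not)).comp m1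
  refine ofMid_meas.comp (measurable_pi_lambda _ fun m => m2.comp (measurable_pi_apply (m + (1, 1))))

lemma no_both (n : ℕ) (ω : Om) (h1 : cfg (1 / 2) ω ∈ LR 0 (2 * n) 0 n) (h2 : dcfg ω ∈ TB 0 (2 * n - 1) (-1) n) : False := by
  obtain ⟨u, hu, v, hv, h⟩ := h1
  obtain ⟨w, hw, z, hz, h'⟩ := h2
  have hu : u.1 ≤ 0 := hu
  have hv : 2 * (n : ℤ) ≤ v.1 := hv
  have hw : w.2 ≤ -1 := hw
  have hz : (n : ℤ) ≤ z.2 := hz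
  have s1 := dbl_SC (t := (0, 0)) h
  have s2 := dbl_SC (t := (1, 1)) h'
  obtain ⟨x, hx, hx'⟩ := cross_lemma (a := 0) (b := 4 * n) (c := 0) (d := 2 * n) s1 s2 (by
      rintro x (⟨a, ha, rfl⟩ | ⟨a, ha, b, hb, _, rfl⟩)
      · simp only [bx, Set.mem_ofPred_eq, Prod.fst_add, Prod.snd_add] at *; omega
      · simp only [bx, Set.mem_ofPred_eq, Prod.fst_add, Prod.snd_add] at *; omega) (by
      rintro x (⟨a, ha, rfl⟩ | ⟨a, ha, b, hb, _, rfl⟩)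
      · simp only [bx, Set.mem_ofPred_eq, Prod.fst_add, Prod.snd_add] at *; omega
      · simp only [bx, Set.mem_ofPred_eq, Prod.fst_add, Prod.snd_add] at *; omega)
    (by simp only [Prod.fst_add, Prod.snd_add]; omega) (by simp only [Prod.fst_add, Prod.snd_add]; omega)
    (by simp only [Prod.fst_add, Prod.snd_add]; omega) (by simp only [Prod.fst_add, Prod.snd_add]; omega)
  rcases hx with ⟨a, ha, ex⟩ | ⟨a, ha, b, hb, ho, ex⟩ <;> rcases hx' with ⟨a', ha', ex'⟩ | ⟨a', ha', b', hb', ho', ex'⟩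
  · have := congrArg Prod.fst (ex.symm.trans ex')
    simp only [Prod.fst_add, Prod.snd_add] at this; omega
  · have h1 := congrArg Prod.fst (ex.symm.trans ex')
    have h2 := congrArg Prod.snd (ex.symm.trans ex')
    have := sqAdj_iff.1 ho'.1
    simp only [Prod.fst_add, Prod.snd_add] at h1 h2; omega
  · have h1 := congrArg Prod.fst (ex.symm.trans ex')
    have h2 := congrArg Prod.snd (ex.symm.trans ex')
    have := sqAdj_iff.1 ho.1
    simp only [Prod.fst_add, Prod.snd_add] at h1 h2; omega
  · have h1 := (ostep_cfg.1 ho).2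
    have h2 := (dcfg_iff.1 ho'.2.1).2
    have e0 : a + b + ((0, 0) : V) = a + b := add_zero _
    rw [e0] at ex
    rw [← ex', ex] at h2
    exact h2 h1

lemma phi_small {p : ℝ} (h0 : 0 ≤ p) (hp : p < 1 / 2) : ∃ S : Finset V, ((0, 0) : V) ∈ S ∧ phi p S < 1 := by
  by_contra hc
  push Not at hc
  have hb := bond_perc (q := 1 / 2) (by norm_num) (by norm_num)
  have hub := u_bound h0 hp hc
  have hθ : 0 < 1 - Real.exp (-(1 / 2 - p)) := by
    have : Real.exp (-(1 / 2 - p)) < 1 := Real.exp_lt_one_iff.2 (by linarith)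
    linarith
  obtain ⟨n, -, hn, hh⟩ := hb.long_to_one (bond_mix (1 / 2)) tendsto_const_nhds hθ (by
    intro n
    have : {ω | ¬ toB (1 / 2) n ω (0, 0)} = (cfg (1 / 2) ⁻¹' Ev (BB n) {(0, 0)} {v | (n : ℤ) ≤ nrm v})ᶜ := by
      ext ω; simp [toB, Ev]
    have hu := hub n
    rw [uP, this, measureReal_compl (cfg_meas _ (Ev_meas _ _ _)), ← bond_real _ (Ev_meas _ _ _)] at hu
    simp at hu
    simp
    linarith) (1 / 4) (by norm_num) 0
  have h2 : 3 / 4 < (bond (1 / 2)).real (TB 0 (2 * n - 1) (-1) n) := by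
    rw [hb.TB_eq]
    have := hb.hP_anti (w := n - -1) (w' := 2 * n) (h := 2 * n - 1 - 0) (h' := n) (by omega) (by omega) (by omega)
    linarith
  have mT : MeasurableSet (TB 0 (2 * n - 1) (-1) n) := Ev_meas _ _ _
  have mL : MeasurableSet (LR 0 (2 * n) 0 n) := Ev_meas _ _ _
  rw [← dcfg_law, map_measureReal_apply dcfg_meas mT] at h2
  rw [hP, bond_real _ mL] at hh
  have hd : Disjoint (cfg (1 / 2) ⁻¹' LR 0 (2 * n) 0 n) (dcfg ⁻¹' TB 0 (2 * n - 1) (-1) n) := by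
    rw [Set.disjoint_left]; exact fun ω a b => no_both n ω a b
  have := measureReal_union (μ := PI V) hd (dcfg_meas mT)
  have h1 : (PI V).real (cfg (1 / 2) ⁻¹' LR 0 (2 * n) 0 n ∪ dcfg ⁻¹' TB 0 (2 * n - 1) (-1) n) ≤ 1 := measureReal_le_one
  linarith

theorem decay {p : ℝ} (h0 : 0 ≤ p) (hp : p < 1 / 2) :
    ∃ K : ℝ, 0 ≤ K ∧ ∀ n : ℕ, 1 ≤ n → armP p n ≤ K / (n : ℝ) ^ 3 := by
  obtain ⟨S, hS, hφ⟩ := phi_small h0 hp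
  exact armP_decay h0 (by linarith) hS hφ

end DaC


namespace DaC

/-! ## Part 3a: clusters, representatives, colours -/

/-- Connection in the graph of open edges. -/
def jn (β : V → Bool) (u v : V) : Prop := CI (ofMid β) Set.univ u v

lemma ostep_ofMid {β : V → Bool} {a b : V} : ostep (ofMid β) a b ↔ SqAdj a b ∧ β (a + b) = true := by
  simp only [ostep, ofMid, Bool.and_eq_true, boolOf_iff, add_comm b a]
  constructor
  · rintro ⟨h, ⟨_, h2⟩, _⟩; exact ⟨h, h2⟩
  · rintro ⟨h, h2⟩; exact ⟨h, ⟨h, h2⟩, h.symm, h2⟩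

lemma conn_iff {β : V → Bool} {u v : V} : Conn (ofMid β) u v ↔ jn β u v := by
  constructor
  · intro h
    refine ⟨Set.mem_univ _, rtg_mono (fun a b h => ⟨?_, Set.mem_univ _, Set.mem_univ _⟩) h⟩
    rw [ostep_ofMid]
    simpa [ofMid, boolOf_iff] using h
  · intro h
    exact rtg_mono (fun a b h => h.1.2.1) h.2

lemma jn.refl (β : V → Bool) (u : V) : jn β u u := CI.refl (Set.mem_univ u)
lemma jn.symm {β : V → Bool} {u v : V} (h : jn β u v) : jn β v u := CI.symm h
lemma jn.trans {β : V → Bool} {u v w : V} (h : jn β u v) (h' : jn β v w) : jn β u w := CI.trans h h'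
lemma jn.edge {β : V → Bool} {a b : V} (h : SqAdj a b) (h' : β (a + b) = true) : jn β a b :=
  CI.tail (CI.refl (Set.mem_univ a)) (ostep_ofMid.2 ⟨h, h'⟩) (Set.mem_univ b)
lemma jn.mono {β β' : V → Bool} (h : ∀ m, β m = true → β' m = true) {u v : V} (h' : jn β u v) : jn β' u v := by
  refine CI.mono_cfg (fun a b => ?_) h'
  simp only [ofMid, Bool.and_eq_true]
  exact fun k => ⟨k.1, h _ k.2⟩
lemma jn.induct {β : V → Bool} {u v : V} (h : jn β u v) {P : V → Prop} (h0 : P u)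
    (hs : ∀ a b, jn β u a → P a → SqAdj a b → β (a + b) = true → P b) : P v := by
  obtain ⟨h1, h2⟩ := h
  induction h2 with
  | refl => exact h0
  | @tail a b hua hab ih =>
    have := ostep_ofMid.1 hab.1
    exact hs a b ⟨h1, hua⟩ ih this.1 this.2

noncomputable def rp (β : V → Bool) (v : V) : V := clusterRep (ofMid β) v

lemma rp_prop (β : V → Bool) (v : V) : jn β v (rp β v) ∧ ∀ w, jn β v w → Encodable.encode (rp β v) ≤ Encodable.encode w := by
  have hne : (Encodable.encode '' pCluster (ofMid β) v).Nonempty := ⟨_, v, Relation.ReflTransGen.refl, rfl⟩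
  obtain ⟨w, hw, e⟩ := Nat.sInf_mem hne
  have hr : rp β v = w := by
    unfold rp clusterRep
    rw [← e, Encodable.encodek]; rfl
  rw [hr]
  refine ⟨conn_iff.1 hw, fun w' h' => ?_⟩
  rw [e]
  exact Nat.sInf_le ⟨w', conn_iff.2 h', rfl⟩

lemma rp_jn (β : V → Bool) (v : V) : jn β v (rp β v) := (rp_prop β v).1

lemma rp_spec {β : V → Bool} {v w : V} :
    rp β v = w ↔ jn β v w ∧ ∀ w', jn β v w' → Encodable.encode w ≤ Encodable.encode w' := by
  constructor
  · rintro rfl; exact rp_prop β v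
  · rintro ⟨h1, h2⟩
    have h := rp_prop β v
    exact Encodable.encode_injective (le_antisymm (h.2 _ h1) (h2 _ h.1))

lemma rp_congr {β β' : V → Bool} {v : V} (h : ∀ w, jn β v w ↔ jn β' v w) : rp β v = rp β' v := by
  rw [rp_spec]
  have := rp_prop β' v
  exact ⟨(h _).2 this.1, fun w' hw => this.2 _ ((h _).1 hw)⟩

lemma rp_eq_iff {β : V → Bool} {v w : V} : rp β v = rp β w ↔ jn β v w := by
  constructor
  · intro h
    exact (rp_jn β v).trans (h ▸ (rp_jn β w).symm)
  · intro h
    rw [rp_spec]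
    have := rp_prop β w
    exact ⟨h.trans this.1, fun w' hw => this.2 _ (h.symm.trans hw)⟩

lemma jn_meas (u v : V) : MeasurableSet {β : V → Bool | jn β u v} := ofMid_meas (CI_meas Set.univ u v)

lemma rp_meas_set (v w : V) : MeasurableSet {β : V → Bool | rp β v = w} := by
  have : {β : V → Bool | rp β v = w} = {β | jn β v w} ∩ ⋂ w' : V, {β | jn β v w' → Encodable.encode w ≤ Encodable.encode w'} := by
    ext β; simp only [Set.mem_ofPred_eq, Set.mem_inter_iff, Set.mem_iInter]; exact rp_spec
  rw [this]
  refine (jn_meas v w).inter (MeasurableSet.iInter fun w' => ?_)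
  by_cases h : Encodable.encode w ≤ Encodable.encode w'
  · simp [h]
  · simp only [h, imp_false]; exact (jn_meas v w').compl

/-- Restricted edge configuration. -/
noncomputable def bt (F : Set V) (p : ℝ) (ω : Om) : V → Bool := fun m => boolOf (m ∈ F) && thr p ω m

lemma bt_iff {F : Set V} {p : ℝ} {ω : Om} {m : V} : bt F p ω m = true ↔ m ∈ F ∧ ω m < p := by
  simp [bt, thr, boolOf]

lemma bt_meas (F : Set V) (p : ℝ) : Measurable (bt F p) := by
  refine measurable_pi_lambda _ fun m => ?_
  have : Measurable fun c : Bool => (boolOf (m ∈ F) && c) := measurable_from_top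
  exact this.comp ((measurable_pi_apply m).comp (thr_meas p))

lemma bt_univ (p : ℝ) (ω : Om) : bt Set.univ p ω = thr p ω := by
  ext m; simp [bt, boolOf]

open Classical in
/-- Colours, with the clusters meeting `A` forced to have the colour `c`. -/
noncomputable def colA (F A : Set V) (c : Bool) (p r : ℝ) (ω : Om × Om) : V → Bool := fun v =>
  if ∃ a ∈ A, jn (bt F p ω.1) v a then c else boolOf (ω.2 (rp (bt F p ω.1) v) < r)

lemma lab_at_meas (F : Set V) (p r : ℝ) (v : V) : MeasurableSet {ω : Om × Om | ω.2 (rp (bt F p ω.1) v) < r} := by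
  have : {ω : Om × Om | ω.2 (rp (bt F p ω.1) v) < r} =
      ⋃ w : V, {ω : Om × Om | rp (bt F p ω.1) v = w} ∩ {ω : Om × Om | ω.2 w < r} := by
    ext ω; simp
  rw [this]
  refine MeasurableSet.iUnion fun w => MeasurableSet.inter ?_ ?_
  · exact ((bt_meas F p).comp measurable_fst) (rp_meas_set v w)
  · exact ((measurable_pi_apply w).comp measurable_snd) measurableSet_Iio

lemma colA_meas (F A : Set V) (c : Bool) (p r : ℝ) : Measurable (colA F A c p r) := by
  refine measurable_pi_lambda _ fun v => ?_
  unfold colA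
  refine Measurable.ite ?_ measurable_const (boolOf_meas (lab_at_meas F p r v))
  have : {ω : Om × Om | ∃ a ∈ A, jn (bt F p ω.1) v a} = ⋃ a ∈ A, {ω : Om × Om | jn (bt F p ω.1) v a} := by
    ext ω; simp
  rw [this]
  exact MeasurableSet.biUnion (Set.to_countable _) fun a _ => ((bt_meas F p).comp measurable_fst) (jn_meas v a)

/-- Fubini for the two families of labels. -/
lemma PP_real {E : Set (Om × Om)} (hE : MeasurableSet E) :
    PP.real E = ∫ x, (PI V).real (Prod.mk x ⁻¹' E) ∂(PI V) := by
  rw [Measure.real, PP, Measure.prod_apply hE, integral_eq_lintegral_of_nonneg_ae]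
  · congr 1
    refine lintegral_congr fun x => ?_
    rw [Measure.real, ENNReal.ofReal_toReal (measure_ne_top _ _)]
  · exact Filter.Eventually.of_forall fun x => measureReal_nonneg
  · exact (measurable_measure_prodMk_left hE).ennreal_toReal.aestronglyMeasurable

lemma PP_int {E : Set (Om × Om)} (hE : MeasurableSet E) :
    Integrable (fun x => (PI V).real (Prod.mk x ⁻¹' E)) (PI V) := by
  refine Integrable.of_bound (measurable_measure_prodMk_left hE).ennreal_toReal.aestronglyMeasurable 1 ?_
  refine Filter.Eventually.of_forall fun x => ?_
  rw [Real.norm_of_nonneg measureReal_nonneg]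
  exact measureReal_le_one

lemma PP_congr {E E' : Set (Om × Om)} (hE : MeasurableSet E) (hE' : MeasurableSet E')
    (h : ∀ x, (PI V).real (Prod.mk x ⁻¹' E) = (PI V).real (Prod.mk x ⁻¹' E')) : PP.real E = PP.real E' := by
  rw [PP_real hE, PP_real hE']; simp_rw [h]

lemma PP_comb {E G H : Set (Om × Om)} (hE : MeasurableSet E) (hG : MeasurableSet G) (hH : MeasurableSet H) {r : ℝ}
    (h : ∀ x, (PI V).real (Prod.mk x ⁻¹' E) = r * (PI V).real (Prod.mk x ⁻¹' G) + (1 - r) * (PI V).real (Prod.mk x ⁻¹' H)) :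
    PP.real E = r * PP.real G + (1 - r) * PP.real H := by
  rw [PP_real hE, PP_real hG, PP_real hH, ← integral_const_mul, ← integral_const_mul, ← integral_add
    ((PP_int hG).const_mul _) ((PP_int hH).const_mul _)]
  simp_rw [h]

/-- Law of labels composed with maps having the same fibres. -/
lemma fibre_law {f1 f2 : V → V} (h : ∀ v w, f1 v = f1 w ↔ f2 v = f2 w) :
    (PI V).map (fun ω v => ω (f1 v)) = (PI V).map (fun ω v => ω (f2 v)) := by
  classical
  let R : Type := Set.range f2
  let i : R → V := fun x => x.1
  have hi : Function.Injective i := Subtype.val_injective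
  let j : R → V := fun x => f1 x.2.choose
  have hjs : ∀ x : R, f2 x.2.choose = x.1 := fun x => x.2.choose_spec
  have hj : Function.Injective j := by
    intro x y e
    have := (h _ _).1 e
    rw [hjs, hjs] at this
    exact Subtype.ext this
  let e : (R → ℝ) → Om := fun ω v => ω ⟨f2 v, v, rfl⟩
  have me : Measurable e := by fun_prop
  have e1 : (fun (ω : Om) v => ω (f1 v)) = e ∘ fun ω k => ω (j k) := by
    funext ω v
    show ω (f1 v) = ω (f1 _)
    congr 1
    exact ((h _ _).2 (hjs ⟨f2 v, v, rfl⟩)).symm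
  have e2 : (fun (ω : Om) v => ω (f2 v)) = e ∘ fun ω k => ω (i k) := rfl
  rw [e1, e2, ← Measure.map_map me (by fun_prop), ← Measure.map_map me (by fun_prop), pi_reindex hi, pi_reindex hj]

/-- Site configurations as edge configurations. -/
noncomputable def site (ξ : V → Bool) : EdgeCfg := fun a b => boolOf (SqAdj a b) && (ξ a && ξ b)

lemma site_meas : Measurable site := by
  refine measurable_pi_lambda _ fun a => measurable_pi_lambda _ fun b => ?_
  have : Measurable fun c : Bool × Bool => (boolOf (SqAdj a b) && (c.1 && c.2)) := measurable_of_countable _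
  have h2 : Measurable fun ξ : V → Bool => (ξ a, ξ b) := (measurable_pi_apply a).prodMk (measurable_pi_apply b)
  exact this.comp h2

noncomputable def col (p r : ℝ) : Om × Om → V → Bool := colA Set.univ ∅ true p r

lemma col_iff {p r : ℝ} {ω : Om × Om} {v : V} : col p r ω v = true ↔ ω.2 (rp (thr p ω.1) v) < r := by
  simp [col, colA, bt_univ, boolOf]

lemma col_eq (p r : ℝ) (ω : Om × Om) (v : V) : col p r ω v = boolOf (ω.2 (rp (thr p ω.1) v) < r) := by
  simp [col, colA, bt_univ]

lemma col_meas (p r : ℝ) : Measurable (col p r) := colA_meas _ _ _ _ _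

noncomputable def dac (p r : ℝ) : Measure EdgeCfg := PP.map (fun ω => site (col p r ω))

lemma sc_meas (p r : ℝ) : Measurable (fun ω => site (col p r ω)) := site_meas.comp (col_meas p r)

instance dac_prob (p r : ℝ) : IsProbabilityMeasure (dac p r) :=
  Measure.isProbabilityMeasure_map (sc_meas p r).aemeasurable

lemma dac_real (p r : ℝ) {A : Set EdgeCfg} (hA : MeasurableSet A) :
    (dac p r).real A = PP.real {ω | site (col p r ω) ∈ A} := map_measureReal_apply (sc_meas p r) hA

lemma jn_act {g : V ≃ V} (hg : Lat g) {j : V → V} (hj : ∀ a b, g a + g b = j (a + b)) (β : V → Bool) (u v : V) :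
    jn (fun k => β (j k)) u v ↔ jn β (g u) (g v) := by
  constructor
  · intro h
    refine h.induct (P := fun v => jn β (g u) (g v)) (jn.refl _ _) fun a b _ ih hab hb => ih.trans (jn.edge ((hg.adj a b).2 hab) ?_)
    rw [hj]; exact hb
  · intro h
    have := h.induct (P := fun w => jn (fun k => β (j k)) u (g.symm w)) (by simpa using jn.refl _ _) fun a b _ ih hab hb =>
      ih.trans (jn.edge ((hg.adj _ _).1 (by simpa using hab)) (by rw [← hj]; simpa using hb))
    simpa using this

lemma dac_inv (p r : ℝ) (g : V ≃ V) (hg : Lat g) : (dac p r).map (act g) = dac p r := by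
  obtain ⟨j, hj, e⟩ := hg.mid
  refine Measure.ext fun A hA => ?_
  haveI : IsProbabilityMeasure ((dac p r).map (act g)) := Measure.isProbabilityMeasure_map (act_meas g).aemeasurable
  rw [← ENNReal.toReal_eq_toReal_iff' (measure_ne_top _ _) (measure_ne_top _ _)]
  change Measure.real _ _ = Measure.real _ _
  rw [map_measureReal_apply (act_meas g) hA, dac_real _ _ (act_meas g hA), dac_real _ _ hA]
  have mT : Measurable fun ω : Om × Om => ((fun k => ω.1 (j k) : Om), ω.2) := by fun_prop
  have mE : MeasurableSet {ω | site (col p r ω) ∈ A} := sc_meas p r hA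
  have law : PP.map (fun ω : Om × Om => ((fun k => ω.1 (j k) : Om), ω.2)) = PP := by
    have := Measure.map_prod_map (PI V) (PI V) (f := fun ω k => ω (j k)) (g := id) (by fun_prop) measurable_id
    rw [pi_reindex hj, Measure.map_id] at this
    exact this.symm
  conv_rhs => rw [← law]
  rw [map_measureReal_apply mT mE]
  refine PP_congr (sc_meas p r (act_meas g hA)) (mT mE) fun x => ?_
  let S : Set Om := {u | site (fun v => boolOf (u v < r)) ∈ A}
  have mS : MeasurableSet S := site_meas.comp (thr_meas r) hA
  have h1 : Prod.mk x ⁻¹' {ω | site (col p r ω) ∈ act g ⁻¹' A} = (fun (ω : Om) v => ω (rp (thr p x) (g v))) ⁻¹' S := by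
    ext y
    show act g (site (col p r (x, y))) ∈ A ↔ site _ ∈ A
    have : act g (site (col p r (x, y))) = site (fun v => boolOf (y (rp (thr p x) (g v)) < r)) := by
      ext a b
      simp only [act, site, col_eq, hg.adj]
    rw [this]
  have h2 : Prod.mk x ⁻¹' ((fun ω : Om × Om => ((fun k => ω.1 (j k) : Om), ω.2)) ⁻¹' {ω | site (col p r ω) ∈ A}) =
      (fun (ω : Om) v => ω (rp (fun k => thr p x (j k)) v)) ⁻¹' S := by
    ext y
    show site (col p r (fun k => x (j k), y)) ∈ A ↔ site _ ∈ A
    have : site (col p r (fun k => x (j k), y)) = site (fun v => boolOf (y (rp (fun k => thr p x (j k)) v) < r)) := by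
      ext a b
      simp only [site, col_eq]
      rfl
    rw [this]
  rw [h1, h2, ← map_measureReal_apply (by fun_prop) mS, ← map_measureReal_apply (by fun_prop) mS, fibre_law]
  intro v w
  rw [rp_eq_iff, rp_eq_iff, jn_act hg e]

end DaC


namespace DaC

/-! ## Part 3b: positive association -/

noncomputable def DA (p r : ℝ) (F A : Set V) (c : Bool) (E : Set (V → Bool)) : ℝ :=
  PP.real {ω | colA F A c p r ω ∈ E}

lemma colA_of_not {F A : Set V} {c : Bool} {p r : ℝ} {ω : Om × Om} {v : V} (h : ¬ ∃ a ∈ A, jn (bt F p ω.1) v a) :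
    colA F A c p r ω v = boolOf (ω.2 (rp (bt F p ω.1) v) < r) := if_neg h
lemma colA_of {F A : Set V} {c : Bool} {p r : ℝ} {ω : Om × Om} {v : V} (h : ∃ a ∈ A, jn (bt F p ω.1) v a) :
    colA F A c p r ω v = c := if_pos h
lemma colA_empty {F : Set V} {c : Bool} {p r : ℝ} {ω : Om × Om} {v : V} :
    colA F ∅ c p r ω v = boolOf (ω.2 (rp (bt F p ω.1) v) < r) := if_neg (by simp)

lemma DA_split1 {p r : ℝ} (h0 : 0 ≤ r) (h1 : r ≤ 1) (F : Set V) (c : Bool) (u : V) {E : Set (V → Bool)} (hE : MeasurableSet E) :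
    DA p r F ∅ c E = r * DA p r F {u} true E + (1 - r) * DA p r F {u} false E := by
  have mm : ∀ A c, MeasurableSet {ω | colA F A c p r ω ∈ E} := fun A c => colA_meas F A c p r hE
  refine PP_comb (mm _ _) (mm _ _) (mm _ _) fun x => ?_
  have dd : ∀ c, DepC {rp (bt F p x) u}ᶜ (Prod.mk x ⁻¹' {ω | colA F {u} c p r ω ∈ E}) := by
    intro c y y' e hy
    have : colA F {u} c p r (x, y) = colA F {u} c p r (x, y') := by
      funext v
      by_cases h : jn (bt F p x) v u
      · have hh : ∃ a ∈ ({u} : Set V), jn (bt F p x) v a := ⟨u, rfl, h⟩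
        rw [colA_of (ω := (x, y)) hh, colA_of (ω := (x, y')) hh]
      · rw [colA_of_not (by simpa using h), colA_of_not (by simpa using h)]
        have : rp (bt F p x) v ≠ rp (bt F p x) u := fun h' => h (rp_eq_iff.1 h')
        simp only [e _ this]
    show colA F {u} c p r (x, y') ∈ E
    rw [← this]; exact hy
  refine pi_split (rp (bt F p x) u) h0 h1 (measurable_prodMk_left (mm _ _)) (measurable_prodMk_left (mm _ _)) (dd _) (dd _) fun y => ?_
  show colA F ∅ c p r (x, y) ∈ E ↔ (_ ∧ colA F {u} true p r (x, y) ∈ E) ∨ (_ ∧ colA F {u} false p r (x, y) ∈ E)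
  have key : ∀ b : Bool, boolOf (y (rp (bt F p x) u) < r) = b → colA F ∅ c p r (x, y) = colA F {u} b p r (x, y) := by
    intro b hb
    funext v
    rw [colA_empty]
    by_cases h : jn (bt F p x) v u
    · have hh : ∃ a ∈ ({u} : Set V), jn (bt F p x) v a := ⟨u, rfl, h⟩
      rw [colA_of (ω := (x, y)) hh, ← hb, rp_eq_iff.2 h]
    · rw [colA_of_not (by simpa using h)]
  by_cases hy : y (rp (bt F p x) u) < r
  · rw [key true (by simp [boolOf, hy])]; tauto
  · rw [key false (by simp [boolOf, hy])]; tauto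

lemma DA_split2 {p r : ℝ} (h0 : 0 ≤ p) (h1 : p ≤ 1) {F A : Set V} (c : Bool) {a b : V} (hab : SqAdj a b) (ha : a ∈ A)
    (hF : a + b ∉ F) {E : Set (V → Bool)} (hE : MeasurableSet E) :
    DA p r (insert (a + b) F) A c E = p * DA p r F (insert b A) c E + (1 - p) * DA p r F A c E := by
  set m := a + b with hm
  have mm : ∀ F A c, MeasurableSet {ω | colA F A c p r ω ∈ E} := fun F A c => colA_meas F A c p r hE
  have mJ : MeasurableSet {ω : Om × Om | ω.1 m < p} := ((measurable_pi_apply m).comp measurable_fst) measurableSet_Iio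
  have dJ : DepP {m} ∅ {ω : Om × Om | ω.1 m < p} := by
    intro ω ω' e _ h
    show ω'.1 m < p
    rw [← e m rfl]; exact h
  have dJ' : DepP {m} ∅ {ω : Om × Om | ω.1 m < p}ᶜ := by
    intro ω ω' e _ h h'
    exact h (by show ω.1 m < p; rw [e m rfl]; exact h')
  have dE : ∀ A, DepP {m}ᶜ Set.univ {ω | colA F A c p r ω ∈ E} := by
    intro A ω ω' e e' h
    have h1 : bt F p ω.1 = bt F p ω'.1 := by
      funext k
      rw [Bool.eq_iff_iff, bt_iff, bt_iff]
      refine and_congr_right fun hk => ?_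
      rw [e k (fun h => hF (h ▸ hk))]
    have h2 : ω.2 = ω'.2 := funext fun k => e' k (Set.mem_univ k)
    have : colA F A c p r ω = colA F A c p r ω' := by unfold colA; rw [h1, h2]
    show colA F A c p r ω' ∈ E
    rw [← this]; exact h
  have pJ : PP.real {ω : Om × Om | ω.1 m < p} = p := by
    have e : {ω : Om × Om | ω.1 m < p} = {x : Om | x m ∈ {t : ℝ | t < p}} ×ˢ Set.univ := by ext ω; simp
    rw [e, PP, measureReal_prod_prod, pi_coord m (show MeasurableSet {t : ℝ | t < p} from measurableSet_Iio), base_lt h0 h1]; simp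
  have pJ' : PP.real {ω : Om × Om | ω.1 m < p}ᶜ = 1 - p := by rw [measureReal_compl mJ, pJ]; simp
  have i1 := prod_indep mJ (mm F (insert b A) c) dJ (dE _) disjoint_compl_right (Set.empty_disjoint _)
  have i2 := prod_indep mJ.compl (mm F A c) dJ' (dE _) disjoint_compl_right (Set.empty_disjoint _)
  change PP.real _ = PP.real _ * PP.real _ at i1
  change PP.real _ = PP.real _ * PP.real _ at i2
  rw [pJ] at i1
  rw [pJ'] at i2
  unfold DA
  rw [← i1, ← i2, ← measureReal_union]
  · congr 1
    ext ω
    by_cases hω : ω.1 m < p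
    · have hsub : ∀ k, bt F p ω.1 k = true → bt (insert m F) p ω.1 k = true := by
        intro k; rw [bt_iff, bt_iff]; exact fun h => ⟨Or.inr h.1, h.2⟩
      have hem : bt (insert m F) p ω.1 m = true := bt_iff.2 ⟨Or.inl rfl, hω⟩
      have step : ∀ x y, SqAdj x y → bt (insert m F) p ω.1 (x + y) = true →
          bt F p ω.1 (x + y) = true ∨ (x = a ∧ y = b) ∨ (x = b ∧ y = a) := by
        intro x y hxy h
        rw [bt_iff] at h
        rcases h.1 with h' | h'
        · exact Or.inr (mid_inj hxy hab h')
        · exact Or.inl (bt_iff.2 ⟨h', h.2⟩)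
      have hT : ∀ v, (∃ a' ∈ A, jn (bt (insert m F) p ω.1) v a') ↔ ∃ a' ∈ insert b A, jn (bt F p ω.1) v a' := by
        intro v
        constructor
        · rintro ⟨a', ha', h⟩
          refine h.symm.induct (P := fun v => ∃ a' ∈ insert b A, jn (bt F p ω.1) v a') ⟨a', Or.inr ha', jn.refl _ _⟩ ?_
          rintro x y _ ⟨z, hz, hxz⟩ hxy hb
          rcases step x y hxy hb with h | ⟨rfl, rfl⟩ | ⟨rfl, rfl⟩
          · exact ⟨z, hz, (jn.edge hxy h).symm.trans hxz⟩
          · exact ⟨_, Or.inl rfl, jn.refl _ _⟩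
          · exact ⟨_, Or.inr ha, jn.refl _ _⟩
        · rintro ⟨a', ha' | ha', h⟩
          · rw [ha'] at h
            exact ⟨a, ha, (h.mono hsub).trans (jn.edge hab hem).symm⟩
          · exact ⟨a', ha', h.mono hsub⟩
      have hcol : colA (insert m F) A c p r ω = colA F (insert b A) c p r ω := by
        funext v
        by_cases h : ∃ a' ∈ insert b A, jn (bt F p ω.1) v a'
        · rw [colA_of h, colA_of ((hT v).2 h)]
        · rw [colA_of_not h, colA_of_not (fun h' => h ((hT v).1 h'))]
          have : rp (bt (insert m F) p ω.1) v = rp (bt F p ω.1) v := by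
            refine rp_congr fun w => ⟨fun hw => ?_, fun hw => hw.mono hsub⟩
            refine hw.induct (P := fun w => jn (bt F p ω.1) v w) (jn.refl _ _) ?_
            rintro x y _ hx hxy hb
            rcases step x y hxy hb with h' | ⟨rfl, rfl⟩ | ⟨rfl, rfl⟩
            · exact hx.trans (jn.edge hxy h')
            · exact absurd ⟨_, Or.inr ha, hx⟩ h
            · exact absurd ⟨_, Or.inl rfl, hx⟩ h
          rw [this]
      simp only [Set.mem_ofPred_eq, Set.mem_union, Set.mem_inter_iff, Set.mem_compl_iff, hω, hcol, true_and, not_true, false_and, or_false]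
    · have hb : bt (insert m F) p ω.1 = bt F p ω.1 := by
        funext k
        rw [Bool.eq_iff_iff, bt_iff, bt_iff]
        constructor
        · rintro ⟨rfl | h, h'⟩
          · exact absurd h' hω
          · exact ⟨h, h'⟩
        · rintro ⟨h, h'⟩; exact ⟨Or.inr h, h'⟩
      have hcol : colA (insert m F) A c p r ω = colA F A c p r ω := by unfold colA; rw [hb]
      simp only [Set.mem_ofPred_eq, Set.mem_union, Set.mem_inter_iff, Set.mem_compl_iff, hω, hcol, true_and, not_false_iff, false_and, false_or]
  · rw [Set.disjoint_left]; rintro ω h h'; exact h'.1 h.1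
  · exact mJ.compl.inter (mm _ _ _)

lemma DA_mono {p r : ℝ} {F A A' : Set V} {c c' : Bool} {E : Set (V → Bool)} (hE : IncB E)
    (h : ∀ ω v, colA F A c p r ω v = true → colA F A' c' p r ω v = true) : DA p r F A c E ≤ DA p r F A' c' E :=
  measureReal_mono (fun ω hω => hE _ _ (h ω) hω) (measure_ne_top _ _)

lemma DA_mono_true {p r : ℝ} {F A A' : Set V} (hA : A ⊆ A') {E : Set (V → Bool)} (hE : IncB E) :
    DA p r F A true E ≤ DA p r F A' true E := by
  refine DA_mono hE fun ω v h => ?_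
  by_cases h' : ∃ a ∈ A', jn (bt F p ω.1) v a
  · rw [colA_of h']
  · rw [colA_of_not h']
    rwa [colA_of_not (fun ⟨a, ha, h⟩ => h' ⟨a, hA ha, h⟩)] at h

lemma DA_mono_false {p r : ℝ} {F A A' : Set V} (hA : A ⊆ A') {E : Set (V → Bool)} (hE : IncB E) :
    DA p r F A' false E ≤ DA p r F A false E := by
  refine DA_mono hE fun ω v h => ?_
  by_cases h' : ∃ a ∈ A', jn (bt F p ω.1) v a
  · rw [colA_of h'] at h; exact absurd h (by simp)
  · rw [colA_of_not h'] at h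
    rwa [colA_of_not (fun ⟨a, ha, h⟩ => h' ⟨a, hA ha, h⟩)]

lemma DA_mono_col {p r : ℝ} {F A : Set V} {E : Set (V → Bool)} (hE : IncB E) :
    DA p r F A false E ≤ DA p r F A true E := by
  refine DA_mono hE fun ω v h => ?_
  by_cases h' : ∃ a ∈ A, jn (bt F p ω.1) v a
  · rw [colA_of h']
  · rw [colA_of_not h'] at h ⊢
    exact h

open Classical in
lemma DA_closed {p r : ℝ} {F A : Set V} (c : Bool) (h : ∀ a ∈ A, ∀ b, b ∉ A → SqAdj a b → a + b ∉ F) (E : Set (V → Bool)) :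
    DA p r F A c E = DA p r F ∅ c {ξ | (fun v => if v ∈ A then c else ξ v) ∈ E} := by
  unfold DA
  congr 1
  ext ω
  have : colA F A c p r ω = fun v => if v ∈ A then c else colA F ∅ c p r ω v := by
    funext v
    by_cases hv : v ∈ A
    · rw [if_pos hv, colA_of ⟨v, hv, jn.refl _ _⟩]
    · rw [if_neg hv, colA_of_not, colA_empty]
      rintro ⟨a, ha, hva⟩
      refine hv (hva.symm.induct (P := fun v => v ∈ A) ha fun x y _ hx hxy hb => ?_)
      by_contra hy
      exact h x hx y hy hxy (bt_iff.1 hb).1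
  show colA F A c p r ω ∈ E ↔ _ ∈ E
  rw [this]

lemma DA_noedge {p r : ℝ} {F : Set V} (c : Bool) (h : ∀ a b, SqAdj a b → a + b ∉ F) {E : Set (V → Bool)} (hE : MeasurableSet E) :
    DA p r F ∅ c E = (PI V).real (thr r ⁻¹' E) := by
  have e : {ω | colA F ∅ c p r ω ∈ E} = Set.univ ×ˢ (thr r ⁻¹' E) := by
    ext ω
    have : colA F ∅ c p r ω = thr r ω.2 := by
      funext v
      rw [colA_empty, thr]
      have : rp (bt F p ω.1) v = v :=
        (rp_jn (bt F p ω.1) v).induct (P := fun w => w = v) rfl fun x y _ _ hxy hb => absurd (bt_iff.1 hb).1 (h x y hxy)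
      rw [this]
    simp [this]
  rw [DA, e, PP, measureReal_prod_prod]; simp

lemma IncB.inter {E E' : Set (V → Bool)} (h : IncB E) (h' : IncB E') : IncB (E ∩ E') :=
  fun _ _ e hx => ⟨h _ _ e hx.1, h' _ _ e hx.2⟩

/-- Positive association for finitely many edges. -/
lemma DA_pa {p r : ℝ} (hp0 : 0 ≤ p) (hp1 : p ≤ 1) (hr0 : 0 ≤ r) (hr1 : r ≤ 1) (W : Finset V) :
    ∀ (n : ℕ) (F : Finset V), F.card = n → ∀ (A : Set V) (c : Bool) (E E' : Set (V → Bool)),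
      DepB (W : Set V) E → DepB (W : Set V) E' → IncB E → IncB E' →
      DA p r F A c E * DA p r F A c E' ≤ DA p r F A c (E ∩ E') := by
  classical
  intro n
  induction n using Nat.strong_induction_on with
  | _ n ih =>
  intro F hF
  have mE : ∀ {E : Set (V → Bool)}, DepB (W : Set V) E → MeasurableSet E := fun h => h.meas (Finset.finite_toSet W)
  -- sets with an edge leaving
  have leave : ∀ (A : Set V) (c : Bool) (a b : V), a ∈ A → SqAdj a b → a + b ∈ F → ∀ (E E' : Set (V → Bool)),
      DepB (W : Set V) E → DepB (W : Set V) E' → IncB E → IncB E' →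
      DA p r F A c E * DA p r F A c E' ≤ DA p r F A c (E ∩ E') := by
    intro A c a b ha hab hm E E' d d' i i'
    have hc : (F.erase (a + b)).card < n := by rw [← hF]; exact Finset.card_erase_lt_of_mem hm
    have hFe : (F : Set V) = insert (a + b) ((F.erase (a + b) : Finset V) : Set V) := by
      rw [← Finset.coe_insert, Finset.insert_erase hm]
    have hn : a + b ∉ ((F.erase (a + b) : Finset V) : Set V) := by simp
    have IH := ih _ hc (F.erase (a + b)) rfl
    rw [hFe, DA_split2 hp0 hp1 c hab ha hn (mE d), DA_split2 hp0 hp1 c hab ha hn (mE d'),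
      DA_split2 hp0 hp1 c hab ha hn ((mE d).inter (mE d'))]
    cases c with
    | true =>
      exact two_point hp0 hp1 (DA_mono_true (Set.subset_insert _ _) i) (DA_mono_true (Set.subset_insert _ _) i')
        (IH A true E E' d d' i i') (IH _ true E E' d d' i i')
    | false =>
      have := two_point (q := 1 - p) (by linarith) (by linarith) (DA_mono_false (p := p) (r := r) (F := ((F.erase (a + b) : Finset V) : Set V)) (Set.subset_insert b A) i)
        (DA_mono_false (p := p) (r := r) (F := ((F.erase (a + b) : Finset V) : Set V)) (Set.subset_insert b A) i')
        (IH _ false E E' d d' i i') (IH A false E E' d d' i i')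
      linarith
  have empty : ∀ (c : Bool) (E E' : Set (V → Bool)),
      DepB (W : Set V) E → DepB (W : Set V) E' → IncB E → IncB E' →
      DA p r F ∅ c E * DA p r F ∅ c E' ≤ DA p r F ∅ c (E ∩ E') := by
    intro c E E' d d' i i'
    by_cases h : ∃ a b, SqAdj a b ∧ a + b ∈ F
    · obtain ⟨a, b, hab, hm⟩ := h
      rw [DA_split1 hr0 hr1 F c a (mE d), DA_split1 hr0 hr1 F c a (mE d'), DA_split1 hr0 hr1 F c a ((mE d).inter (mE d'))]
      exact two_point hr0 hr1 (DA_mono_col i) (DA_mono_col i') (leave {a} false a b rfl hab hm E E' d d' i i')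
        (leave {a} true a b rfl hab hm E E' d d' i i')
    · push Not at h
      rw [DA_noedge c h (mE d), DA_noedge c h (mE d'), DA_noedge c h ((mE d).inter (mE d'))]
      exact harris hr0 hr1 W E E' d d' i i'
  intro A c E E' d d' i i'
  by_cases h : ∃ a ∈ A, ∃ b, SqAdj a b ∧ a + b ∈ F
  · obtain ⟨a, ha, b, hab, hm⟩ := h
    exact leave A c a b ha hab hm E E' d d' i i'
  · push Not at h
    have h' : ∀ a ∈ A, ∀ b, b ∉ A → SqAdj a b → a + b ∉ (F : Set V) := fun a ha b _ hab => h a ha b hab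
    rw [DA_closed c h', DA_closed c h', DA_closed c h']
    have dd : ∀ {E : Set (V → Bool)}, DepB (W : Set V) E → DepB (W : Set V) {ξ | (fun v => if v ∈ A then c else ξ v) ∈ E} := by
      intro E d β β' e hx
      refine d _ _ (fun v hv => ?_) hx
      simp only [e v hv]
    have ii : ∀ {E : Set (V → Bool)}, IncB E → IncB {ξ | (fun v => if v ∈ A then c else ξ v) ∈ E} := by
      intro E d β β' e hx
      refine d _ _ (fun v hv => ?_) hx
      by_cases hvA : v ∈ A
      · simpa [hvA] using hv
      · simp only [hvA, if_false] at hv ⊢; exact e v hv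
    exact empty c _ _ (dd d) (dd d') (ii i) (ii i')

lemma rp_event (p : ℝ) (x : Om) (v : V) : ∃ N0 : ℕ, ∀ N ≥ N0, rp (bt (Bf N : Set V) p x) v = rp (thr p x) v := by
  have key : ∀ w, jn (thr p x) v w → ∃ N0 : ℕ, ∀ N ≥ N0, jn (bt (Bf N : Set V) p x) v w := by
    intro w hw
    refine hw.induct (P := fun w => ∃ N0 : ℕ, ∀ N ≥ N0, jn (bt (Bf N : Set V) p x) v w) ⟨0, fun _ _ => jn.refl _ _⟩ ?_
    rintro a b _ ⟨N0, h⟩ hab hb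
    refine ⟨max N0 (nrm (a + b)).toNat, fun N hN => (h N (le_trans (le_max_left _ _) hN)).trans (jn.edge hab (bt_iff.2 ⟨?_, ?_⟩))⟩
    · have := le_trans (le_max_right N0 (nrm (a + b)).toNat) hN
      rw [Finset.mem_coe, mem_Bf]; omega
    · simpa [thr, boolOf] using hb
  obtain ⟨N0, h⟩ := key _ (rp_jn _ v)
  refine ⟨N0, fun N hN => rp_spec.2 ⟨h N hN, fun w' hw' => (rp_prop (thr p x) v).2 w' (hw'.mono fun m hm => ?_)⟩⟩
  have := (bt_iff.1 hm).2
  simpa [thr, boolOf] using this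

lemma DA_lim {p r : ℝ} (W : Finset V) {E : Set (V → Bool)} (d : DepB (W : Set V) E) :
    Filter.Tendsto (fun N : ℕ => DA p r (Bf N) ∅ true E) Filter.atTop (nhds (PP.real {ω | col p r ω ∈ E})) := by
  have mE : MeasurableSet E := d.meas (Finset.finite_toSet W)
  refine (ENNReal.tendsto_toReal (measure_ne_top _ _)).comp
    (tendsto_measure_of_ae_tendsto_indicator_of_isFiniteMeasure Filter.atTop (col_meas p r mE) (fun N => colA_meas _ _ _ _ _ mE) ?_)
  refine Filter.Eventually.of_forall fun ω => ?_
  have : ∀ v ∈ W, ∀ᶠ N : ℕ in Filter.atTop, colA (Bf N) ∅ true p r ω v = col p r ω v := by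
    intro v _
    obtain ⟨N0, h⟩ := rp_event p ω.1 v
    refine Filter.eventually_atTop.2 ⟨N0, fun N hN => ?_⟩
    rw [colA_empty, col_eq, h N hN]
  filter_upwards [(Filter.eventually_all_finset W).2 this] with N hN
  exact ⟨d _ _ hN, d _ _ fun v hv => (hN v hv).symm⟩

lemma col_pa {p r : ℝ} (hp0 : 0 ≤ p) (hp1 : p ≤ 1) (hr0 : 0 ≤ r) (hr1 : r ≤ 1) (W : Finset V) {E E' : Set (V → Bool)}
    (d : DepB (W : Set V) E) (d' : DepB (W : Set V) E') (i : IncB E) (i' : IncB E') :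
    PP.real {ω | col p r ω ∈ E} * PP.real {ω | col p r ω ∈ E'} ≤ PP.real {ω | col p r ω ∈ E ∩ E'} := by
  have dd : DepB (W : Set V) (E ∩ E') := fun β β' e hx => ⟨d β β' e hx.1, d' β β' e hx.2⟩
  exact le_of_tendsto_of_tendsto' ((DA_lim W d).mul (DA_lim W d')) (DA_lim W dd)
    fun N => DA_pa hp0 hp1 hr0 hr1 W _ (Bf N) rfl ∅ true E E' d d' i i'

lemma site_dep {W : Set V} {A : Set EdgeCfg} (h : Dep W A) : DepB W (site ⁻¹' A) := by
  intro β β' e hx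
  refine h _ _ (fun a b ha hb => ?_) hx
  simp only [site, e a ha, e b hb]

lemma dac_perc {p r : ℝ} (hp0 : 0 ≤ p) (hp1 : p ≤ 1) (hr0 : 0 ≤ r) (hr1 : r ≤ 1) : Perc (dac p r) where
  prob := inferInstance
  inv := dac_inv p r
  pa := by
    intro W A B hW dA dB iA iB
    have mA := dA.measurable hW
    have mB := dB.measurable hW
    rw [dac_real _ _ mA, dac_real _ _ mB, dac_real _ _ (mA.inter mB)]
    have ii : ∀ {A : Set EdgeCfg}, Inc A → IncB (site ⁻¹' A) := by
      intro A i β β' e hx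
      refine i _ _ (fun a b => ?_) hx
      simp only [site, Bool.and_eq_true]
      exact fun h => ⟨h.1, e _ h.2.1, e _ h.2.2⟩
    have cW : ((hW.toFinset : Finset V) : Set V) = W := hW.coe_toFinset
    exact col_pa hp0 hp1 hr0 hr1 hW.toFinset (E := site ⁻¹' A) (E' := site ⁻¹' B) (by rw [cW]; exact site_dep dA)
      (by rw [cW]; exact site_dep dB) (ii iA) (ii iB)

end DaC


namespace DaC

/-! ## Part 3c: mixing -/

lemma loc_dep {p r : ℝ} {U W : Set V} (hWU : W ⊆ U) {E : Set (V → Bool)} (d : DepB W E) :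
    DepP (mids U) U {ω | colA (mids U) ∅ true p r ω ∈ E} := by
  intro ω ω' e e' h
  have hb : bt (mids U) p ω.1 = bt (mids U) p ω'.1 := by
    funext m
    rw [Bool.eq_iff_iff, bt_iff, bt_iff]
    refine and_congr_right fun hm => ?_
    rw [e m hm]
  refine d _ _ (fun v hv => ?_) h
  rw [colA_empty, colA_empty, ← hb]
  have hr : rp (bt (mids U) p ω.1) v ∈ U := by
    refine (rp_jn (bt (mids U) p ω.1) v).induct (P := fun x => x ∈ U) (hWU hv) ?_
    intro a b _ _ hab hm
    exact ((mem_mids hab).1 (bt_iff.1 hm).1).2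
  rw [e' _ hr]

lemma loc_eq {p r : ℝ} {U : Set V} {ω : Om × Om} {v : V} {m : ℤ} (hU : ∀ x, nrm (x - v) ≤ m → x ∈ U)
    (h : ¬ ∃ x, m ≤ nrm (x - v) ∧ jn (thr p ω.1) v x) :
    colA (mids U) ∅ true p r ω v = col p r ω v := by
  rw [colA_empty, col_eq]
  have : rp (bt (mids U) p ω.1) v = rp (thr p ω.1) v := by
    refine rp_congr fun w => ⟨fun h' => ?_, fun h' => ?_⟩
    · refine h'.mono fun m hm => ?_
      exact boolOf_iff.2 (bt_iff.1 hm).2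
    · refine h'.induct (P := fun x => jn (bt (mids U) p ω.1) v x) (jn.refl _ _) ?_
      intro a b ja ih hab hm
      refine ih.trans (jn.edge hab (bt_iff.2 ⟨(mem_mids hab).2 ⟨hU _ ?_, hU _ ?_⟩, boolOf_iff.1 hm⟩))
      · by_contra hc
        exact h ⟨a, by omega, ja⟩
      · by_contra hc
        exact h ⟨b, by omega, ja.trans (jn.edge hab hm)⟩
  rw [this]

lemma armP_at (q : ℝ) (m : ℕ) (y : V) :
    (PI V).real (cfg q ⁻¹' Ev Set.univ {y} {v | (m : ℤ) ≤ nrm (v - y)}) ≤ armP q m := by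
  rw [armP, ← bond_real q (Ev_meas _ _ _), ← bond_real q (Ev_meas _ _ _)]
  rw [← Perc.act_Ev (trE_lat y), ← map_measureReal_apply (act_meas _) (Ev_meas _ _ _), bond_inv q _ (trE_lat y)]
  refine measureReal_mono (Ev.mono (Set.subset_univ _) ?_ ?_)
  · intro v hv
    have hv : trE y v = y := hv
    rw [trE_apply] at hv
    have h1 := congrArg Prod.fst hv
    have h2 := congrArg Prod.snd hv
    simp only at h1 h2
    have : v = (0, 0) := Prod.ext (by show v.1 = 0; omega) (by show v.2 = 0; omega)
    rw [this]; rfl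
  · intro v hv
    have hv : (m : ℤ) ≤ nrm (trE y v - y) := hv
    have e : trE y v - y = v := by simp [trE]
    rw [e] at hv
    exact hv

def badS (p : ℝ) (N m : ℕ) : Set Om :=
  ⋃ v ∈ Bf N, cfg p ⁻¹' Ev Set.univ {v} {x | (m : ℤ) ≤ nrm (x - v)}

lemma badS_meas (p : ℝ) (N m : ℕ) : MeasurableSet (badS p N m) :=
  Finset.measurableSet_biUnion _ fun v _ => cfg_meas p (Ev_meas _ _ _)

lemma Bf_card (n : ℕ) : (Bf n).card ≤ (2 * n + 1) ^ 2 := by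
  have : Bf n ⊆ Finset.Icc (-(n : ℤ)) n ×ˢ Finset.Icc (-(n : ℤ)) n := by
    intro v hv
    have := nrm_le.1 (mem_Bf.1 hv)
    rw [Finset.mem_product, Finset.mem_Icc, Finset.mem_Icc]
    omega
  refine (Finset.card_le_card this).trans ?_
  rw [Finset.card_product, Int.card_Icc, sq]
  have : ((n : ℤ) + 1 - -(n : ℤ)).toNat = 2 * n + 1 := by omega
  rw [this]

lemma badS_le (p : ℝ) (N m : ℕ) : (PI V).real (badS p N m) ≤ ((2 * N + 1) ^ 2 : ℕ) * armP p m := by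
  refine (measureReal_biUnion_finset_le _ _).trans ?_
  refine (Finset.sum_le_card_nsmul _ _ (armP p m) fun v _ => armP_at p m v).trans ?_
  rw [nsmul_eq_mul]
  refine mul_le_mul_of_nonneg_right ?_ (armP_nonneg _ _)
  exact_mod_cast Bf_card N

lemma PP_fst {S : Set Om} : PP.real {ω | ω.1 ∈ S} = (PI V).real S := by
  have : {ω : Om × Om | ω.1 ∈ S} = S ×ˢ Set.univ := by ext ω; simp
  rw [this, PP, measureReal_prod_prod]; simp

lemma mix_core {p r : ℝ} {n : ℕ} (hn : 1 ≤ n) {W W' : Set V} {A B : Set EdgeCfg} (hW : W ⊆ BB (20 * n))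
    (hW' : W' ⊆ BB (20 * n)) (hd : ∀ u ∈ W, ∀ v ∈ W', (n : ℤ) ≤ nrm (u - v)) (dA : Dep W A) (dB : Dep W' B) :
    (dac p r).real (A ∩ B) ≤ (dac p r).real A * (dac p r).real B + 3 * (PI V).real (badS p (20 * n) (n / 3)) := by
  set m : ℕ := n / 3 with hm
  have fW : W.Finite := (bx_finite _ _ _ _).subset hW
  have fW' : W'.Finite := (bx_finite _ _ _ _).subset hW'
  have mA := dA.measurable fW
  have mB := dB.measurable fW'
  rw [dac_real _ _ mA, dac_real _ _ mB, dac_real _ _ (mA.inter mB)]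
  let U : Set V → Set V := fun W => {x | ∃ u ∈ W, nrm (x - u) ≤ m}
  have hWU : ∀ W, W ⊆ U W := fun W u hu => ⟨u, hu, by simp [nrm]⟩
  have hUU : Disjoint (U W) (U W') := by
    rw [Set.disjoint_left]
    rintro x ⟨u, hu, h⟩ ⟨v, hv, h'⟩
    have := hd u hu v hv
    rw [nrm_le] at h h'
    have h2 : nrm (u - v) ≤ 2 * m := by
      rw [nrm_le]
      simp only [Prod.fst_sub, Prod.snd_sub] at *
      omega
    omega
  set Bad : Set (Om × Om) := {ω | ω.1 ∈ badS p (20 * n) m} with hBad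
  have eb : PP.real Bad = (PI V).real (badS p (20 * n) m) := PP_fst
  rw [← eb]
  let LA : Set (Om × Om) := {ω | colA (mids (U W)) ∅ true p r ω ∈ site ⁻¹' A}
  let LB : Set (Om × Om) := {ω | colA (mids (U W')) ∅ true p r ω ∈ site ⁻¹' B}
  have eq : ∀ W : Set V, W ⊆ BB (20 * n) → ∀ ω, ω ∉ Bad → ∀ v ∈ W, colA (mids (U W)) ∅ true p r ω v = col p r ω v := by
    intro W hW ω hω v hv
    refine loc_eq (m := m) (fun x hx => ⟨v, hv, hx⟩) ?_
    rintro ⟨x, hx, hj⟩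
    refine hω ?_
    show ω.1 ∈ badS p (20 * n) m
    refine Set.mem_biUnion (x := v) ?_ ?_
    · have := mem_BB.1 (hW hv)
      exact mem_Bf.2 (by push_cast; exact this)
    · exact ⟨v, rfl, x, hx, hj⟩
  have iA : ∀ ω, ω ∉ Bad → (site (col p r ω) ∈ A ↔ ω ∈ LA) := by
    intro ω hω
    have e := eq W hW ω hω
    exact ⟨site_dep dA _ _ fun v hv => (e v hv).symm, site_dep dA _ _ e⟩
  have iB : ∀ ω, ω ∉ Bad → (site (col p r ω) ∈ B ↔ ω ∈ LB) := by
    intro ω hω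
    have e := eq W' hW' ω hω
    exact ⟨site_dep dB _ _ fun v hv => (e v hv).symm, site_dep dB _ _ e⟩
  have mLA : MeasurableSet LA := colA_meas _ _ _ _ _ (site_meas mA)
  have mLB : MeasurableSet LB := colA_meas _ _ _ _ _ (site_meas mB)
  have ind : PP.real (LA ∩ LB) = PP.real LA * PP.real LB :=
    prod_indep mLA mLB (loc_dep (hWU W) (site_dep dA)) (loc_dep (hWU W') (site_dep dB)) (mids_disjoint hUU) hUU
  have le : ∀ {X Y : Set (Om × Om)}, X ⊆ Y ∪ Bad → PP.real X ≤ PP.real Y + PP.real Bad := fun h =>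
    (measureReal_mono h (measure_ne_top _ _)).trans (measureReal_union_le _ _)
  have l1 : PP.real {ω | site (col p r ω) ∈ A ∩ B} ≤ PP.real (LA ∩ LB) + PP.real Bad := by
    refine le fun ω hω => ?_
    by_cases hb : ω ∈ Bad
    · exact .inr hb
    · exact .inl ⟨(iA ω hb).1 hω.1, (iB ω hb).1 hω.2⟩
  have l2 : PP.real LA ≤ PP.real {ω | site (col p r ω) ∈ A} + PP.real Bad := by
    refine le fun ω hω => ?_
    by_cases hb : ω ∈ Bad
    · exact .inr hb
    · exact .inl ((iA ω hb).2 hω)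
  have l3 : PP.real LB ≤ PP.real {ω | site (col p r ω) ∈ B} + PP.real Bad := by
    refine le fun ω hω => ?_
    by_cases hb : ω ∈ Bad
    · exact .inr hb
    · exact .inl ((iB ω hb).2 hω)
  have b0 : 0 ≤ PP.real Bad := measureReal_nonneg
  have x0 : 0 ≤ PP.real LA := measureReal_nonneg
  have x1 : PP.real LA ≤ 1 := measureReal_le_one
  have y0 : 0 ≤ PP.real {ω | site (col p r ω) ∈ B} := measureReal_nonneg
  have y1 : PP.real {ω | site (col p r ω) ∈ B} ≤ 1 := measureReal_le_one
  rw [ind] at l1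
  nlinarith [mul_le_mul_of_nonneg_left l3 x0, mul_le_mul_of_nonneg_right l2 y0, mul_le_mul_of_nonneg_right x1 b0,
    mul_le_mul_of_nonneg_left y1 b0]

lemma dac_mix {p : ℝ} (h0 : 0 ≤ p) (hp : p < 1 / 2) : ∃ C : ℝ, 0 ≤ C ∧ ∀ r, Mix (dac p r) (fun n => C / n) := by
  obtain ⟨K, hK, h⟩ := decay h0 hp
  refine ⟨3 * 1681 * 125 * K + 3, by positivity, fun r n hn W W' A B hW hW' hd dA dB => ?_⟩
  have n0 : (0 : ℝ) < n := by exact_mod_cast hn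
  have p0 : 0 ≤ (dac p r).real A * (dac p r).real B := mul_nonneg measureReal_nonneg measureReal_nonneg
  show _ ≤ _ + (3 * 1681 * 125 * K + 3) / (n : ℝ)
  by_cases h3 : n < 3
  · have l1 : (dac p r).real (A ∩ B) ≤ 1 := measureReal_le_one
    have h3' : (n : ℝ) ≤ 3 := by exact_mod_cast h3.le
    have : 1 ≤ (3 * 1681 * 125 * K + 3) / (n : ℝ) := by
      rw [le_div_iff₀ n0]; nlinarith
    linarith
  · refine (mix_core hn hW hW' hd dA dB).trans ?_
    have m5 : n ≤ 5 * (n / 3) := by omega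
    have m1 : 1 ≤ n / 3 := by omega
    have hm := h (n / 3) m1
    set m : ℕ := n / 3
    have m5' : (n : ℝ) ≤ 5 * m := by exact_mod_cast m5
    have m0 : (0 : ℝ) < m := by exact_mod_cast m1
    have k1 : K / (m : ℝ) ^ 3 ≤ 125 * K / (n : ℝ) ^ 3 := by
      rw [div_le_div_iff₀ (by positivity) (by positivity)]
      have : (n : ℝ) ^ 3 ≤ (5 * m) ^ 3 := pow_le_pow_left₀ n0.le m5' 3
      nlinarith
    have k2 := badS_le p (20 * n) m
    have k3 : (((2 * (20 * n) + 1) ^ 2 : ℕ) : ℝ) ≤ 1681 * (n : ℝ) ^ 2 := by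
      have : (2 * (20 * n) + 1) ^ 2 ≤ 1681 * n ^ 2 := by nlinarith
      exact_mod_cast this
    have k4 : (PI V).real (badS p (20 * n) m) ≤ 1681 * (n : ℝ) ^ 2 * (125 * K / (n : ℝ) ^ 3) :=
      k2.trans (mul_le_mul k3 (hm.trans k1) (armP_nonneg _ _) (by positivity))
    have k5 : 1681 * (n : ℝ) ^ 2 * (125 * K / (n : ℝ) ^ 3) = 1681 * 125 * K / n := by
      field_simp
    rw [k5] at k4
    have k6 : (3 * 1681 * 125 * K + 3) / (n : ℝ) = 3 * (1681 * 125 * K / n) + 3 / n := by ring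
    have k7 : 0 ≤ 3 / (n : ℝ) := by positivity
    rw [k6]; linarith

end DaC


namespace DaC

/-! ## Part 4: conclusion -/

def far (L : ℕ) : Set V := {v | (L : ℤ) ≤ nrm v}

/-- The origin is in an infinite cluster. -/
def InfE : Set EdgeCfg := ⋂ L : ℕ, Ev Set.univ {(0, 0)} (far L)

lemma InfE_meas : MeasurableSet InfE := MeasurableSet.iInter fun L => Ev_meas _ _ _

lemma ostep_site {ξ : V → Bool} {a b : V} : ostep (site ξ) a b ↔ SqAdj a b ∧ ξ a = true ∧ ξ b = true := by
  simp only [ostep, site, Bool.and_eq_true, boolOf_iff]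
  constructor
  · rintro ⟨h, ⟨_, h2⟩, _⟩; exact ⟨h, h2⟩
  · rintro ⟨h, h2⟩; exact ⟨h, ⟨h, h2⟩, h.symm, h2.2, h2.1⟩

lemma monoConn_iff {ξ : V → Bool} {u v : V} : MonoConn SqAdj ξ true u v ↔ CI (site ξ) Set.univ u v := by
  constructor
  · intro h
    exact ⟨Set.mem_univ _, rtg_mono (fun a b h => ⟨ostep_site.2 h, Set.mem_univ _, Set.mem_univ _⟩) h⟩
  · intro h
    exact rtg_mono (fun a b h => ostep_site.1 h.1) h.2

lemma mono_inf {ξ : V → Bool} : (monoCluster SqAdj ξ true origin).Infinite ↔ site ξ ∈ InfE := by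
  constructor
  · intro h
    refine Set.mem_iInter.2 fun L => ?_
    have : ∃ w ∈ monoCluster SqAdj ξ true origin, w ∉ BB L := by
      by_contra hc
      push Not at hc
      exact h ((bx_finite _ _ _ _).subset hc)
    obtain ⟨w, hw, hL⟩ := this
    refine ⟨(0, 0), rfl, w, ?_, monoConn_iff.1 hw.2⟩
    rw [mem_BB] at hL
    show (L : ℤ) ≤ nrm w
    omega
  · intro h hf
    have : ∃ L : ℕ, ∀ w ∈ monoCluster SqAdj ξ true origin, nrm w ≤ L := by
      obtain ⟨M, hM⟩ := (hf.image nrm).bddAbove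
      exact ⟨M.toNat, fun w hw => (hM ⟨w, hw, rfl⟩).trans (by omega)⟩
    obtain ⟨L, hL⟩ := this
    obtain ⟨u, hu, v, hv, hc⟩ := Set.mem_iInter.1 h (L + 1)
    have hu : u = (0, 0) := hu
    subst hu
    have hv : ((L + 1 : ℕ) : ℤ) ≤ nrm v := hv
    have hm := monoConn_iff.2 hc
    have h0 : ξ (0, 0) = true := by
      rcases Relation.ReflTransGen.cases_head hm with e | ⟨c, hc, _⟩
      · rw [← e] at hv
        simp [nrm] at hv
        omega
      · exact hc.2.1
    have := hL v ⟨h0, hm⟩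
    push_cast at hv
    omega

lemma edgeCfg_lab (p x : ℝ) : edgeCfg SqAdj p x = cfg p (lab x).1 := by
  funext a b
  rw [Bool.eq_iff_iff, cfg_iff]
  simp only [edgeCfg, Bool.and_eq_true, boolOf_iff]
  refine and_congr_right fun h => ?_
  show unif (2 * eIdx a b) x < p ↔ unif (eIx (a + b)) x < p
  rw [eIx_adj h]

lemma colourCfg_lab (p r x : ℝ) : colourCfg SqAdj p r x = col p r (lab x) := by
  funext v
  rw [col_eq]
  simp only [colourCfg, edgeCfg_lab]
  rfl

def GG (p r : ℝ) : Set (Om × Om) := {ω | site (col p r ω) ∈ InfE}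

lemma GG_meas (p r : ℝ) : MeasurableSet (GG p r) := sc_meas p r InfE_meas

lemma theta_eq (p r : ℝ) : thetaSq p r = PP (GG p r) := by
  have e1 : (fun x => (edgeCfg SqAdj p x, colourCfg SqAdj p r x)) =
      (fun ω : Om × Om => (cfg p ω.1, col p r ω)) ∘ lab := by
    funext x
    simp only [edgeCfg_lab, colourCfg_lab, Function.comp]
  have m1 : Measurable (fun ω : Om × Om => (cfg p ω.1, col p r ω)) :=
    ((cfg_meas p).comp measurable_fst).prodMk (col_meas p r)
  have e2 : {ω : Config | (monoCluster SqAdj ω.2 true origin).Infinite} = {ω : Config | site ω.2 ∈ InfE} := by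
    ext ω; exact mono_inf
  have m2 : MeasurableSet {ω : Config | site ω.2 ∈ InfE} := (site_meas.comp measurable_snd) InfE_meas
  rw [thetaSq, percProb, DaCMeasure, e1, ← Measure.map_map m1 lab_meas, lab_law, e2, Measure.map_apply m1 m2]
  rfl

lemma col_le {p r s : ℝ} (h : r ≤ s) (ω : Om × Om) : cle (site (col p r ω)) (site (col p s ω)) := by
  intro a b
  simp only [site, Bool.and_eq_true, col_iff]
  exact fun k => ⟨k.1, k.2.1.trans_le h, k.2.2.trans_le h⟩

lemma GG_mono {p r s : ℝ} (h : r ≤ s) : GG p r ⊆ GG p s := by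
  intro ω hω
  refine Set.mem_iInter.2 fun L => ?_
  exact Ev.inc _ _ _ _ _ (col_le h ω) (Set.mem_iInter.1 hω L)

lemma ae_ne (r : ℝ) : ∀ᵐ ω ∂PP, ∀ v : V, ω.2 v ≠ r := by
  rw [ae_all_iff]
  intro v
  have h1 : (PI V).real {ω : Om | ω v ∈ ({r} : Set ℝ)} = 0 := by
    rw [pi_coord v (measurableSet_singleton r), measureReal_def]
    have : base {r} = 0 := by
      refine le_antisymm ((Measure.restrict_apply_le _ _).trans ?_) bot_le
      simp
    rw [this]; rfl
  have h2 : PP.real {ω : Om × Om | ω.2 v = r} = 0 := by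
    have : {ω : Om × Om | ω.2 v = r} = Set.univ ×ˢ {ω : Om | ω v ∈ ({r} : Set ℝ)} := by ext ω; simp
    rw [this, PP, measureReal_prod_prod, h1, mul_zero]
  rw [ae_iff]
  simp only [not_not]
  exact (measureReal_eq_zero_iff (measure_ne_top _ _)).1 h2

lemma stab {p r : ℝ} {ω : Om × Om} (h : ∀ v : V, ω.2 v ≠ r) {W : Set V} (hW : W.Finite) :
    ∀ᶠ s in nhds r, ∀ v ∈ W, col p s ω v = col p r ω v := by
  rw [Filter.eventually_all_finite hW]
  intro v _
  rcases lt_or_gt_of_ne (h (rp (thr p ω.1) v)) with h' | h'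
  · filter_upwards [lt_mem_nhds h'] with s hs
    rw [Bool.eq_iff_iff, col_iff, col_iff]; tauto
  · filter_upwards [gt_mem_nhds h'] with s hs
    rw [Bool.eq_iff_iff, col_iff, col_iff]
    constructor <;> intro k <;> linarith

lemma stab_dep {p r : ℝ} {ω : Om × Om} (h : ∀ v : V, ω.2 v ≠ r) {W : Set V} (hW : W.Finite) {A : Set EdgeCfg} (d : Dep W A) :
    ∀ᶠ s in nhds r, (site (col p s ω) ∈ A ↔ site (col p r ω) ∈ A) := by
  filter_upwards [stab (p := p) h hW] with s hs
  exact ⟨site_dep d _ _ hs, site_dep d _ _ fun v hv => (hs v hv).symm⟩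

lemma local_cont (p r : ℝ) {W : Set V} (hW : W.Finite) {A : Set EdgeCfg} (d : Dep W A) :
    Filter.Tendsto (fun s => (dac p s).real A) (nhds r) (nhds ((dac p r).real A)) := by
  have mA := d.measurable hW
  simp only [dac_real _ _ mA]
  refine (ENNReal.tendsto_toReal (measure_ne_top _ _)).comp
    (tendsto_measure_of_ae_tendsto_indicator_of_isFiniteMeasure (nhds r) (sc_meas p r mA) (fun s => sc_meas p s mA) ?_)
  filter_upwards [ae_ne r] with ω hω
  exact stab_dep hω hW d

lemma InfE_box {η : EdgeCfg} (h : η ∈ InfE) (L : ℕ) : η ∈ Ev (BB L) {(0, 0)} (far L) := by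
  obtain ⟨u, hu, v, hv, hc⟩ := Set.mem_iInter.1 h L
  have hu' : u = (0, 0) := hu
  subst hu'
  obtain ⟨v', e, h'⟩ := hc.haltAt nrm lip_nrm L (by simp [nrm]) hv
  exact ⟨(0, 0), rfl, v', e.ge, h'.mono fun x hx => mem_BB.2 hx.2⟩

lemma right_cont (p r : ℝ) {b : ℝ≥0∞} (hb : PP (GG p r) < b) : ∃ s, r < s ∧ PP (GG p s) < b := by
  let t : ℕ → ℝ := fun k => r + 1 / ((k : ℝ) + 1)
  have ht : Filter.Tendsto t Filter.atTop (nhds r) := by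
    have := (tendsto_const_nhds (x := r)).add (tendsto_one_div_add_atTop_nhds_zero_nat (𝕜 := ℝ))
    simpa [t] using this
  have hrt : ∀ k, r < t k := fun k => by
    have : (0 : ℝ) < 1 / ((k : ℝ) + 1) := by positivity
    show r < r + _
    linarith
  have anti : Antitone fun k => GG p (t k) := by
    intro i j hij
    refine GG_mono ?_
    have : (1 : ℝ) / ((j : ℝ) + 1) ≤ 1 / ((i : ℝ) + 1) := by
      have : (i : ℝ) ≤ j := by exact_mod_cast hij
      gcongr
    show r + _ ≤ r + _
    linarith
  have lim := tendsto_measure_iInter_atTop (μ := PP) (fun k => (GG_meas p (t k)).nullMeasurableSet) anti ⟨0, measure_ne_top _ _⟩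
  have le : PP (⋂ k, GG p (t k)) ≤ PP (GG p r) := by
    refine measure_mono_ae ?_
    filter_upwards [ae_ne r] with ω hω hin
    refine Set.mem_iInter.2 fun L => ?_
    have ev := ht.eventually (stab_dep (p := p) hω (bx_finite _ _ _ _) (Ev.dep (BB L) {(0, 0)} (far L)))
    obtain ⟨k, hk⟩ := ev.exists
    exact Ev.mono (Set.subset_univ _) le_rfl le_rfl (hk.1 (InfE_box (Set.mem_iInter.1 hin k) L))
  obtain ⟨k, hk⟩ := (lim.eventually (gt_mem_nhds (le.trans_lt hb))).exists
  exact ⟨t k, hrt k, hk⟩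

lemma left_cont {p r : ℝ} (hp0 : 0 ≤ p) (hp : p < 1 / 2) (hr0 : 0 < r) (hr1 : r ≤ 1) {a : ℝ≥0∞} (ha : a < PP (GG p r)) :
    ∃ s, s < r ∧ a < PP (GG p s) := by
  obtain ⟨C, hC, hM⟩ := dac_mix hp0 hp
  have pr : 0 < PP.real (GG p r) := by
    rw [measureReal_def]
    exact ENNReal.toReal_pos (bot_le.trans_lt ha).ne' (measure_ne_top _ _)
  have perc := dac_perc hp0 (by linarith) hr0.le hr1
  have hε : Filter.Tendsto (fun n : ℕ => C / (n : ℝ)) Filter.atTop (nhds 0) := tendsto_const_div_atTop_nhds_zero_nat C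
  have harm : ∀ n : ℕ, PP.real (GG p r) ≤ (dac p r).real (Ev (BB n) {(0, 0)} {v | (n : ℤ) ≤ nrm v}) := by
    intro n
    rw [dac_real _ _ (Ev_meas _ _ _)]
    exact measureReal_mono (fun ω hω => InfE_box hω n) (measure_ne_top _ _)
  obtain ⟨n, hn0, hn1, hnP⟩ := perc.long_to_one (hM r) hε pr harm (1 / 600) (by norm_num) ⌈1200 * C⌉₊
  have hnC : 1200 * C ≤ n := (Nat.le_ceil _).trans (by exact_mod_cast hn0)
  -- a smaller parameter
  have ev : ∀ᶠ s in nhds r, 1 - 1 / 600 < hP (dac p s) (2 * n) n :=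
    (local_cont p r (bx_finite _ _ _ _) (LR.dep 0 (2 * n) 0 n)).eventually (lt_mem_nhds hnP)
  obtain ⟨r', ⟨h1, h2⟩, h3⟩ : ∃ r', (1 - 1 / 600 < hP (dac p r') (2 * n) n ∧ 0 < r') ∧ r' < r := by
    have e2 : ∀ᶠ s in nhds r, 0 < s := lt_mem_nhds hr0
    have := ((ev.and e2).filter_mono nhdsWithin_le_nhds).and (self_mem_nhdsWithin : Set.Iio r ∈ nhdsWithin r (Set.Iio r))
    exact this.exists
  have perc' := dac_perc (r := r') hp0 (by linarith) h2.le (by linarith)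
  have ae1 := perc'.renorm_ae (hM r') hC (fun n _ => le_rfl) hn1 hnC (by linarith)
  have ae2 : ∀ᵐ ω ∂PP, ∃ k0 : ℕ, ∀ k, k0 ≤ k → site (col p r' ω) ∈ Perc.Zev (5 ^ k * n : ℕ) :=
    ae_of_ae_map (sc_meas p r').aemeasurable ae1
  -- the sequence
  let t : ℕ → ℝ := fun k => r - (r - r') * (1 / ((k : ℝ) + 1))
  have ht : Filter.Tendsto t Filter.atTop (nhds r) := by
    have := (tendsto_const_nhds (x := r)).sub ((tendsto_one_div_add_atTop_nhds_zero_nat (𝕜 := ℝ)).const_mul (r - r'))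
    simpa [t] using this
  have htr : ∀ k, t k < r := fun k => by
    have : (0 : ℝ) < (r - r') * (1 / ((k : ℝ) + 1)) := mul_pos (by linarith) (by positivity)
    show r - _ < r
    linarith
  have hmono : Monotone t := by
    intro i j hij
    have h : (1 : ℝ) / ((j : ℝ) + 1) ≤ 1 / ((i : ℝ) + 1) := by
      have : (i : ℝ) ≤ j := by exact_mod_cast hij
      gcongr
    have := mul_le_mul_of_nonneg_left h (show 0 ≤ r - r' by linarith)
    show r - _ ≤ r - _
    linarith
  have ht0 : ∀ k, r' ≤ t k := fun k => by
    have := hmono (Nat.zero_le k)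
    have e : t 0 = r' := by simp [t]
    linarith
  have le : PP (GG p r) ≤ PP (⋃ k, GG p (t k)) := by
    refine measure_mono_ae ?_
    filter_upwards [ae_ne r, ae2] with ω hω hz hin
    obtain ⟨k0, hk0⟩ := hz
    obtain ⟨z, hz1, hz2⟩ := chain_infinite hn1 hk0
    obtain ⟨x, hx1, hx2⟩ := hz2 (site (col p r ω)) (0, 0) (fun L => by
      obtain ⟨u, hu, v, hv, hc⟩ := Set.mem_iInter.1 hin L.toNat
      have hu' : u = (0, 0) := hu
      subst hu'
      have hv : ((L.toNat : ℕ) : ℤ) ≤ nrm v := hv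
      exact ⟨v, by omega, hc⟩)
    obtain ⟨N, hN⟩ := hx1.bounded
    have ev := ht.eventually (stab_dep (p := p) hω ((bx_finite (-(N : ℤ)) N (-N) N).subset Set.inter_subset_right)
      (Ev.dep (Set.univ ∩ BB N) {(0, 0)} {x}))
    obtain ⟨k, hk⟩ := ev.exists
    obtain ⟨u, hu, x', hx', hc⟩ := hk.2 ⟨(0, 0), rfl, x, rfl, hN⟩
    have hu' : u = (0, 0) := hu
    have hx'' : x' = x := hx'
    subst hu'
    subst hx''
    refine Set.mem_iUnion.2 ⟨k, Set.mem_iInter.2 fun L => ?_⟩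
    obtain ⟨v, hv, hzv⟩ := hz1 L
    have up : ∀ {a b}, CI (site (col p r' ω)) Set.univ a b → CI (site (col p (t k) ω)) Set.univ a b :=
      fun h => h.mono_cfg (col_le (ht0 k) ω)
    exact ⟨(0, 0), rfl, v, hv, ((hc.mono (Set.subset_univ _)).trans (up hx2).symm).trans (up hzv)⟩
  have lim := tendsto_measure_iUnion_atTop (μ := PP) (s := fun k => GG p (t k)) (fun i j h => GG_mono (hmono h))
  obtain ⟨k, hk⟩ := (lim.eventually (lt_mem_nhds (ha.trans_le le))).exists
  exact ⟨t k, htr k, hk⟩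

/-- For every `p < 1/2`, the percolation function `r ↦ Θ(p,r)` is continuous
on `[0,1]`. -/
theorem theta_continuousOn (p : ℝ) (hp0 : 0 ≤ p) (hp : p < 1 / 2) :
    ContinuousOn (fun r : ℝ => thetaSq p r) (Set.Icc 0 1) := by
  intro r hr
  simp only [ContinuousWithinAt, theta_eq]
  refine tendsto_order.2 ⟨fun a ha => ?_, fun b hb => ?_⟩
  · rcases hr.1.eq_or_lt with e | h
    · filter_upwards [self_mem_nhdsWithin] with s hs
      exact ha.trans_le (measure_mono (GG_mono (e ▸ hs.1)))
    · obtain ⟨s, hs, h'⟩ := left_cont hp0 hp h hr.2 ha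
      filter_upwards [nhdsWithin_le_nhds (lt_mem_nhds hs)] with u hu
      exact h'.trans_le (measure_mono (GG_mono (le_of_lt hu)))
  · obtain ⟨s, hs, h'⟩ := right_cont p r hb
    filter_upwards [nhdsWithin_le_nhds (gt_mem_nhds hs)] with u hu
    exact (measure_mono (GG_mono (le_of_lt hu))).trans_lt h'

end DaC
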